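/- (Bott periodicity, orthogonal case.) For every integer k ≥ 1 there exists an integer N such that for all n, m ≥ N, the k-th homotopy group of the orthogonal group O(n) is isomorphic to the (k+8)-th homotopy group of O(m); that is, the stable homotopy groups of the orthogonal group are periodic of period 8. -/

import Mathlib

open scoped Topology

namespace Bott

open unitInterval Set

/-- `f` and `g` are homotopic through maps with values in `Y`, relative to `A`. -/
def HtpyRel {X E : Type*} [TopologicalSpace X] [TopologicalSpace E] (Y : Set E) (A : Set X)
    (f g : X → E) : Prop :=
  ∃ H : I × X → E, Continuous H ∧ (∀ p, H p ∈ Y) ∧ (∀ x, H (0, x) = f x) ∧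
    (∀ x, H (1, x) = g x) ∧ ∀ t, ∀ x ∈ A, H (t, x) = f x

namespace HtpyRel

variable {X X' E E' : Type*} [TopologicalSpace X] [TopologicalSpace X'] [TopologicalSpace E]
  [TopologicalSpace E'] {Y : Set E} {Y' : Set E'} {A : Set X} {f g h : X → E}

theorem refl (hf : Continuous f) (hY : ∀ x, f x ∈ Y) : HtpyRel Y A f f :=
  ⟨fun p => f p.2, by fun_prop, fun p => hY _, fun _ => rfl, fun _ => rfl, fun _ _ _ => rfl⟩

theorem eqOn (H : HtpyRel Y A f g) {x : X} (hx : x ∈ A) : g x = f x := by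
  obtain ⟨H, -, -, -, h1, hA⟩ := H
  rw [← h1, hA _ _ hx]

theorem continuous_left (H : HtpyRel Y A f g) : Continuous f := by
  obtain ⟨H, hc, -, h0, -, -⟩ := H
  have : f = fun x => H (0, x) := by funext x; rw [h0]
  rw [this]; fun_prop

theorem mem_left (H : HtpyRel Y A f g) (x : X) : f x ∈ Y := by
  obtain ⟨H, hc, hY, h0, -, -⟩ := H
  rw [← h0]; exact hY _

theorem symm (H : HtpyRel Y A f g) : HtpyRel Y A g f := by
  have hAg := fun x hx => H.eqOn (x := x) hx
  obtain ⟨H, hc, hY, h0, h1, hA⟩ := H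
  refine ⟨fun p => H (σ p.1, p.2), by fun_prop, fun p => hY _, fun x => by simp [h1],
    fun x => by simp [h0], fun t x hx => by rw [hAg x hx]; exact hA _ _ hx⟩

theorem continuous_right (H : HtpyRel Y A f g) : Continuous g := H.symm.continuous_left

theorem mem_right (H : HtpyRel Y A f g) (x : X) : g x ∈ Y := H.symm.mem_left x

theorem trans (H : HtpyRel Y A f g) (K : HtpyRel Y A g h) : HtpyRel Y A f h := by
  have hAg := fun x hx => H.eqOn (x := x) hx
  obtain ⟨H, hc, hY, h0, h1, hA⟩ := H
  obtain ⟨K, kc, kY, k0, k1, kA⟩ := K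
  refine ⟨fun p => if (p.1 : ℝ) ≤ 1 / 2 then H (projIcc 0 1 zero_le_one (2 * p.1), p.2)
    else K (projIcc 0 1 zero_le_one (2 * p.1 - 1), p.2), ?_, ?_, ?_, ?_, ?_⟩
  · refine Continuous.if_le ?_ ?_ (by fun_prop) (by fun_prop) ?_
    · exact hc.comp ((continuous_projIcc.comp (by fun_prop)).prodMk continuous_snd)
    · exact kc.comp ((continuous_projIcc.comp (by fun_prop)).prodMk continuous_snd)
    · intro p hp
      rw [hp]; norm_num [h1, k0]
  · intro p; beta_reduce; split_ifs
    · exact hY _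
    · exact kY _
  · intro x; simp [h0]
  · intro x; norm_num; exact k1 x
  · intro t x hx
    simp only
    split_ifs
    · exact hA _ _ hx
    · rw [kA _ _ hx, hAg _ hx]

theorem mono {A' : Set X} {Y₂ : Set E} (H : HtpyRel Y A f g) (hA : A' ⊆ A) (hY : Y ⊆ Y₂) :
    HtpyRel Y₂ A' f g := by
  obtain ⟨H, hc, hY', h0, h1, hA'⟩ := H
  exact ⟨H, hc, fun p => hY (hY' p), h0, h1, fun t x hx => hA' t x (hA hx)⟩

/-- Postcomposition with a map that may depend on the base point. -/
theorem map (H : HtpyRel Y A f g) (φ : X → E → E') (hφ : Continuous fun p : X × E => φ p.1 p.2)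
    (hY : ∀ x, ∀ y ∈ Y, φ x y ∈ Y') :
    HtpyRel Y' A (fun x => φ x (f x)) (fun x => φ x (g x)) := by
  obtain ⟨H, hc, hY', h0, h1, hA'⟩ := H
  refine ⟨fun p => φ p.2 (H p), hφ.comp (continuous_snd.prodMk hc), fun p => hY _ _ (hY' _),
    fun x => by simp [h0], fun x => by simp [h1], fun t x hx => by simp [hA' t x hx]⟩

theorem comp (H : HtpyRel Y A f g) {A' : Set X'} (φ : X' → X) (hφ : Continuous φ)
    (hA : ∀ x ∈ A', φ x ∈ A) : HtpyRel Y A' (fun x => f (φ x)) (fun x => g (φ x)) := by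
  obtain ⟨H, hc, hY', h0, h1, hA'⟩ := H
  exact ⟨fun p => H (p.1, φ p.2), hc.comp (by fun_prop), fun p => hY' _, fun x => h0 _,
    fun x => h1 _, fun t x hx => hA' t _ (hA x hx)⟩

theorem map₂ {E₂ : Type*} [TopologicalSpace E₂] {Y₂ : Set E₂} {f' g' : X → E'}
    (H : HtpyRel Y A f g) (K : HtpyRel Y' A f' g')
    (φ : X → E → E' → E₂) (hφ : Continuous fun p : X × E × E' => φ p.1 p.2.1 p.2.2)
    (hY : ∀ x, ∀ y ∈ Y, ∀ y' ∈ Y', φ x y y' ∈ Y₂) :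
    HtpyRel Y₂ A (fun x => φ x (f x) (f' x)) (fun x => φ x (g x) (g' x)) := by
  obtain ⟨H, hc, hY', h0, h1, hA'⟩ := H
  obtain ⟨K, kc, kY', k0, k1, kA'⟩ := K
  refine ⟨fun p => φ p.2 (H p) (K p), hφ.comp (continuous_snd.prodMk (hc.prodMk kc)),
    fun p => hY _ _ (hY' _) _ (kY' _),
    fun x => by simp [h0, k0], fun x => by simp [h1, k1], fun t x hx => by
      simp [hA' t x hx, kA' t x hx]⟩

/-- A homotopy given by a continuous family over the real segment `[0, b]`. -/
theorem of_real (b : ℝ) (hb : 0 ≤ b) (H : ℝ → X → E) (hc : Continuous fun p : ℝ × X => H p.1 p.2)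
    (hY : ∀ t ∈ Icc 0 b, ∀ x, H t x ∈ Y) (h0 : ∀ x, H 0 x = f x) (h1 : ∀ x, H b x = g x)
    (hA : ∀ t ∈ Icc 0 b, ∀ x ∈ A, H t x = f x) : HtpyRel Y A f g := by
  have hm : ∀ t : I, b * (t : ℝ) ∈ Icc 0 b := fun t =>
    ⟨mul_nonneg hb t.2.1, mul_le_of_le_one_right hb t.2.2⟩
  refine ⟨fun p => H (b * p.1) p.2, ?_, fun p => hY _ (hm _) _, fun x => by simp [h0],
    fun x => by simp [h1], fun t x hx => hA _ (hm t) x hx⟩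
  exact hc.comp (by fun_prop : Continuous fun p : I × X => (b * (p.1 : ℝ), p.2))

theorem congr (H : HtpyRel Y A f g) {f' g' : X → E} (hf : ∀ x, f' x = f x) (hg : ∀ x, g' x = g x) :
    HtpyRel Y A f' g' := by
  rwa [show f' = f from funext hf, show g' = g from funext hg]

end HtpyRel

section Cube

variable {n : ℕ} {E : Type*} [TopologicalSpace E] {Y : Set E}

/-- Distance of a point of the cube to the centre, normalised to be `1` on the boundary. -/
noncomputable def cubeRad (y : Fin n → I) : ℝ := ‖fun i => 2 * (y i : ℝ) - 1‖

@[fun_prop]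
theorem continuous_cubeRad : Continuous (cubeRad (n := n)) := by
  unfold cubeRad; fun_prop

theorem cubeRad_le_one (y : Fin n → I) : cubeRad y ≤ 1 := by
  refine (pi_norm_le_iff_of_nonneg zero_le_one).2 fun i => ?_
  have h := (y i).2
  rw [Real.norm_eq_abs, abs_le]; constructor <;> linarith [h.1, h.2]

theorem cubeRad_eq_one {y : Fin n → I} (hy : y ∈ Cube.boundary (Fin n)) : cubeRad y = 1 := by
  refine le_antisymm (cubeRad_le_one y) ?_
  obtain ⟨i, hi⟩ := hy
  have := norm_le_pi_norm (fun i => 2 * (y i : ℝ) - 1) i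
  rcases hi with hi | hi <;> norm_num [hi] at this <;> exact this

theorem mem_boundary_of_cubeRad {y : Fin n → I} (hy : cubeRad y = 1) :
    y ∈ Cube.boundary (Fin n) := by
  by_contra hcon
  have hlt : cubeRad y < 1 := by
    refine (pi_norm_lt_iff zero_lt_one).2 fun i => ?_
    have h0 : (y i : ℝ) ≠ 0 := fun h => hcon ⟨i, Or.inl (Subtype.ext h)⟩
    have h1 : (y i : ℝ) ≠ 1 := fun h => hcon ⟨i, Or.inr (Subtype.ext h)⟩
    have h := (y i).2
    have h0' := lt_of_le_of_ne h.1 h0.symm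
    have h1' := lt_of_le_of_ne h.2 h1
    rw [Real.norm_eq_abs, abs_lt]; constructor <;> linarith
  exact hlt.ne hy

/-- The radial expansion of the cube by the factor `1 / max (cubeRad y) s`. -/
noncomputable def cubeExp (s : ℝ) (y : Fin n → I) : Fin n → I := fun i =>
  projIcc 0 1 zero_le_one (1 / 2 + ((y i : ℝ) - 1 / 2) / max (cubeRad y) s)

theorem continuousOn_cubeExp {Z : Type*} [TopologicalSpace Z] {s : Z → ℝ} {y : Z → Fin n → I}
    (hs : Continuous s) (hy : Continuous y) (h : ∀ z, 0 < s z) :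
    Continuous fun z => cubeExp (s z) (y z) := by
  unfold cubeExp
  refine continuous_pi fun i => continuous_projIcc.comp ?_
  refine continuous_const.add (Continuous.div (by fun_prop) (by fun_prop) fun z => ?_)
  exact (lt_max_of_lt_right (h z)).ne'

theorem cubeExp_of_boundary {s : ℝ} (hs : s ≤ 1) {y : Fin n → I} (hy : y ∈ Cube.boundary (Fin n)) :
    cubeExp s y = y := by
  funext i
  simp [cubeExp, cubeRad_eq_one hy, hs]

theorem cubeExp_one (y : Fin n → I) : cubeExp 1 y = y := by
  funext i
  simp [cubeExp, cubeRad_le_one y]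

theorem cubeExp_mem_boundary {s : ℝ} (hs : 0 < s) {y : Fin n → I} (hy : s ≤ cubeRad y) :
    cubeExp s y ∈ Cube.boundary (Fin n) := by
  apply mem_boundary_of_cubeRad
  have hpos : 0 < cubeRad y := hs.trans_le hy
  have : (fun i => 2 * (cubeExp s y i : ℝ) - 1) = (cubeRad y)⁻¹ • fun i => 2 * (y i : ℝ) - 1 := by
    funext i
    have hi := norm_le_pi_norm (fun i => 2 * (y i : ℝ) - 1) i
    change _ ≤ cubeRad y at hi
    rw [Real.norm_eq_abs, abs_le] at hi
    have hd : ((y i : ℝ) - 1 / 2) / cubeRad y ∈ Icc (-1 / 2 : ℝ) (1 / 2) := by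
      constructor
      · rw [le_div_iff₀ hpos]; linarith
      · rw [div_le_iff₀ hpos]; linarith
    simp only [cubeExp, max_eq_left hy, coe_projIcc, Pi.smul_apply, smul_eq_mul]
    rw [min_eq_right (by linarith [hd.2]), max_eq_right (by linarith [hd.1])]
    field_simp
    ring
  rw [cubeRad, this, norm_smul, norm_inv, Real.norm_of_nonneg hpos.le]
  exact inv_mul_cancel₀ hpos.ne'

/-- Homotopy extension for the boundary of a cube. -/
theorem cube_hep {b : (Fin n → I) → E} (hb : Continuous b) (hbY : ∀ y, b y ∈ Y)
    (p : I × (Fin n → I) → E) (hp : Continuous p) (hpY : ∀ q, p q ∈ Y)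
    (h0 : ∀ y ∈ Cube.boundary (Fin n), p (0, y) = b y) :
    ∃ H : I × (Fin n → I) → E, Continuous H ∧ (∀ q, H q ∈ Y) ∧ (∀ y, H (0, y) = b y) ∧
      ∀ t, ∀ y ∈ Cube.boundary (Fin n), H (t, y) = p (t, y) := by
  have hpos : ∀ t : I, 0 < 1 + (t : ℝ) := fun t => by linarith [t.2.1]
  have hce : Continuous fun q : I × (Fin n → I) => cubeExp (1 / (1 + (q.1 : ℝ))) q.2 :=
    continuousOn_cubeExp (continuous_const.div (by fun_prop) fun q => (hpos _).ne')
      continuous_snd fun q => one_div_pos.2 (hpos _)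
  refine ⟨fun q => if (1 + (q.1 : ℝ)) * cubeRad q.2 ≤ 1 then b (cubeExp (1 / (1 + (q.1 : ℝ))) q.2)
    else p (projIcc 0 1 zero_le_one ((1 + (q.1 : ℝ)) * cubeRad q.2 - 1),
      cubeExp (1 / (1 + (q.1 : ℝ))) q.2), ?_, ?_, ?_, ?_⟩
  · refine Continuous.if_le (hb.comp hce) (hp.comp ((continuous_projIcc.comp ?_).prodMk hce))
      ?_ continuous_const ?_
    · fun_prop
    · fun_prop
    · intro q hq
      rw [hq, sub_self, projIcc_left]
      refine (h0 _ (cubeExp_mem_boundary (one_div_pos.2 (hpos _)) ?_)).symm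
      rw [div_le_iff₀ (hpos _), mul_comm, hq]
  · intro q; beta_reduce; split_ifs
    · exact hbY _
    · exact hpY _
  · intro y
    simp [cubeRad_le_one, cubeExp_one]
  · intro t y hy
    have h1 : 1 / (1 + (t : ℝ)) ≤ 1 := by
      rw [div_le_iff₀ (hpos _)]; linarith [t.2.1]
    simp only [cubeRad_eq_one hy, cubeExp_of_boundary h1 hy, mul_one]
    split_ifs with h
    · have : t = 0 := Subtype.ext (le_antisymm (by simpa using h) t.2.1)
      rw [this, h0 _ hy]
    · simp

/-- If two free homotopies agree on the boundary of the cube, a homotopy relative to the boundary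
between their starting points yields one between their end points. -/
theorem HtpyRel.transfer {H K : I × (Fin n → I) → E} (hH : Continuous H) (hK : Continuous K)
    (hHY : ∀ q, H q ∈ Y) (hKY : ∀ q, K q ∈ Y)
    (hHK : ∀ t, ∀ y ∈ Cube.boundary (Fin n), H (t, y) = K (t, y))
    (R : HtpyRel Y (Cube.boundary (Fin n)) (fun y => H (0, y)) (fun y => K (0, y))) :
    HtpyRel Y (Cube.boundary (Fin n)) (fun y => H (1, y)) (fun y => K (1, y)) := by
  have hproj : Continuous fun y : Fin n → I => projIcc (0 : ℝ) 1 zero_le_one (2 * cubeRad y - 1) :=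
    continuous_projIcc.comp (by fun_prop)
  have hexp : Continuous fun y : Fin n → I => cubeExp (1 / 2) y :=
    continuousOn_cubeExp continuous_const continuous_id fun _ => by norm_num
  have hb1 : ∀ y ∈ Cube.boundary (Fin n), projIcc (0 : ℝ) 1 zero_le_one (2 * cubeRad y - 1) = 1 := by
    intro y hy
    rw [cubeRad_eq_one hy]; norm_num
  have key : ∀ {L : I × (Fin n → I) → E}, Continuous L → (∀ q, L q ∈ Y) →
      HtpyRel Y (Cube.boundary (Fin n)) (fun y => L (1, y))
        (fun y => L (projIcc 0 1 zero_le_one (2 * cubeRad y - 1), cubeExp (1 / 2) y)) := by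
    intro L hL hLY
    refine ⟨fun q => L (max (σ q.1) (projIcc 0 1 zero_le_one (2 * cubeRad q.2 - 1)),
      cubeExp (1 - (q.1 : ℝ) / 2) q.2), hL.comp (Continuous.prodMk ?_ ?_),
      fun q => hLY _, ?_, ?_, ?_⟩
    · exact Continuous.max (by fun_prop) (hproj.comp continuous_snd)
    · exact continuousOn_cubeExp (by fun_prop) (by fun_prop) fun q => by linarith [q.1.2.2]
    · intro y; simp [cubeExp_one, le_one']
    · intro y; norm_num
    · intro t y hy
      simp only
      rw [cubeExp_of_boundary (by linarith [t.2.1]) hy, hb1 y hy, max_eq_right le_one']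
  refine (key hH hHY).trans (HtpyRel.trans ?_ (key hK hKY).symm)
  obtain ⟨R, hR, hRY, R0, R1, Rb⟩ := R
  have hbd : ∀ y : Fin n → I, 1 / 2 ≤ cubeRad y → cubeExp (1 / 2) y ∈ Cube.boundary (Fin n) :=
    fun y hy => cubeExp_mem_boundary (by norm_num) hy
  refine ⟨fun q => if cubeRad q.2 ≤ 1 / 2 then R (q.1, cubeExp (1 / 2) q.2)
    else H (projIcc 0 1 zero_le_one (2 * cubeRad q.2 - 1), cubeExp (1 / 2) q.2), ?_, ?_, ?_, ?_, ?_⟩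
  · refine Continuous.if_le (hR.comp (continuous_fst.prodMk (hexp.comp continuous_snd)))
      (hH.comp ((hproj.comp continuous_snd).prodMk (hexp.comp continuous_snd)))
      (by fun_prop) continuous_const ?_
    intro q hq
    rw [Rb _ _ (hbd _ hq.ge), hq]; norm_num
  · intro q; beta_reduce; split_ifs
    · exact hRY _
    · exact hHY _
  · intro y
    simp only [R0]
    split_ifs with h
    · rw [projIcc_of_le_left _ (by linarith)]; rfl
    · rfl
  · intro y
    simp only [R1]
    split_ifs with h
    · rw [projIcc_of_le_left _ (by linarith)]; rfl
    · exact hHK _ _ (hbd _ (le_of_not_ge h))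
  · intro t y hy
    have : ¬ cubeRad y ≤ 1 / 2 := by rw [cubeRad_eq_one hy]; norm_num
    simp only [if_neg this]

end Cube

end Bott

open scoped Topology

namespace Bott

open unitInterval Set

section LinDef

variable {A : Type*} [Ring A] [StarRing A] [Algebra ℝ A] [StarModule ℝ A]

/-- Skew elements anticommuting with all elements of `S`. -/
def skewAnti (S : Set A) : Submodule ℝ A where
  carrier := {x | star x = -x ∧ ∀ g ∈ S, x * g = -(g * x)}
  add_mem' := by
    rintro a b ⟨ha, ha'⟩ ⟨hb, hb'⟩
    refine ⟨by rw [star_add, ha, hb]; abel, fun g hg => ?_⟩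
    rw [add_mul, mul_add, ha' g hg, hb' g hg]; abel
  zero_mem' := by simp
  smul_mem' := by
    rintro c a ⟨ha, ha'⟩
    refine ⟨by rw [star_smul, ha, star_trivial, smul_neg], fun g hg => ?_⟩
    rw [smul_mul_assoc, mul_smul_comm, ha' g hg, smul_neg]

theorem mem_skewAnti {S : Set A} {x : A} :
    x ∈ skewAnti S ↔ star x = -x ∧ ∀ g ∈ S, x * g = -(g * x) := Iff.rfl

/-- A complex structure: a square root of `-1` in `skewAnti S`. -/
def IsCplx (S : Set A) (J : A) : Prop := J ∈ skewAnti S ∧ J * J = -1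

/-- The elements `B` of `skewAnti S` for which all nontrivial combinations of `J` and `B` are
invertible. -/
def Lin (S : Set A) (J : A) : Set A :=
  {B | B ∈ skewAnti S ∧ ∀ c s : ℝ, c ^ 2 + s ^ 2 = 1 → IsUnit (c • J + s • B)}

/-- Invertible elements of `skewAnti S`. -/
def USkew (S : Set A) : Set A := {B | B ∈ skewAnti S ∧ IsUnit B}

theorem Lin.isUnit {S : Set A} {J B : A} (hB : B ∈ Lin S J) : IsUnit B := by
  simpa using hB.2 0 1 (by norm_num)

end LinDef

theorem sum_range_periodic {M : Type*} [AddCommGroup M] (N : ℕ) (h : ℤ → M)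
    (hN : ∀ k, h (k + N) = h k) (a : ℤ) :
    ∑ k ∈ Finset.range N, h (a - k) = ∑ k ∈ Finset.range N, h k := by
  have hstep : ∀ a : ℤ, ∑ k ∈ Finset.range N, h (a + k) = ∑ k ∈ Finset.range N, h (a + 1 + k) := by
    intro a
    have h1 := Finset.sum_range_succ (fun k : ℕ => h (a + k)) N
    rw [Finset.sum_range_succ'] at h1
    simp only [Nat.cast_zero, add_zero, hN] at h1
    rw [add_right_cancel_iff] at h1
    rw [← h1]
    refine Finset.sum_congr rfl fun k _ => congrArg h ?_
    push_cast; ring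
  have hall : ∀ a : ℤ, ∑ k ∈ Finset.range N, h (a + k) = ∑ k ∈ Finset.range N, h k := by
    intro a
    induction a using Int.induction_on with
    | zero => simp
    | succ i ih => rw [← hstep, ih]
    | pred i ih => rw [hstep, ← ih]; simp
  rw [← hall (a - N + 1), ← Finset.sum_range_reflect]
  refine Finset.sum_congr rfl fun k hk => congrArg h ?_
  have := Finset.mem_range.1 hk
  rw [Nat.cast_sub (by omega), Nat.cast_sub (by omega)]
  push_cast; ring

section Rot

variable {n : Type*} [Fintype n] [DecidableEq n]

open Matrix

/-- The Möbius rotation by `θ` of a real matrix. -/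
noncomputable def rot (θ : ℝ) (y : Matrix n n ℝ) : Matrix n n ℝ :=
  (Real.cos θ • y - Real.sin θ • 1) * (Real.cos θ • 1 + Real.sin θ • y)⁻¹

/-- No real eigenvalues. -/
def NoReal (y : Matrix n n ℝ) : Prop :=
  ∀ c s : ℝ, c ^ 2 + s ^ 2 = 1 → IsUnit (c • (1 : Matrix n n ℝ) + s • y)

theorem NoReal.unit {y : Matrix n n ℝ} (hy : NoReal y) (θ : ℝ) :
    IsUnit (Real.cos θ • (1 : Matrix n n ℝ) + Real.sin θ • y) :=
  hy _ _ (Real.cos_sq_add_sin_sq θ)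

theorem NoReal.inv_mul {y : Matrix n n ℝ} (hy : NoReal y) (θ : ℝ) :
    (Real.cos θ • (1 : Matrix n n ℝ) + Real.sin θ • y)⁻¹ * (Real.cos θ • 1 + Real.sin θ • y) = 1 :=
  nonsing_inv_mul _ ((isUnit_iff_isUnit_det _).1 (hy.unit θ))

theorem NoReal.mul_inv {y : Matrix n n ℝ} (hy : NoReal y) (θ : ℝ) :
    (Real.cos θ • (1 : Matrix n n ℝ) + Real.sin θ • y) * (Real.cos θ • 1 + Real.sin θ • y)⁻¹ = 1 :=
  mul_nonsing_inv _ ((isUnit_iff_isUnit_det _).1 (hy.unit θ))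

theorem NoReal.rot_mul {y : Matrix n n ℝ} (hy : NoReal y) (θ : ℝ) :
    rot θ y * (Real.cos θ • 1 + Real.sin θ • y) = Real.cos θ • y - Real.sin θ • 1 := by
  rw [rot, mul_assoc, hy.inv_mul, mul_one]

/-- `rot θ y` is the unique solution of its defining equation. -/
theorem NoReal.rot_eq {y z : Matrix n n ℝ} (hy : NoReal y) {θ : ℝ}
    (h : z * (Real.cos θ • 1 + Real.sin θ • y) = Real.cos θ • y - Real.sin θ • 1) :
    rot θ y = z := by
  rw [rot, ← h, mul_assoc, hy.mul_inv, mul_one]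

theorem NoReal.commute_rot {y z : Matrix n n ℝ} (hy : NoReal y) (h : Commute z y) (θ : ℝ) :
    Commute z (rot θ y) := by
  have hD : Commute z (Real.cos θ • 1 + Real.sin θ • y) :=
    ((Commute.one_right z).smul_right _).add_right (h.smul_right _)
  have hN : Commute z (Real.cos θ • y - Real.sin θ • 1) :=
    (h.smul_right _).sub_right ((Commute.one_right z).smul_right _)
  have : Commute z (Real.cos θ • (1 : Matrix n n ℝ) + Real.sin θ • y)⁻¹ := by
    have h1 := hy.inv_mul θ
    have h2 := hy.mul_inv θ
    generalize (Real.cos θ • (1 : Matrix n n ℝ) + Real.sin θ • y) = D at *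
    have : D⁻¹ * (z * D) * D⁻¹ = D⁻¹ * (D * z) * D⁻¹ := by rw [hD.eq]
    rw [Commute, SemiconjBy]
    calc z * D⁻¹ = (D⁻¹ * D) * z * D⁻¹ := by rw [h1, one_mul]
      _ = D⁻¹ * (D * z) * D⁻¹ := by noncomm_ring
      _ = D⁻¹ * (z * D) * D⁻¹ := by rw [hD.eq]
      _ = D⁻¹ * z * (D * D⁻¹) := by noncomm_ring
      _ = D⁻¹ * z := by rw [h2, mul_one]
  exact hN.mul_right this

theorem rot_zero (y : Matrix n n ℝ) : rot 0 y = y := by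
  simp [rot]

theorem NoReal.rot_add_pi (y : Matrix n n ℝ) (θ : ℝ) : rot (θ + Real.pi) y = rot θ y := by
  rw [rot, rot]
  simp only [Real.cos_add_pi, Real.sin_add_pi, neg_smul]
  rw [show -(Real.cos θ • y) - -(Real.sin θ • (1 : Matrix n n ℝ)) =
    -(Real.cos θ • y - Real.sin θ • 1) by abel, show -(Real.cos θ • (1 : Matrix n n ℝ)) +
      -(Real.sin θ • y) = -(Real.cos θ • 1 + Real.sin θ • y) by abel]
  generalize (Real.cos θ • (1 : Matrix n n ℝ) + Real.sin θ • y) = D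
  have : (-D)⁻¹ = -D⁻¹ := by
    by_cases h : IsUnit D.det
    · refine inv_eq_left_inv ?_
      rw [neg_mul_neg, nonsing_inv_mul _ h]
    · have h' : ¬ IsUnit (-D).det := by
        rw [← isUnit_iff_isUnit_det] at h ⊢
        rwa [IsUnit.neg_iff]
      rw [nonsing_inv_apply_not_isUnit _ h, nonsing_inv_apply_not_isUnit _ h', neg_zero]
  rw [this, neg_mul_neg]

theorem NoReal.rot_periodic (y : Matrix n n ℝ) {N : ℕ} (hN : N ≠ 0) (k : ℤ) :
    rot ((k + N : ℤ) * Real.pi / N) y = rot (k * Real.pi / N) y := by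
  have : ((k + N : ℤ) : ℝ) * Real.pi / N = k * Real.pi / N + Real.pi := by
    push_cast; field_simp
  rw [this, NoReal.rot_add_pi]

theorem NoReal.rot_pair {y : Matrix n n ℝ} (hy : NoReal y) (θ φ : ℝ) :
    Real.sin (θ - φ) • (rot θ y * rot φ y + 1) = -Real.cos (θ - φ) • (rot θ y - rot φ y) := by
  have hc : Commute y y := Commute.refl y
  have h1 := hy.rot_mul θ
  have h2 := hy.rot_mul φ
  have c1 := (hy.commute_rot hc θ).eq
  have c2 := (hy.commute_rot hc φ).eq
  have m1 := hy.mul_inv θ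
  have m2 := hy.mul_inv φ
  set a := rot θ y
  set b := rot φ y
  set D := (Real.cos θ • (1 : Matrix n n ℝ) + Real.sin θ • y) with hD
  set E := (Real.cos φ • (1 : Matrix n n ℝ) + Real.sin φ • y) with hE
  have hbD : b * D = D * b := by
    rw [hD, mul_add, add_mul, mul_smul_comm, mul_smul_comm, smul_mul_assoc, smul_mul_assoc, c2]
    simp
  have hDE : D * E = E * D := by
    rw [hD, hE]; simp only [mul_add, add_mul, smul_mul_smul_comm, one_mul, mul_one]
    rw [mul_comm (Real.cos φ), mul_comm (Real.cos φ), mul_comm (Real.sin φ),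
      mul_comm (Real.sin φ)]
    abel
  have key : (Real.sin (θ - φ) • (a * b + 1)) * (D * E) =
      (-Real.cos (θ - φ) • (a - b)) * (D * E) := by
    have e1 : a * b * (D * E) = (Real.cos θ • y - Real.sin θ • 1) *
        (Real.cos φ • y - Real.sin φ • 1) := by
      calc a * b * (D * E) = a * (b * D) * E := by noncomm_ring
        _ = (a * D) * (b * E) := by rw [hbD]; noncomm_ring
        _ = _ := by rw [h1, h2]
    have e2 : a * (D * E) = (Real.cos θ • y - Real.sin θ • 1) * E := by
      rw [← mul_assoc, h1]
    have e3 : b * (D * E) = (Real.cos φ • y - Real.sin φ • 1) * D := by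
      rw [hDE, ← mul_assoc, h2]
    rw [smul_mul_assoc, smul_mul_assoc, add_mul, sub_mul, e1, e2, e3, one_mul, hD, hE]
    simp only [Real.sin_sub, Real.cos_sub, mul_add, add_mul, sub_mul, mul_sub, smul_mul_smul_comm,
      one_mul, mul_one]
    module
  have hU : (D * E) * (E⁻¹ * D⁻¹) = 1 := by
    calc _ = D * (E * E⁻¹) * D⁻¹ := by noncomm_ring
      _ = 1 := by rw [m2, mul_one, m1]
  have := congrArg (· * (E⁻¹ * D⁻¹)) key
  simpa only [mul_assoc _ (D * E), hU, mul_one] using this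

/-- The average of `N` rotations of `y`; as `N` grows this tends to a square root of `-1`. -/
noncomputable def rotAvg (N : ℕ) (y : Matrix n n ℝ) : Matrix n n ℝ :=
  (1 / N : ℝ) • ∑ k ∈ Finset.range N, rot ((k : ℤ) * Real.pi / N) y

theorem sum_cot (N : ℕ) (hN : N ≠ 0) (k : ℤ) :
    ∑ l ∈ Finset.range N, (Real.cos ((k - (l : ℤ)) * Real.pi / N) /
      Real.sin ((k - (l : ℤ)) * Real.pi / N)) = 0 := by
  let h : ℤ → ℝ := fun m => Real.cos (m * Real.pi / N) / Real.sin (m * Real.pi / N)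
  have hp : ∀ k, h (k + N) = h k := by
    intro k
    have : ((k + N : ℤ) : ℝ) * Real.pi / N = k * Real.pi / N + Real.pi := by
      push_cast; field_simp
    simp only [h]
    rw [this, Real.cos_add_pi, Real.sin_add_pi, neg_div_neg_eq]
  have h1 := sum_range_periodic N h hp k
  have h2 := sum_range_periodic N h hp 0
  have h3 : ∀ m, h (-m) = - h m := by
    intro m
    simp only [h]
    push_cast
    rw [neg_mul, neg_div, Real.cos_neg, Real.sin_neg, div_neg]
  simp only [zero_sub, h3, Finset.sum_neg_distrib] at h2
  have h4 : ∑ k ∈ Finset.range N, h k = 0 := by linarith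
  rw [h4] at h1
  simpa [h] using h1

theorem NoReal.rotAvg_sq {y : Matrix n n ℝ} (hy : NoReal y) (N : ℕ) (hN : N ≠ 0) :
    rotAvg N y * rotAvg N y = -1 + (1 / N ^ 2 : ℝ) • ∑ k ∈ Finset.range N,
      (rot ((k : ℤ) * Real.pi / N) y * rot ((k : ℤ) * Real.pi / N) y + 1) := by
  set r : ℕ → Matrix n n ℝ := fun k => rot ((k : ℤ) * Real.pi / N) y with hr
  let ct : ℕ → ℕ → ℝ := fun k l => Real.cos (((k : ℤ) - (l : ℤ)) * Real.pi / N) /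
      Real.sin (((k : ℤ) - (l : ℤ)) * Real.pi / N)
  have hN' : (N : ℝ) ≠ 0 := by exact_mod_cast hN
  have hpair : ∀ k ∈ Finset.range N, ∀ l ∈ Finset.range N, r k * r l + 1 =
      (if k = l then (r k * r k + 1) else 0) - ct k l • r k + ct k l • r l := by
    intro k hk l hl
    by_cases hkl : k = l
    · subst hkl; simp
    rw [if_neg hkl]
    have hs : Real.sin (((k : ℤ) - (l : ℤ)) * Real.pi / N) ≠ 0 := by
      intro h0
      obtain ⟨m, hm⟩ := Real.sin_eq_zero_iff.1 h0
      have hm' : (m : ℝ) * N = (k : ℝ) - l := by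
        have hpi := Real.pi_ne_zero
        field_simp at hm
        push_cast at hm
        exact hm
      have hm'' : m * (N : ℤ) = k - l := by exact_mod_cast hm'
      rw [Finset.mem_range] at hk hl
      have hm0 : m = 0 := by
        by_contra hne
        rcases lt_or_gt_of_ne hne with h | h
        · nlinarith
        · nlinarith
      rw [hm0] at hm''; omega
    have hp := hy.rot_pair ((k : ℤ) * Real.pi / N) ((l : ℤ) * Real.pi / N)
    rw [show (((k : ℤ) : ℝ) * Real.pi / N - ((l : ℤ) : ℝ) * Real.pi / N) =
      ((k : ℤ) - (l : ℤ)) * Real.pi / N by ring] at hp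
    have := congrArg (fun z => (Real.sin (((k : ℤ) - (l : ℤ)) * Real.pi / N))⁻¹ • z) hp
    simp only [smul_smul, inv_mul_cancel₀ hs, one_smul] at this
    rw [this, zero_sub]
    simp only [ct, hr, div_eq_inv_mul]
    module
  have hsum : (∑ k ∈ Finset.range N, r k) * (∑ l ∈ Finset.range N, r l) =
      ∑ k ∈ Finset.range N, (r k * r k + 1) - ((N : ℝ) ^ 2) • 1 := by
    rw [Finset.sum_mul_sum]
    have : ∀ k ∈ Finset.range N, ∀ l ∈ Finset.range N, r k * r l =
      ((if k = l then (r k * r k + 1) else 0) - ct k l • r k + ct k l • r l) - 1 := by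
      intro k hk l hl; rw [← hpair k hk l hl]; abel
    rw [Finset.sum_congr rfl fun k hk => Finset.sum_congr rfl fun l hl => this k hk l hl]
    simp only [Finset.sum_sub_distrib, Finset.sum_add_distrib, ← Finset.sum_smul]
    have z1 : ∀ k : ℕ, ∑ l ∈ Finset.range N, ct k l = 0 := fun k => sum_cot N hN k
    have z2 : ∀ l : ℕ, ∑ k ∈ Finset.range N, ct k l = 0 := by
      intro l
      rw [← neg_eq_zero, ← Finset.sum_neg_distrib, ← z1 l]
      refine Finset.sum_congr rfl fun k _ => ?_
      simp only [ct]
      rw [show ((l : ℤ) - (k : ℤ) : ℝ) * Real.pi / N = -(((k : ℤ) - (l : ℤ)) * Real.pi / N) by ring,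
        Real.cos_neg, Real.sin_neg, div_neg]
    rw [Finset.sum_comm (f := fun k l => ct k l • r l)]
    simp only [z1, z2, ← Finset.sum_smul, zero_smul, Finset.sum_const_zero]
    simp only [Finset.sum_ite_eq, Finset.sum_const, Finset.card_range, sub_zero, add_zero,
      ← Nat.cast_smul_eq_nsmul ℝ, smul_smul, ← sq]
    rw [sub_left_inj, Finset.sum_congr rfl fun k hk => if_pos hk, Finset.sum_add_distrib]
    simp [← Nat.cast_smul_eq_nsmul ℝ]
  rw [rotAvg, smul_mul_smul_comm, hsum, smul_sub, smul_smul]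
  rw [show (1 / (N : ℝ) * (1 / N)) * (N : ℝ) ^ 2 = 1 by field_simp,
    show (1 / (N : ℝ) * (1 / N)) = 1 / (N : ℝ) ^ 2 by field_simp, one_smul]
  abel

end Rot

end Bott

open scoped Topology

namespace Bott

open unitInterval Set Matrix

section Retr

variable {n : Type*} [Fintype n] [DecidableEq n]

theorem isUnit_of_mulVec {M : Matrix n n ℝ} (h : ∀ v, M *ᵥ v = 0 → v = 0) : IsUnit M := by
  rw [isUnit_iff_isUnit_det, isUnit_iff_ne_zero]
  intro h0
  obtain ⟨v, hv, hv'⟩ := exists_mulVec_eq_zero_iff.2 h0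
  exact hv (h v hv')

theorem NoReal.convex {y : Matrix n n ℝ} (hy : NoReal y) (s : Finset ℕ) (θ w : ℕ → ℝ)
    (hw : ∀ k ∈ s, 0 ≤ w k) (hw1 : ∑ k ∈ s, w k = 1) :
    NoReal (∑ k ∈ s, w k • rot (θ k) y) := by
  set z := ∑ k ∈ s, w k • rot (θ k) y with hz
  intro c d hcd
  by_contra hcon
  rw [isUnit_iff_isUnit_det, isUnit_iff_ne_zero, not_not] at hcon
  have hd : d ≠ 0 := by
    rintro rfl
    have : c ≠ 0 := by rintro rfl; norm_num at hcd
    simp [this] at hcon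
  let φ : Matrix n n ℝ →+* Matrix n n ℂ := (algebraMap ℝ ℂ).mapMatrix
  have hφs : ∀ (a : ℝ) (M : Matrix n n ℝ), φ (a • M) = (a : ℂ) • φ M := by
    intro a M; ext i j; simp [φ]
  have hdet : ∀ M : Matrix n n ℝ, (φ M).det = (M.det : ℂ) := fun M =>
    (RingHom.map_det (algebraMap ℝ ℂ) M).symm
  obtain ⟨v₀, hv₀, hzv₀⟩ := exists_mulVec_eq_zero_iff.2
    (show (φ (c • 1 + d • z)).det = 0 by rw [hdet, hcon]; simp)
  let K : Submodule ℂ (n → ℂ) := LinearMap.ker (Matrix.mulVecLin (φ (c • 1 + d • z)))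
  have hcomm : Commute y z := by
    refine Commute.sum_right _ _ _ fun k _ => Commute.smul_right ?_ _
    exact hy.commute_rot (Commute.refl y) _
  have hcomm' : Commute (φ y) (φ (c • 1 + d • z)) :=
    (((Commute.one_right y).smul_right c).add_right (hcomm.smul_right d)).map φ
  have hK : ∀ v ∈ K, Matrix.mulVecLin (φ y) v ∈ K := by
    intro v hv
    simp only [K, LinearMap.mem_ker, mulVecLin_apply] at hv ⊢
    rw [mulVec_mulVec, ← hcomm'.eq, ← mulVec_mulVec, hv, mulVec_zero]
  have : Nontrivial K := ⟨⟨⟨v₀, hzv₀⟩, 0, fun h => hv₀ (congrArg Subtype.val h)⟩⟩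
  obtain ⟨μ, hμ⟩ := Module.End.exists_eigenvalue ((Matrix.mulVecLin (φ y)).restrict hK)
  obtain ⟨v, hv⟩ := hμ.exists_hasEigenvector
  have hv0 : (v : n → ℂ) ≠ 0 := fun h => hv.2 (Subtype.ext h)
  have hyv : φ y *ᵥ (v : n → ℂ) = μ • (v : n → ℂ) := by
    have := congrArg Subtype.val hv.apply_eq_smul
    simpa using this
  have hzv : φ (c • 1 + d • z) *ᵥ (v : n → ℂ) = 0 := by
    exact v.2
  generalize (v : n → ℂ) = v at hv0 hyv hzv
  have hlin : ∀ a b : ℝ, φ (a • 1 + b • y) *ᵥ v = ((a : ℂ) + b * μ) • v := by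
    intro a b
    rw [map_add, hφs, hφs, map_one, add_mulVec, smul_mulVec, smul_mulVec, one_mulVec, hyv,
      smul_smul, add_smul]
  have hunit : ∀ a b : ℝ, a ^ 2 + b ^ 2 = 1 → (a : ℂ) + b * μ ≠ 0 := by
    intro a b hab h0
    have h1 := hlin a b
    rw [h0, zero_smul] at h1
    have h2 := exists_mulVec_eq_zero_iff.1 ⟨v, hv0, h1⟩
    rw [hdet] at h2
    have h3 := hy a b hab
    rw [isUnit_iff_isUnit_det, isUnit_iff_ne_zero] at h3
    exact h3 (by exact_mod_cast h2)
  have him : μ.im ≠ 0 := by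
    intro h0
    have hpos : 0 < μ.re ^ 2 + 1 := by positivity
    set r := Real.sqrt (μ.re ^ 2 + 1) with hr
    have hr0 : r ≠ 0 := (Real.sqrt_pos.2 hpos).ne'
    have hr2 : r ^ 2 = μ.re ^ 2 + 1 := Real.sq_sqrt hpos.le
    refine hunit (-μ.re / r) (1 / r) (by field_simp; rw [hr2]) ?_
    have : μ = (μ.re : ℂ) := Complex.ext rfl (by simp [h0])
    rw [this]
    simp only [Complex.ofReal_re]
    push_cast
    field_simp
    ring
  have hrot : ∀ k, φ (rot (θ k) y) *ᵥ v =
      ((Real.cos (θ k) * μ - Real.sin (θ k)) / (Real.cos (θ k) + Real.sin (θ k) * μ)) • v := by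
    intro k
    have h1 := congrArg (fun M => φ M *ᵥ v) (hy.rot_mul (θ k))
    simp only [map_mul] at h1
    rw [← mulVec_mulVec, hlin, show Real.cos (θ k) • y - Real.sin (θ k) • (1 : Matrix n n ℝ) =
      (-Real.sin (θ k)) • 1 + Real.cos (θ k) • y by module, hlin, mulVec_smul] at h1
    have h2 := hunit _ _ (Real.cos_sq_add_sin_sq (θ k))
    rw [div_eq_inv_mul, ← smul_smul, eq_inv_smul_iff₀ h2, h1]
    congr 1
    push_cast; ring
  have hzv2 : φ z *ᵥ v = (∑ k ∈ s, (w k : ℂ) * ((Real.cos (θ k) * μ - Real.sin (θ k)) /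
      (Real.cos (θ k) + Real.sin (θ k) * μ))) • v := by
    rw [hz, map_sum, Finset.sum_smul, sum_mulVec]
    refine Finset.sum_congr rfl fun k _ => ?_
    rw [hφs, smul_mulVec, hrot, smul_smul]
  rw [map_add, hφs, hφs, map_one, add_mulVec, smul_mulVec, smul_mulVec, one_mulVec, hzv2,
    smul_smul, ← add_smul, smul_eq_zero, or_iff_left hv0] at hzv
  have him0 := congrArg Complex.im hzv
  simp only [Complex.add_im, Complex.ofReal_im, zero_add, Complex.zero_im,
    Complex.im_ofReal_mul, Complex.im_sum, mul_eq_zero, hd,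
    false_or] at him0
  have hterm : ∀ k, ((Real.cos (θ k) * μ - Real.sin (θ k)) /
      (Real.cos (θ k) + Real.sin (θ k) * μ) : ℂ).im =
      μ.im / Complex.normSq (Real.cos (θ k) + Real.sin (θ k) * μ) := by
    intro k
    have h2 := Real.cos_sq_add_sin_sq (θ k)
    rw [Complex.div_im, ← sub_div]
    congr 1
    simp only [Complex.sub_im, Complex.sub_re, Complex.add_re, Complex.add_im,
      Complex.re_ofReal_mul, Complex.im_ofReal_mul, Complex.ofReal_re, Complex.ofReal_im]
    linear_combination μ.im * h2
  simp only [hterm, mul_div_assoc', mul_comm _ μ.im] at him0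
  simp only [mul_div_assoc, ← Finset.mul_sum, mul_eq_zero, him, false_or] at him0
  rw [Finset.sum_eq_zero_iff_of_nonneg fun k hk => div_nonneg (hw k hk) (Complex.normSq_nonneg _)]
    at him0
  have : ∑ k ∈ s, w k = 0 := Finset.sum_eq_zero fun k hk => by
    have := him0 k hk
    rw [div_eq_zero_iff] at this
    refine this.resolve_right fun h => ?_
    exact hunit _ _ (Real.cos_sq_add_sin_sq (θ k)) (Complex.normSq_eq_zero.1 h)
  rw [hw1] at this
  exact one_ne_zero this

theorem NoReal.semiconj_rot {y y' P : Matrix n n ℝ} (hy : NoReal y) (hy' : NoReal y')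
    (h : P * y = y' * P) (θ : ℝ) : P * rot θ y = rot θ y' * P := by
  have h1 := hy.mul_inv θ
  have e1 : P * (Real.cos θ • 1 + Real.sin θ • y) = (Real.cos θ • 1 + Real.sin θ • y') * P := by
    simp [mul_add, add_mul, h]
  have e2 : P * (Real.cos θ • y - Real.sin θ • 1) = (Real.cos θ • y' - Real.sin θ • 1) * P := by
    simp [mul_sub, sub_mul, h]
  calc P * rot θ y = (Real.cos θ • y' - Real.sin θ • 1) * P *
        (Real.cos θ • 1 + Real.sin θ • y)⁻¹ := by rw [rot, ← mul_assoc, e2]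
    _ = rot θ y' * ((Real.cos θ • 1 + Real.sin θ • y') * P) *
        (Real.cos θ • 1 + Real.sin θ • y)⁻¹ := by rw [← mul_assoc, hy'.rot_mul]
    _ = rot θ y' * P * ((Real.cos θ • 1 + Real.sin θ • y) *
        (Real.cos θ • 1 + Real.sin θ • y)⁻¹) := by rw [← e1]; noncomm_ring
    _ = rot θ y' * P := by rw [h1, mul_one]

theorem NoReal.neg {y : Matrix n n ℝ} (hy : NoReal y) : NoReal (-y) := by
  intro c s h
  have := hy c (-s) (by rw [neg_sq, h])
  simpa using this

theorem NoReal.transpose {y : Matrix n n ℝ} (hy : NoReal y) : NoReal yᵀ := by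
  intro c s h
  have := hy c s h
  rw [isUnit_iff_isUnit_det] at this ⊢
  rw [← det_transpose]
  simpa using this

theorem transpose_rot {y : Matrix n n ℝ} (hy : NoReal y) (θ : ℝ) : (rot θ y)ᵀ = rot θ yᵀ := by
  symm
  apply hy.transpose.rot_eq
  have hc : Commute (rot θ y) (Real.cos θ • 1 + Real.sin θ • y) :=
    ((Commute.one_right _).smul_right _).add_right
      ((hy.commute_rot (Commute.refl y) θ).symm.smul_right _)
  have h := congrArg Matrix.transpose (hc.symm.eq.trans (hy.rot_mul θ))
  simpa using h

theorem rot_neg_neg {y : Matrix n n ℝ} (hy : NoReal y) (θ : ℝ) : rot (-θ) (-y) = - rot θ y := by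
  apply hy.neg.rot_eq
  simp only [Real.cos_neg, Real.sin_neg, smul_neg, neg_smul, neg_neg]
  rw [neg_mul, hy.rot_mul]; abel

theorem rotAvg_neg {y : Matrix n n ℝ} (hy : NoReal y) (N : ℕ) (hN : N ≠ 0) :
    rotAvg N (-y) = -rotAvg N y := by
  rw [rotAvg, rotAvg, ← smul_neg, ← Finset.sum_neg_distrib]
  congr 1
  have h := sum_range_periodic N (fun k : ℤ => rot (k * Real.pi / N) (-y))
    (fun k => NoReal.rot_periodic _ hN k) 0
  rw [← h]
  refine Finset.sum_congr rfl fun k _ => ?_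
  rw [← rot_neg_neg hy]
  congr 1
  push_cast; ring

theorem rot_of_sq {y : Matrix n n ℝ} (hy : NoReal y) (h : y * y = -1) (θ : ℝ) : rot θ y = y := by
  apply hy.rot_eq
  rw [mul_add, mul_smul_comm, mul_smul_comm, h, mul_one, smul_neg, sub_eq_add_neg]

theorem rotAvg_of_sq {y : Matrix n n ℝ} (hy : NoReal y) (h : y * y = -1) (N : ℕ) (hN : N ≠ 0) :
    rotAvg N y = y := by
  have hN' : (N : ℝ) ≠ 0 := by exact_mod_cast hN
  rw [rotAvg, Finset.sum_congr rfl fun k _ => rot_of_sq hy h _]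
  simp [← Nat.cast_smul_eq_nsmul ℝ, smul_smul, hN']

theorem semiconj_rotAvg {y y' P : Matrix n n ℝ} (hy : NoReal y) (hy' : NoReal y')
    (h : P * y = y' * P) (N : ℕ) : P * rotAvg N y = rotAvg N y' * P := by
  rw [rotAvg, rotAvg, mul_smul_comm, smul_mul_assoc, Finset.mul_sum, Finset.sum_mul]
  congr 1
  exact Finset.sum_congr rfl fun k _ => hy.semiconj_rot hy' h _

theorem transpose_rotAvg {y : Matrix n n ℝ} (hy : NoReal y) (N : ℕ) :
    (rotAvg N y)ᵀ = rotAvg N yᵀ := by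
  rw [rotAvg, rotAvg, transpose_smul, transpose_sum]
  congr 1
  exact Finset.sum_congr rfl fun k _ => transpose_rot hy _

theorem NoReal.convex_rotAvg {y : Matrix n n ℝ} (hy : NoReal y) (N : ℕ) (hN : N ≠ 0) {t : ℝ}
    (ht0 : 0 ≤ t) (ht1 : t ≤ 1) : NoReal ((1 - t) • y + t • rotAvg N y) := by
  have hN' : (N : ℝ) ≠ 0 := by exact_mod_cast hN
  have h := hy.convex (Finset.range (N + 1)) (fun k => if k < N then ((k : ℤ) * Real.pi / N) else 0)
    (fun k => if k < N then t / N else 1 - t) ?_ ?_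
  · rw [Finset.sum_range_succ, if_neg (lt_irrefl N), if_neg (lt_irrefl N), rot_zero] at h
    rw [Finset.sum_congr rfl (g := fun k : ℕ => (t / N) • rot ((k : ℤ) * Real.pi / N) y),
      ← Finset.smul_sum, add_comm] at h
    · rwa [rotAvg, smul_smul, mul_one_div]
    · intro k hk
      rw [if_pos (Finset.mem_range.1 hk), if_pos (Finset.mem_range.1 hk)]
  · intro k _
    split_ifs
    · positivity
    · linarith
  · rw [Finset.sum_range_succ, if_neg (lt_irrefl N),
      Finset.sum_congr rfl (g := fun k => (t / N)) fun k hk => if_pos (Finset.mem_range.1 hk)]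
    simp
    field_simp; ring

theorem continuous_rot {X : Type*} [TopologicalSpace X] {y : X → Matrix n n ℝ} {θ : X → ℝ}
    (hθ : Continuous θ) (hc : Continuous y) (hy : ∀ x, NoReal (y x)) :
    Continuous fun x => rot (θ x) (y x) := by
  have h : Continuous fun x => (Real.cos (θ x) • (1 : Matrix n n ℝ) + Real.sin (θ x) • y x)⁻¹ := by
    rw [continuous_iff_continuousAt]
    intro x
    refine ContinuousAt.comp (g := fun M : Matrix n n ℝ => M⁻¹)
      (f := fun x => Real.cos (θ x) • (1 : Matrix n n ℝ) + Real.sin (θ x) • y x)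
      (continuousAt_matrix_inv _ ?_) (by fun_prop)
    exact NormedRing.inverse_continuousAt ((isUnit_iff_isUnit_det _).1 ((hy x).unit (θ x))).unit
  unfold rot
  fun_prop

theorem abs_dotProduct_mulVec_le (Q : Matrix n n ℝ) (v : n → ℝ) :
    v ⬝ᵥ Q *ᵥ v ≤ (∑ i, ∑ j, |Q i j|) * (v ⬝ᵥ v) := by
  have hv : ∀ i, v i ^ 2 ≤ v ⬝ᵥ v := by
    intro i
    have := Finset.single_le_sum (f := fun i => v i * v i) (fun j _ => mul_self_nonneg _)
      (Finset.mem_univ i)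
    rw [sq]; exact this
  generalize v ⬝ᵥ v = w at hv ⊢
  simp only [dotProduct, mulVec, Finset.mul_sum, Finset.sum_mul]
  refine Finset.sum_le_sum fun i _ => Finset.sum_le_sum fun j _ => ?_
  have h1 := hv i
  have h2 := hv j
  calc v i * (Q i j * v j) ≤ |v i * (Q i j * v j)| := le_abs_self _
    _ = |Q i j| * (|v i| * |v j|) := by rw [abs_mul, abs_mul]; ring
    _ ≤ _ := by
        refine mul_le_mul_of_nonneg_left ?_ (abs_nonneg _)
        have h3 := sq_nonneg (|v i| - |v j|)
        have h4 := sq_abs (v i)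
        have h5 := sq_abs (v j)
        nlinarith

theorem exists_rotAvg_neg {X : Type*} [TopologicalSpace X] [CompactSpace X]
    {y : X → Matrix n n ℝ} (hc : Continuous y) (hy : ∀ x, NoReal (y x)) :
    ∃ N : ℕ, N ≠ 0 ∧ ∀ x, ∀ v ≠ 0, v ⬝ᵥ (rotAvg N (y x) * rotAvg N (y x)) *ᵥ v < 0 := by
  let Q : ℝ × X → Matrix n n ℝ := fun p => rot p.1 (y p.2) * rot p.1 (y p.2) + 1
  have hQ : Continuous Q := by
    have := continuous_rot (θ := fun p : ℝ × X => p.1) (y := fun p : ℝ × X => y p.2) continuous_fst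
      (hc.comp continuous_snd) fun p => hy _
    exact (this.matrix_mul this).add continuous_const
  have hq : Continuous fun p => ∑ i, ∑ j, |Q p i j| := by
    refine continuous_finsetSum _ fun i _ => continuous_finsetSum _ fun j _ => ?_
    exact (hQ.matrix_elem i j).abs
  obtain ⟨C, hC⟩ := ((isCompact_Icc (a := (0 : ℝ)) (b := Real.pi)).prod
    (isCompact_univ (X := X))).bddAbove_image hq.continuousOn
  have hC' : ∀ θ ∈ Icc 0 Real.pi, ∀ x, ∑ i, ∑ j, |Q (θ, x) i j| ≤ C := fun θ hθ x =>
    hC ⟨(θ, x), ⟨hθ, mem_univ _⟩, rfl⟩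
  obtain ⟨N, hN⟩ := exists_nat_gt (max C 1)
  have hN1 : (1 : ℝ) < N := (le_max_right _ _).trans_lt hN
  have hNC : C < N := (le_max_left _ _).trans_lt hN
  have hN0 : N ≠ 0 := by rintro rfl; norm_num at hN1
  refine ⟨N, hN0, fun x v hv => ?_⟩
  have hvv : 0 < v ⬝ᵥ v := lt_of_le_of_ne (Finset.sum_nonneg fun i _ => mul_self_nonneg _)
    (fun h => hv (dotProduct_self_eq_zero.1 h.symm))
  rw [(hy x).rotAvg_sq N hN0, add_mulVec, dotProduct_add, neg_mulVec, one_mulVec, dotProduct_neg,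
    smul_mulVec, dotProduct_smul, sum_mulVec, dotProduct_sum, smul_eq_mul]
  have hsum : ∑ k ∈ Finset.range N, v ⬝ᵥ (rot ((k : ℤ) * Real.pi / N) (y x) *
      rot ((k : ℤ) * Real.pi / N) (y x) + 1) *ᵥ v ≤ ∑ k ∈ Finset.range N, C * (v ⬝ᵥ v) := by
    refine Finset.sum_le_sum fun k hk => (abs_dotProduct_mulVec_le _ _).trans ?_
    refine mul_le_mul_of_nonneg_right (hC' _ ⟨?_, ?_⟩ x) hvv.le
    · have := Real.pi_pos.le
      push_cast; positivity
    · rw [div_le_iff₀ (by linarith), mul_comm]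
      refine mul_le_mul_of_nonneg_left ?_ Real.pi_pos.le
      exact_mod_cast (Finset.mem_range.1 hk).le
  rw [Finset.sum_const, Finset.card_range, nsmul_eq_mul] at hsum
  have h3 : 1 / (N : ℝ) ^ 2 * (N * (C * (v ⬝ᵥ v))) < v ⬝ᵥ v := by
    rw [show 1 / (N : ℝ) ^ 2 * (N * (C * (v ⬝ᵥ v))) = (C / N) * (v ⬝ᵥ v) by field_simp]
    have : C / N < 1 := by rw [div_lt_one (by linarith)]; exact hNC
    nlinarith
  have h4 := mul_le_mul_of_nonneg_left hsum (by positivity : 0 ≤ 1 / (N : ℝ) ^ 2)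
  linarith

/-- If the quadratic form of `z ^ 2` is negative definite, then deforming the symmetric part of `z`
to zero creates no real eigenvalues. -/
theorem noReal_of_negSq {z : Matrix n n ℝ} (hz : ∀ v ≠ 0, v ⬝ᵥ (z * z) *ᵥ v < 0) {b : ℝ}
    (hb0 : 0 ≤ b) (hb1 : b ≤ 1) : NoReal (z - (b / 2) • (z + zᵀ)) := by
  intro c s hcs
  refine isUnit_of_mulVec fun v hv => ?_
  by_contra hv0
  set p := (1 / 2 : ℝ) • (z *ᵥ v - zᵀ *ᵥ v) with hp
  set q := (1 / 2 : ℝ) • (z *ᵥ v + zᵀ *ᵥ v) with hq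
  have hzv : z *ᵥ v = p + q := by rw [hp, hq]; module
  have hzv' : zᵀ *ᵥ v = q - p := by rw [hp, hq]; module
  have h1 : (q - p) ⬝ᵥ (p + q) < 0 := by
    have := hz v hv0
    rw [← mulVec_mulVec, dotProduct_mulVec, ← mulVec_transpose, hzv', hzv] at this
    exact this
  have h2 : c • v + s • (p + (1 - b) • q) = 0 := by
    rw [← hv, add_mulVec, smul_mulVec, smul_mulVec, one_mulVec, sub_mulVec, smul_mulVec,
      add_mulVec, hzv, hzv']
    module
  have h3 : v ⬝ᵥ p = 0 := by
    have : v ⬝ᵥ z *ᵥ v = zᵀ *ᵥ v ⬝ᵥ v := by rw [dotProduct_mulVec, ← mulVec_transpose]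
    rw [hp, dotProduct_smul, dotProduct_sub, this, dotProduct_comm v (zᵀ *ᵥ v)]
    simp
  have hs : s ≠ 0 := by
    rintro rfl
    rw [zero_smul, add_zero, smul_eq_zero] at h2
    rcases h2 with h | h
    · rw [h] at hcs; norm_num at hcs
    · exact hv0 h
  have h4 : p ⬝ᵥ p + (1 - b) * (p ⬝ᵥ q) = 0 := by
    have := congrArg (fun u => p ⬝ᵥ u) h2
    simp only [dotProduct_add, dotProduct_smul, smul_eq_mul, dotProduct_zero,
      dotProduct_comm p v, h3, mul_zero, zero_add, mul_eq_zero, hs, false_or] at this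
    exact this
  have h5 : q ⬝ᵥ q < p ⬝ᵥ p := by
    simp only [sub_dotProduct, dotProduct_add, dotProduct_comm p q] at h1
    linarith
  have h6 : 0 ≤ (p + q) ⬝ᵥ (p + q) := Finset.sum_nonneg fun i _ => mul_self_nonneg _
  have h7 : 0 ≤ p ⬝ᵥ p := Finset.sum_nonneg fun i _ => mul_self_nonneg _
  simp only [add_dotProduct, dotProduct_add, dotProduct_comm q p] at h6
  have h8 : 0 ≤ q ⬝ᵥ q := Finset.sum_nonneg fun i _ => mul_self_nonneg _
  nlinarith [mul_nonneg (sub_nonneg.2 hb1) h6, mul_nonneg hb0 (add_nonneg h7 h8)]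

end Retr

end Bott

open scoped Topology

namespace Bott

open unitInterval Set Matrix

section RetrLin

variable {n : Type*} [Fintype n] [DecidableEq n]

/-- Elements `y` such that `J * y` lies in `skewAnti S`. -/
def SkewFactor (S : Set (Matrix n n ℝ)) (J y : Matrix n n ℝ) : Prop :=
  yᵀ * J = J * y ∧ ∀ g ∈ S, y * g = g * y

theorem star_eq_transpose (x : Matrix n n ℝ) : star x = xᵀ := by
  rw [star_eq_conjTranspose, conjTranspose_eq_transpose_of_trivial]

variable {S : Set (Matrix n n ℝ)} {J : Matrix n n ℝ}

theorem IsCplx.transpose (hJ : IsCplx S J) : Jᵀ = -J := by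
  rw [← star_eq_transpose, hJ.1.1]

theorem SkewFactor.mul_mem (hJ : IsCplx S J) {y : Matrix n n ℝ} (hy : SkewFactor S J y) :
    J * y ∈ skewAnti S := by
  refine ⟨?_, fun g hg => ?_⟩
  · rw [star_eq_transpose, transpose_mul, hJ.transpose, mul_neg, hy.1]
  · rw [mul_assoc, hy.2 g hg, ← mul_assoc, hJ.1.2 g hg]; noncomm_ring

theorem SkewFactor.of_mem (hJ : IsCplx S J) {B : Matrix n n ℝ} (hB : B ∈ skewAnti S) :
    SkewFactor S J (-(J * B)) := by
  have hB' : Bᵀ = -B := by rw [← star_eq_transpose, hB.1]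
  refine ⟨?_, fun g hg => ?_⟩
  · rw [transpose_neg, transpose_mul, hJ.transpose, hB']
    simp only [neg_mul, mul_neg, neg_neg, mul_assoc, hJ.2]
    rw [← mul_assoc, hJ.2]; simp
  · rw [neg_mul, mul_assoc, hB.2 g hg, mul_neg, ← mul_assoc, hJ.1.2 g hg]; noncomm_ring

theorem SkewFactor.transpose_eq (hJ : IsCplx S J) {y : Matrix n n ℝ} (hy : SkewFactor S J y) :
    yᵀ = -(J * y * J) := by
  rw [← hy.1, mul_assoc, hJ.2]; simp

theorem SkewFactor.transpose (hJ : IsCplx S J) {y : Matrix n n ℝ} (hy : SkewFactor S J y) :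
    SkewFactor S J yᵀ := by
  refine ⟨?_, fun g hg => ?_⟩
  · rw [transpose_transpose, hy.transpose_eq hJ, mul_neg, ← mul_assoc, ← mul_assoc, hJ.2]; simp
  · have h1 := hJ.1.2 g hg
    have h2 := hy.2 g hg
    rw [hy.transpose_eq hJ]
    calc -(J * y * J) * g = -(J * y * (J * g)) := by noncomm_ring
      _ = J * (y * g) * J := by rw [h1]; noncomm_ring
      _ = (J * g) * y * J := by rw [h2]; noncomm_ring
      _ = g * -(J * y * J) := by rw [h1]; noncomm_ring

theorem SkewFactor.add {y z : Matrix n n ℝ} (hy : SkewFactor S J y) (hz : SkewFactor S J z) :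
    SkewFactor S J (y + z) := by
  refine ⟨?_, fun g hg => ?_⟩
  · rw [transpose_add, add_mul, mul_add, hy.1, hz.1]
  · rw [add_mul, mul_add, hy.2 g hg, hz.2 g hg]

theorem SkewFactor.smul {y : Matrix n n ℝ} (hy : SkewFactor S J y) (c : ℝ) :
    SkewFactor S J (c • y) := by
  refine ⟨?_, fun g hg => ?_⟩
  · rw [transpose_smul, smul_mul_assoc, mul_smul_comm, hy.1]
  · rw [smul_mul_assoc, mul_smul_comm, hy.2 g hg]

theorem SkewFactor.rotAvg {y : Matrix n n ℝ} (hy : SkewFactor S J y) (h : NoReal y) (N : ℕ) :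
    SkewFactor S J (rotAvg N y) := by
  refine ⟨?_, fun g hg => ?_⟩
  · rw [transpose_rotAvg h, semiconj_rotAvg h h.transpose hy.1.symm]
  · rw [semiconj_rotAvg h h (hy.2 g hg).symm]

theorem mul_mem_Lin (hJ : IsCplx S J) {y : Matrix n n ℝ} (hy : SkewFactor S J y) (h : NoReal y) :
    J * y ∈ Lin S J := by
  refine ⟨hy.mul_mem hJ, fun c s hcs => ?_⟩
  rw [show c • J + s • (J * y) = J * (c • 1 + s • y) by simp [mul_add]]
  refine IsUnit.mul ?_ (h c s hcs)
  exact ⟨⟨J, -J, by rw [mul_neg, hJ.2, neg_neg], by rw [neg_mul, hJ.2, neg_neg]⟩, rfl⟩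

theorem noReal_of_mem (hJ : IsCplx S J) {B : Matrix n n ℝ} (hB : B ∈ Lin S J) :
    NoReal (-(J * B)) := by
  intro c s hcs
  rw [show c • (1 : Matrix n n ℝ) + s • -(J * B) = -J * (c • J + s • B) by
    rw [mul_add, mul_smul_comm, mul_smul_comm, neg_mul, hJ.2, neg_neg, neg_mul]]
  refine IsUnit.mul ?_ (hB.2 c s hcs)
  exact ⟨⟨-J, J, by rw [neg_mul, hJ.2, neg_neg], by rw [mul_neg, hJ.2, neg_neg]⟩, rfl⟩

/-- `Lin S J` deforms into its elements anticommuting with `J`. -/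
theorem lin_retract {X : Type*} [TopologicalSpace X] [CompactSpace X] (hJ : IsCplx S J)
    {B : X → Matrix n n ℝ} (hBc : Continuous B) (hB : ∀ x, B x ∈ Lin S J) :
    ∃ H : I × X → Matrix n n ℝ, Continuous H ∧ (∀ p, H p ∈ Lin S J) ∧ (∀ x, H (0, x) = B x) ∧
      (∀ x, H (1, x) * J = -(J * H (1, x))) ∧
      (∀ x, B x * J = -(J * B x) → ∀ t, H (t, x) * J = -(J * H (t, x))) ∧
      ∀ x, B x * J = -(J * B x) → B x * B x = -1 → ∀ t, H (t, x) = B x := by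
  have hy : ∀ x, SkewFactor S J (-(J * B x)) := fun x => SkewFactor.of_mem hJ (hB x).1
  have hr : ∀ x, NoReal (-(J * B x)) := fun x => noReal_of_mem hJ (hB x)
  have hJB : ∀ x, J * -(J * B x) = B x := fun x => by
    rw [mul_neg, ← mul_assoc, hJ.2, neg_mul, one_mul, neg_neg]
  have hyc : Continuous fun x => -(J * B x) := by fun_prop
  obtain ⟨N, hN, hneg⟩ := exists_rotAvg_neg hyc hr
  have hfc : Continuous fun x => rotAvg N (-(J * B x)) := by
    unfold rotAvg
    exact (continuous_finsetSum _ fun k _ => continuous_rot continuous_const hyc hr).const_smul (1 / (N : ℝ))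
  set f := fun x => rotAvg N (-(J * B x)) with hf
  have hfy : ∀ x, SkewFactor S J (f x) := fun x => (hy x).rotAvg (hr x) N
  let z : ℝ → X → Matrix n n ℝ := fun a x => (1 - a) • (-(J * B x)) + a • f x
  have hz : ∀ a x, SkewFactor S J (z a x) := fun a x => ((hy x).smul _).add ((hfy x).smul _)
  have hanti : ∀ x, B x * J = -(J * B x) → ∀ a, (z a x)ᵀ = -z a x := by
    intro x hx a
    have h1 : J * -(J * B x) = -(-(J * B x)) * J := by
      rw [hJB, neg_neg, mul_assoc, hx, mul_neg, ← mul_assoc, hJ.2]; simp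
    have h2 := semiconj_rotAvg (hr x) (hr x).neg h1 N
    rw [rotAvg_neg (hr x) N hN] at h2
    rw [(hz a x).transpose_eq hJ]
    have h3 : J * z a x = -z a x * J := by
      simp only [z, hf]
      rw [mul_add, mul_smul_comm, mul_smul_comm, h1, h2]
      simp only [neg_add, neg_mul, add_mul, smul_mul_assoc, smul_neg, neg_neg]
    rw [h3, mul_assoc, hJ.2]; simp
  have hskew : ∀ w : Matrix n n ℝ, SkewFactor S J w → wᵀ = -w → J * w * J = -(J * (J * w)) := by
    intro w hw hw'
    have := hw.1
    rw [hw', neg_mul, neg_eq_iff_eq_neg] at this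
    rw [mul_assoc, this, mul_neg]
  refine ⟨fun p => J * (z (min (2 * p.1) 1) p.2 - (max (2 * (p.1 : ℝ) - 1) 0 / 2) •
    (z (min (2 * p.1) 1) p.2 + (z (min (2 * p.1) 1) p.2)ᵀ)), ?_, ?_, ?_, ?_, ?_, ?_⟩
  · simp only [z]
    fun_prop
  · intro p
    have hzz := hz (min (2 * p.1) 1) p.2
    refine mul_mem_Lin hJ ?_ ?_
    · rw [sub_eq_add_neg, ← neg_smul]
      exact hzz.add ((hzz.add (hzz.transpose hJ)).smul _)
    · have h0 := p.1.2.1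
      have h1 := p.1.2.2
      rcases le_total (2 * (p.1 : ℝ)) 1 with h | h
      · rw [min_eq_left h, max_eq_right (by linarith)]
        simp only [zero_div, zero_smul, sub_zero]
        exact (hr _).convex_rotAvg N hN (by linarith) h
      · rw [min_eq_right h, max_eq_left (by linarith)]
        simp only [z, sub_self, zero_smul, zero_add, one_smul]
        exact noReal_of_negSq (hneg p.2) (by linarith) (by linarith)
  · intro x
    simp [z, ← mul_assoc, hJ.2]
  · intro x
    have e1 : min (2 * ((1 : I) : ℝ)) 1 = 1 := by norm_num
    have e2 : max (2 * ((1 : I) : ℝ) - 1) 0 / 2 = 1 / 2 := by norm_num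
    simp only [e1, e2]
    have h1 := hz 1 x
    generalize z 1 x = w at h1 ⊢
    refine hskew _ ?_ ?_
    · rw [sub_eq_add_neg, ← neg_smul]
      exact h1.add ((h1.add (h1.transpose hJ)).smul _)
    · rw [transpose_sub, transpose_smul, transpose_add, transpose_transpose]
      module
  · intro x hx t
    have h := hanti x hx (min (2 * t) 1)
    simp only [h, add_neg_cancel, smul_zero, sub_zero]
    exact hskew _ (hz _ _) h
  · intro x hx hx2 t
    have h := hanti x hx (min (2 * t) 1)
    simp only [h, add_neg_cancel, smul_zero, sub_zero]
    have hsq : -(J * B x) * -(J * B x) = -1 := by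
      rw [neg_mul_neg, mul_assoc, ← mul_assoc (B x), hx, neg_mul, mul_assoc J, hx2]
      rw [mul_neg, ← mul_assoc, hJ.2]; simp
    have : f x = -(J * B x) := rotAvg_of_sq (hr x) hsq N hN
    simp only [z, this]
    rw [← add_smul, sub_add_cancel, one_smul, hJB]

end RetrLin

end Bott

open scoped Topology

namespace Bott

open unitInterval Set Matrix

section StarEquiv

variable {A B : Type*} [Ring A] [StarRing A] [Algebra ℝ A] [StarModule ℝ A] [TopologicalSpace A]
  [Ring B] [StarRing B] [Algebra ℝ B] [StarModule ℝ B] [TopologicalSpace B]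

/-- An algebra equivalence which is a homeomorphism and respects the involution. -/
structure IsStarHomeo (φ : A ≃ₐ[ℝ] B) : Prop where
  map_star : ∀ x, φ (star x) = star (φ x)
  continuous : Continuous φ
  continuous_symm : Continuous φ.symm

namespace IsStarHomeo

variable {φ : A ≃ₐ[ℝ] B} {S : Set A} {J x : A}

theorem mem_skewAnti (hφ : IsStarHomeo φ) : φ x ∈ skewAnti (φ '' S) ↔ x ∈ skewAnti S := by
  simp only [Bott.mem_skewAnti, forall_mem_image, ← hφ.map_star, ← map_mul, ← map_neg,
    φ.injective.eq_iff]

theorem mem_USkew (hφ : IsStarHomeo φ) : φ x ∈ USkew (φ '' S) ↔ x ∈ USkew S := by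
  simp only [USkew, mem_ofPred_eq, hφ.mem_skewAnti, MulEquiv.isUnit_map]

theorem mem_Lin (hφ : IsStarHomeo φ) : φ x ∈ Lin (φ '' S) (φ J) ↔ x ∈ Lin S J := by
  simp only [Lin, mem_ofPred_eq, hφ.mem_skewAnti, ← map_smul, ← map_add, MulEquiv.isUnit_map]

theorem isCplx (hφ : IsStarHomeo φ) : IsCplx (φ '' S) (φ J) ↔ IsCplx S J := by
  simp only [IsCplx, hφ.mem_skewAnti, ← map_mul, ← map_one φ, ← map_neg, φ.injective.eq_iff]

end IsStarHomeo

end StarEquiv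

section Block

variable {A : Type*} [Ring A] [StarRing A] [Algebra ℝ A] [StarModule ℝ A] [TopologicalSpace A]
variable {m n : Type*} [Fintype m] [DecidableEq m] [Fintype n] [DecidableEq n]

theorem mem_skewAnti_scalar {S : Set A} {x : Matrix m m A} :
    x ∈ skewAnti (scalar m '' S) ↔
      (∀ i j, star (x i j) = -x j i) ∧ ∀ g ∈ S, ∀ i j, x i j * g = -(g * x i j) := by
  simp only [mem_skewAnti, forall_mem_image, ← Matrix.ext_iff, scalar_apply, mul_diagonal,
    diagonal_mul, Matrix.neg_apply, star_apply]
  constructor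
  · exact fun h => ⟨fun i j => h.1 j i, fun g hg i j => h.2 hg i j⟩
  · exact fun h => ⟨fun i j => h.1 j i, fun g hg i j => h.2 g hg i j⟩

theorem scalar_mem_skewAnti {S : Set A} {x : A} (hx : x ∈ skewAnti S) :
    scalar m x ∈ skewAnti (scalar m '' S) := by
  rw [mem_skewAnti_scalar]
  refine ⟨fun i j => ?_, fun g hg i j => ?_⟩
  · by_cases h : i = j
    · subst h; simp [hx.1]
    · simp [h, Ne.symm h]
  · by_cases h : i = j
    · subst h; simp [hx.2 g hg]
    · simp [h]

theorem IsCplx.scalar {S : Set A} {J : A} (hJ : IsCplx S J) :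
    IsCplx (Matrix.scalar m '' S) (Matrix.scalar m J) :=
  ⟨scalar_mem_skewAnti hJ.1, by rw [← map_mul, hJ.2, map_neg, map_one]⟩

theorem fromBlocks_mem_skewAnti {S : Set A} {x : Matrix m m A} {y : Matrix n n A}
    (hx : x ∈ skewAnti (scalar m '' S)) (hy : y ∈ skewAnti (scalar n '' S)) :
    fromBlocks x 0 0 y ∈ skewAnti (scalar (m ⊕ n) '' S) := by
  rw [mem_skewAnti_scalar] at *
  refine ⟨?_, ?_⟩
  · rintro (i | i) (j | j) <;> simp [hx.1, hy.1]
  · rintro g hg (i | i) (j | j) <;> simp [hx.2 g hg, hy.2 g hg]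

theorem isUnit_fromBlocks_diag {x : Matrix m m A} {y : Matrix n n A} (hx : IsUnit x)
    (hy : IsUnit y) : IsUnit (fromBlocks x 0 0 y) := by
  obtain ⟨u, rfl⟩ := hx
  obtain ⟨v, rfl⟩ := hy
  refine ⟨⟨fromBlocks u.1 0 0 v.1, fromBlocks u⁻¹.1 0 0 v⁻¹.1, ?_, ?_⟩, rfl⟩ <;>
    simp [fromBlocks_multiply]

theorem fromBlocks_mem_USkew {S : Set A} {x : Matrix m m A} {y : Matrix n n A}
    (hx : x ∈ USkew (scalar m '' S)) (hy : y ∈ USkew (scalar n '' S)) :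
    fromBlocks x 0 0 y ∈ USkew (scalar (m ⊕ n) '' S) :=
  ⟨fromBlocks_mem_skewAnti hx.1 hy.1, isUnit_fromBlocks_diag hx.2 hy.2⟩

theorem scalar_sum (J : A) : scalar (m ⊕ n) J = fromBlocks (scalar m J) 0 0 (scalar n J) := by
  ext (i | i) (j | j) <;> simp [diagonal_apply]

theorem fromBlocks_mem_Lin {S : Set A} {J : A} {x : Matrix m m A} {y : Matrix n n A}
    (hx : x ∈ Lin (scalar m '' S) (scalar m J)) (hy : y ∈ Lin (scalar n '' S) (scalar n J)) :
    fromBlocks x 0 0 y ∈ Lin (scalar (m ⊕ n) '' S) (scalar (m ⊕ n) J) := by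
  refine ⟨fromBlocks_mem_skewAnti hx.1 hy.1, fun c s hcs => ?_⟩
  rw [scalar_sum, fromBlocks_smul, fromBlocks_smul, fromBlocks_add]
  simpa using isUnit_fromBlocks_diag (hx.2 c s hcs) (hy.2 c s hcs)

theorem isStarHomeo_comp :
    IsStarHomeo (compAlgEquiv m n A ℝ : Matrix m m (Matrix n n A) ≃ₐ[ℝ] _) where
  map_star x := rfl
  continuous := continuous_matrix fun i j =>
    ((continuous_apply j.2).comp ((continuous_apply i.2).comp
      ((continuous_apply j.1).comp (continuous_apply i.1))))
  continuous_symm := by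
    refine continuous_matrix fun i j => continuous_matrix fun k l => ?_
    exact (continuous_apply (j, l)).comp (continuous_apply (i, k))

theorem isStarHomeo_reindex (e : m ≃ n) :
    IsStarHomeo (reindexAlgEquiv ℝ A e) where
  map_star x := rfl
  continuous := continuous_id.matrix_reindex e e
  continuous_symm := continuous_id.matrix_reindex e.symm e.symm

theorem comp_scalar_scalar (g : A) :
    compAlgEquiv m n A ℝ (scalar m (scalar n g)) = scalar (m × n) g :=
  comp_diagonal_diagonal fun _ _ => g

theorem comp_image_scalar (S : Set A) :
    compAlgEquiv m n A ℝ '' (scalar m '' (scalar n '' S)) = scalar (m × n) '' S := by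
  simp only [image_image, comp_scalar_scalar]

theorem reindex_scalar (e : m ≃ n) (g : A) :
    reindexAlgEquiv ℝ A e (scalar m g) = scalar n g := by
  ext i j
  simp [diagonal_apply]

theorem reindex_image_scalar (e : m ≃ n) (S : Set A) :
    reindexAlgEquiv ℝ A e '' (scalar m '' S) = scalar n '' S := by
  simp only [image_image, reindex_scalar]

end Block

/-- Square matrices with matrix entries. -/
abbrev Mat (ι κ : Type*) := Matrix κ κ (Matrix ι ι ℝ)

section MatLin

variable {ι κ : Type*} [Fintype ι] [DecidableEq ι] [Fintype κ] [DecidableEq κ]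

theorem Mat.isOpen_isUnit : IsOpen {x : Mat ι κ | IsUnit x} := by
  have : {x : Mat ι κ | IsUnit x} = {x | (compAlgEquiv κ ι ℝ ℝ x).det ≠ 0} := by
    ext x
    rw [mem_ofPred_eq, mem_ofPred_eq, ← isUnit_iff_ne_zero, ← isUnit_iff_isUnit_det,
      MulEquiv.isUnit_map]
  rw [this]
  exact isOpen_ne_fun (isStarHomeo_comp.continuous.matrix_det) continuous_const

theorem Mat.lin_retract {X : Type*} [TopologicalSpace X] [CompactSpace X] {S : Set (Mat ι κ)}
    {J : Mat ι κ} (hJ : IsCplx S J)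
    {B : X → Mat ι κ} (hBc : Continuous B) (hB : ∀ x, B x ∈ Lin S J) :
    ∃ H : I × X → Mat ι κ, Continuous H ∧ (∀ p, H p ∈ Lin S J) ∧ (∀ x, H (0, x) = B x) ∧
      (∀ x, H (1, x) * J = -(J * H (1, x))) ∧
      (∀ x, B x * J = -(J * B x) → ∀ t, H (t, x) * J = -(J * H (t, x))) ∧
      ∀ x, B x * J = -(J * B x) → B x * B x = -1 → ∀ t, H (t, x) = B x := by
  have hφ := isStarHomeo_comp (m := κ) (n := ι) (A := ℝ)
  set φ := (compAlgEquiv κ ι ℝ ℝ : Mat ι κ ≃ₐ[ℝ] _)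
  obtain ⟨H, h1, h2, h3, h4, h5, h6⟩ := Bott.lin_retract (hφ.isCplx.2 hJ) (hφ.continuous.comp hBc)
    fun x => hφ.mem_Lin.2 (hB x)
  have e : ∀ p, φ (φ.symm (H p)) = H p := fun p => φ.apply_symm_apply _
  refine ⟨fun p => φ.symm (H p), hφ.continuous_symm.comp h1, fun p => ?_, fun x => ?_, fun x => ?_,
    fun x hx t => ?_, fun x hx hx' t => ?_⟩
  · rw [← hφ.mem_Lin, e]; exact h2 p
  · rw [AlgEquiv.symm_apply_eq]; exact h3 x
  · rw [← φ.injective.eq_iff, map_neg, map_mul, map_mul, e]; exact h4 x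
  · rw [← φ.injective.eq_iff, map_neg, map_mul, map_mul, e]
    exact h5 x (by simp only [Function.comp, ← map_mul, ← map_neg, hx]) t
  · rw [AlgEquiv.symm_apply_eq]
    exact h6 x (by simp only [Function.comp, ← map_mul, ← map_neg, hx])
      (by simp only [Function.comp, ← map_mul, hx', map_neg, map_one]) t

end MatLin

end Bott

open scoped Topology

namespace Bott

open unitInterval Set

/-- `cos (π t)` on the unit interval. -/
noncomputable def cosI : C(I, ℝ) := ⟨fun t => Real.cos (Real.pi * t), by fun_prop⟩

/-- `sin (π t)` on the unit interval. -/
noncomputable def sinI : C(I, ℝ) := ⟨fun t => Real.sin (Real.pi * t), by fun_prop⟩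

theorem cosI_sq_add (t : I) : cosI t ^ 2 + sinI t ^ 2 = 1 := Real.cos_sq_add_sin_sq _
@[simp] theorem cosI_zero : cosI 0 = 1 := by simp [cosI]
@[simp] theorem sinI_zero : sinI 0 = 0 := by simp [sinI]
@[simp] theorem sinI_one : sinI 1 = 0 := by simp [sinI]

theorem sinI_nonneg (t : I) : 0 ≤ sinI t :=
  Real.sin_nonneg_of_nonneg_of_le_pi (mul_nonneg Real.pi_pos.le t.2.1)
    (by nlinarith [t.2.2, Real.pi_pos])

theorem sinI_eq_zero {t : I} (h : sinI t = 0) : t = 0 ∨ t = 1 := by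
  by_contra! hc
  have h0 : (0 : ℝ) < t := lt_of_le_of_ne t.2.1 fun h => hc.1 (Subtype.ext h.symm)
  have h1 : (t : ℝ) < 1 := lt_of_le_of_ne t.2.2 fun h => hc.2 (Subtype.ext h)
  have : 0 < Real.sin (Real.pi * t) :=
    Real.sin_pos_of_pos_of_lt_pi (by have := Real.pi_pos; positivity) (by nlinarith [Real.pi_pos])
  exact this.ne' h

theorem cosI_injective : Function.Injective cosI := by
  intro a b h
  have := Real.injOn_cos (x₁ := Real.pi * a) (x₂ := Real.pi * b)
    ⟨mul_nonneg Real.pi_pos.le a.2.1, by nlinarith [a.2.2, Real.pi_pos]⟩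
    ⟨mul_nonneg Real.pi_pos.le b.2.1, by nlinarith [b.2.2, Real.pi_pos]⟩ h
  exact Subtype.ext (mul_left_cancel₀ Real.pi_ne_zero this)

/-- The relative part of `X × I`. -/
def relEnds {X : Type*} (A : Set X) : Set (X × I) := {p | p.1 ∈ A ∨ p.2 = 0 ∨ p.2 = 1}

section Deg

variable {X E : Type*} [TopologicalSpace X] [AddCommGroup E] [Module ℝ E]
  [TopologicalSpace E] (V : Submodule ℝ E) (A : Set X)

/-- Functions obtained from `sin (π t) • d x` by iterated quadratic combinations. -/
def Deg : ℕ → (X × I → E) → Prop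
  | 0, D => ∃ d : X → E, Continuous d ∧ (∀ x, d x ∈ V) ∧ (∀ x ∈ A, d x = 0) ∧
      ∀ p, D p = sinI p.2 • d p.1
  | n + 1, D => ∃ D₁ D₂ D₃, Deg n D₁ ∧ Deg n D₂ ∧ Deg n D₃ ∧
      ∀ p, D p = cosI p.2 ^ 2 • D₁ p + (2 * (cosI p.2 * sinI p.2)) • D₂ p + sinI p.2 ^ 2 • D₃ p

variable {V A}

namespace Deg

variable {n m : ℕ} {D D' : X × I → E}

theorem mem (h : Deg V A n D) (p : X × I) : D p ∈ V := by
  induction n generalizing D with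
  | zero => obtain ⟨d, -, h, -, e⟩ := h; rw [e]; exact V.smul_mem _ (h _)
  | succ n ih =>
    obtain ⟨D₁, D₂, D₃, h₁, h₂, h₃, e⟩ := h
    rw [e]
    exact V.add_mem (V.add_mem (V.smul_mem _ (ih h₁)) (V.smul_mem _ (ih h₂))) (V.smul_mem _ (ih h₃))

theorem eq_zero (h : Deg V A n D) {p : X × I} (hp : p ∈ relEnds A) : D p = 0 := by
  induction n generalizing D with
  | zero =>
    obtain ⟨d, -, -, h, e⟩ := h
    rw [e]
    rcases hp with hp | hp | hp
    · rw [h _ hp, smul_zero]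
    · simp [hp]
    · simp [hp]
  | succ n ih =>
    obtain ⟨D₁, D₂, D₃, h₁, h₂, h₃, e⟩ := h
    rw [e, ih h₁, ih h₂, ih h₃]; simp

theorem continuous [ContinuousAdd E] [ContinuousSMul ℝ E] (h : Deg V A n D) : Continuous D := by
  induction n generalizing D with
  | zero =>
    obtain ⟨d, h, -, -, e⟩ := h
    rw [funext e]; fun_prop
  | succ n ih =>
    obtain ⟨D₁, D₂, D₃, h₁, h₂, h₃, e⟩ := h
    have := ih h₁; have := ih h₂; have := ih h₃
    rw [funext e]; fun_prop

theorem congr (h : Deg V A n D) (e : ∀ p, D' p = D p) : Deg V A n D' := by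
  rw [show D' = D from funext e]; exact h

theorem add [ContinuousAdd E] (h : Deg V A n D) (h' : Deg V A n D') :
    Deg V A n fun p => D p + D' p := by
  induction n generalizing D D' with
  | zero =>
    obtain ⟨d, h1, h2, h3, e⟩ := h
    obtain ⟨d', h1', h2', h3', e'⟩ := h'
    refine ⟨fun x => d x + d' x, h1.add h1', fun x => V.add_mem (h2 x) (h2' x),
      fun x hx => by simp [h3 x hx, h3' x hx], fun p => by simp [e, e']⟩
  | succ n ih =>
    obtain ⟨D₁, D₂, D₃, h₁, h₂, h₃, e⟩ := h
    obtain ⟨D₁', D₂', D₃', h₁', h₂', h₃', e'⟩ := h'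
    refine ⟨_, _, _, ih h₁ h₁', ih h₂ h₂', ih h₃ h₃', fun p => ?_⟩
    beta_reduce; rw [e, e']; module

/-- Postcomposition with a continuous linear map. -/
theorem map {E' : Type*} [AddCommGroup E'] [Module ℝ E'] [TopologicalSpace E']
    {V' : Submodule ℝ E'} (h : Deg V A n D) (f : E →L[ℝ] E') (hf : ∀ v ∈ V, f v ∈ V') :
    Deg V' A n fun p => f (D p) := by
  induction n generalizing D with
  | zero =>
    obtain ⟨d, h1, h2, h3, e⟩ := h
    exact ⟨fun x => f (d x), f.continuous.comp h1, fun x => hf _ (h2 x),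
      fun x hx => by simp [h3 x hx], fun p => by simp [e]⟩
  | succ n ih =>
    obtain ⟨D₁, D₂, D₃, h₁, h₂, h₃, e⟩ := h
    exact ⟨_, _, _, ih h₁, ih h₂, ih h₃, fun p => by beta_reduce; rw [e]; simp⟩

theorem zero : Deg V A n fun _ => 0 := by
  induction n with
  | zero => exact ⟨fun _ => 0, continuous_const, fun _ => V.zero_mem, fun _ _ => rfl, by simp⟩
  | succ n ih => exact ⟨_, _, _, ih, ih, ih, by simp⟩

theorem cos_sq (h : Deg V A n D) : Deg V A (n + 1) fun p => cosI p.2 ^ 2 • D p :=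
  ⟨D, _, _, h, zero, zero, by simp⟩

theorem smul [ContinuousConstSMul ℝ E] (h : Deg V A n D) (c : ℝ) :
    Deg V A n fun p => c • D p :=
  h.map (c • ContinuousLinearMap.id ℝ E) fun _ hv => V.smul_mem _ hv

theorem cos_mul_sin [ContinuousConstSMul ℝ E] (h : Deg V A n D) :
    Deg V A (n + 1) fun p => (cosI p.2 * sinI p.2) • D p :=
  ⟨_, _, _, zero, h.smul (1 / 2), zero, fun p => by
    simp only [smul_zero, zero_add, add_zero, smul_smul]; congr 1; ring⟩

theorem succ (h : Deg V A n D) : Deg V A (n + 1) D :=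
  ⟨D, _, D, h, zero, h, fun p => by
    rw [smul_zero, add_zero, ← add_smul, cosI_sq_add, one_smul]⟩

theorem mono (h : Deg V A n D) (hnm : n ≤ m) : Deg V A m D := by
  induction m, hnm using Nat.le_induction with
  | base => exact h
  | succ m _ ih => exact ih.succ

end Deg

end Deg

section Approx

variable {X E : Type*} [TopologicalSpace X] [CompactSpace X] [NormedAddCommGroup E]
  [NormedSpace ℝ E] (V : Submodule ℝ E) (A : Set X)

/-- Scalar functions `ψ` for which all `ψ t • v x` can be approximated. -/
def goodScalar : Submodule ℝ C(I, ℝ) where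
  carrier := {ψ | ∀ v : X → E, Continuous v → (∀ x, v x ∈ V) → (∀ x ∈ A, v x = 0) → ∀ ε > 0,
    ∃ n D, Deg V A n D ∧ ∀ p : X × I, ‖ψ p.2 • v p.1 - D p‖ < ε}
  zero_mem' := fun v _ _ _ ε hε => ⟨0, _, Deg.zero, fun p => by simpa using hε⟩
  add_mem' := by
    intro a b ha hb v h1 h2 h3 ε hε
    obtain ⟨n, D, hD, h⟩ := ha v h1 h2 h3 (ε / 2) (half_pos hε)
    obtain ⟨m, D', hD', h'⟩ := hb v h1 h2 h3 (ε / 2) (half_pos hε)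
    refine ⟨max n m, _, (hD.mono (le_max_left _ _)).add (hD'.mono (le_max_right _ _)),
      fun p => ?_⟩
    calc _ = ‖(a p.2 • v p.1 - D p) + (b p.2 • v p.1 - D' p)‖ := by
          congr 1; rw [ContinuousMap.add_apply]; module
      _ ≤ _ := norm_add_le _ _
      _ < ε := by linarith [h p, h' p]
  smul_mem' := by
    intro c a ha v h1 h2 h3 ε hε
    obtain ⟨n, D, hD, h⟩ := ha v h1 h2 h3 (ε / (|c| + 1)) (by positivity)
    refine ⟨n, _, hD.smul c, fun p => ?_⟩
    calc _ = |c| * ‖(a p.2 • v p.1 - D p)‖ := by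
          rw [← Real.norm_eq_abs, ← norm_smul]; congr 1; rw [ContinuousMap.smul_apply]
          simp only [smul_eq_mul]; module
      _ ≤ |c| * (ε / (|c| + 1)) := by gcongr; exact (h p).le
      _ < (|c| + 1) * (ε / (|c| + 1)) := by
          have : 0 < ε / (|c| + 1) := by positivity
          nlinarith
      _ = ε := by field_simp

variable {V A}

theorem isClosed_goodScalar : IsClosed (goodScalar V A : Set C(I, ℝ)) := by
  rw [← isSeqClosed_iff_isClosed]
  intro u a hu ha v h1 h2 h3 ε hε
  obtain ⟨C, hC⟩ := isCompact_univ.exists_bound_of_continuousOn h1.continuousOn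
  rw [Metric.tendsto_atTop] at ha
  obtain ⟨N, hN⟩ := ha (ε / 2 / (|C| + 1)) (by positivity)
  obtain ⟨n, D, hD, h⟩ := hu N v h1 h2 h3 (ε / 2) (half_pos hε)
  refine ⟨n, D, hD, fun p => ?_⟩
  have h4 : |a p.2 - u N p.2| ≤ ε / 2 / (|C| + 1) := by
    rw [abs_sub_comm, ← Real.dist_eq]
    exact (ContinuousMap.dist_apply_le_dist _).trans (hN N le_rfl).le
  calc _ = ‖(a p.2 - u N p.2) • v p.1 + (u N p.2 • v p.1 - D p)‖ := by congr 1; module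
    _ ≤ ‖(a p.2 - u N p.2) • v p.1‖ + ‖u N p.2 • v p.1 - D p‖ := norm_add_le _ _
    _ = |a p.2 - u N p.2| * ‖v p.1‖ + ‖u N p.2 • v p.1 - D p‖ := by
        rw [norm_smul, Real.norm_eq_abs]
    _ ≤ ε / 2 / (|C| + 1) * (|C| + 1) + ‖u N p.2 • v p.1 - D p‖ := by
        gcongr
        linarith [hC p.1 (mem_univ _), le_abs_self C]
    _ < ε := by
        have : ε / 2 / (|C| + 1) * (|C| + 1) = ε / 2 := by field_simp
        linarith [h p]

theorem mul_mem_goodScalar_of {a : C(I, ℝ)} (ha : ∀ t, |a t| ≤ 1)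
    (h : ∀ n (D : X × I → E), Deg V A n D → Deg V A (n + 1) fun p => a p.2 • D p)
    {ψ : C(I, ℝ)} (hψ : ψ ∈ goodScalar V A) : a * ψ ∈ goodScalar V A := by
  intro v h1 h2 h3 ε hε
  obtain ⟨n, D, hD, h'⟩ := hψ v h1 h2 h3 ε hε
  refine ⟨_, _, h n D hD, fun p => ?_⟩
  rw [ContinuousMap.mul_apply, mul_smul, ← smul_sub, norm_smul, Real.norm_eq_abs]
  exact (mul_le_of_le_one_left (norm_nonneg _) (ha _)).trans_lt (h' p)

variable (V A) in
/-- Scalar functions which act on `goodScalar`. -/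
def goodMul : Subalgebra ℝ C(I, ℝ) where
  carrier := {a | ∀ ψ ∈ goodScalar V A, a * ψ ∈ goodScalar V A}
  mul_mem' := fun ha hb ψ hψ => by rw [mul_assoc]; exact ha _ (hb _ hψ)
  add_mem' := fun ha hb ψ hψ => by rw [add_mul]; exact add_mem (ha _ hψ) (hb _ hψ)
  algebraMap_mem' := fun r ψ hψ => by
    rw [← Algebra.smul_def]; exact (goodScalar V A).smul_mem _ hψ

theorem isClosed_goodMul : IsClosed (goodMul V A : Set C(I, ℝ)) := by
  have : (goodMul V A : Set C(I, ℝ)) = ⋂ ψ ∈ goodScalar V A, (fun a => a * ψ) ⁻¹' goodScalar V A := by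
    ext a; simp [goodMul]
  rw [this]
  exact isClosed_biInter fun ψ _ => isClosed_goodScalar.preimage (by fun_prop)

theorem cosI_sq_mem : cosI ^ 2 ∈ goodMul V A := fun ψ hψ =>
  mul_mem_goodScalar_of (fun t => by
    rw [ContinuousMap.pow_apply, abs_of_nonneg (sq_nonneg _)]
    nlinarith [cosI_sq_add t, sq_nonneg (sinI t)]) (fun n D hD => hD.cos_sq) hψ

theorem cosI_mul_sinI_mem : cosI * sinI ∈ goodMul V A := fun ψ hψ =>
  mul_mem_goodScalar_of (fun t => by
    rw [ContinuousMap.mul_apply, abs_le]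
    constructor <;> nlinarith [cosI_sq_add t, sq_nonneg (sinI t + cosI t),
      sq_nonneg (sinI t - cosI t)]) (fun n D hD => hD.cos_mul_sin) hψ

theorem sinI_mem_goodMul : sinI ∈ goodMul V A := by
  have h1 : (1 - cosI ^ 2 : C(I, ℝ)) ∈ goodMul V A := sub_mem (one_mem _) cosI_sq_mem
  have h2 := ContinuousMap.comp_attachBound_mem_closure (goodMul V A) ⟨_, h1⟩
    ⟨fun x => Real.sqrt x, by fun_prop⟩
  rw [← SetLike.mem_coe, Subalgebra.topologicalClosure_coe, isClosed_goodMul.closure_eq] at h2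
  refine (congrArg (· ∈ (goodMul V A : Set C(I, ℝ))) (ContinuousMap.ext fun t => ?_)).mpr h2
  change sinI t = Real.sqrt (1 - cosI t ^ 2)
  rw [← cosI_sq_add t, add_sub_cancel_left, Real.sqrt_sq (sinI_nonneg t)]

theorem sinI_mem_goodScalar : sinI ∈ goodScalar V A := fun v h1 h2 h3 ε hε =>
  ⟨0, fun p => sinI p.2 • v p.1, ⟨v, h1, h2, h3, fun _ => rfl⟩, fun p => by simpa using hε⟩

theorem mul_sinI_sq_mem (a : C(I, ℝ)) : a * sinI ^ 2 ∈ goodScalar V A := by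
  let N : Submodule ℝ C(I, ℝ) := (goodScalar V A).comap (LinearMap.mulRight ℝ (sinI ^ 2))
  have hN : ∀ a, a ∈ N ↔ a * sinI ^ 2 ∈ goodScalar V A := fun a => Iff.rfl
  have hpow : ∀ k, cosI ^ k ∈ N := by
    intro k
    rw [hN]
    rcases Nat.even_or_odd' k with ⟨i, rfl | rfl⟩
    · rw [show cosI ^ (2 * i) * sinI ^ 2 = ((cosI ^ 2) ^ i * sinI) * sinI by ring]
      exact mul_mem (pow_mem cosI_sq_mem i) sinI_mem_goodMul _ sinI_mem_goodScalar
    · rw [show cosI ^ (2 * i + 1) * sinI ^ 2 = ((cosI ^ 2) ^ i * (cosI * sinI)) * sinI by ring]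
      exact mul_mem (pow_mem cosI_sq_mem i) cosI_mul_sinI_mem _ sinI_mem_goodScalar
  have hadj : ∀ a ∈ Algebra.adjoin ℝ {cosI}, a ∈ N := by
    intro a ha
    rw [Algebra.adjoin_singleton_eq_range_aeval] at ha
    obtain ⟨p, rfl⟩ := ha
    change Polynomial.aeval cosI p ∈ N
    induction p using Polynomial.induction_on' with
    | add p q hp hq => rw [map_add]; exact N.add_mem hp hq
    | monomial k c =>
      rw [Polynomial.aeval_monomial, ← Algebra.smul_def]
      exact N.smul_mem _ (hpow k)
  have htop := ContinuousMap.subalgebra_topologicalClosure_eq_top_of_separatesPoints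
    (Algebra.adjoin ℝ {cosI}) fun x y hxy => ⟨_, ⟨cosI, Algebra.subset_adjoin rfl, rfl⟩,
      fun h => hxy (cosI_injective h)⟩
  have hcl : IsClosed (N : Set C(I, ℝ)) := by
    have h : Continuous fun a : C(I, ℝ) => a * sinI ^ 2 := by fun_prop
    have h' := (isClosed_goodScalar (V := V) (A := A)).preimage h
    exact h'
  have : a ∈ (Algebra.adjoin ℝ {cosI}).topologicalClosure := by rw [htop]; trivial
  exact closure_minimal hadj hcl this

theorem mem_goodScalar {ψ : C(I, ℝ)} (h0 : ψ 0 = 0) (h1 : ψ 1 = 0) : ψ ∈ goodScalar V A := by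
  have h := ContinuousMap.idealOfSet_ofIdeal_eq_closure (𝕜 := ℝ) (Ideal.span {sinI ^ 2})
  have h2 : ψ ∈ (Ideal.span {sinI ^ 2} : Ideal C(I, ℝ)).closure := by
    rw [← h, ContinuousMap.mem_idealOfSet]
    intro t ht
    have := ContinuousMap.notMem_setOfIdeal.1 ht (Ideal.mem_span_singleton_self _)
    rcases sinI_eq_zero (pow_eq_zero_iff two_ne_zero |>.1 this) with rfl | rfl
    exacts [h0, h1]
  refine closure_minimal ?_ isClosed_goodScalar h2
  intro a ha
  obtain ⟨b, rfl⟩ := Ideal.mem_span_singleton.1 ha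
  rw [mul_comm]
  exact mul_sinI_sq_mem b

theorem Deg.exists_approx {D : X × I → E} (hc : Continuous D) (hV : ∀ p, D p ∈ V)
    (h0 : ∀ p ∈ relEnds A, D p = 0) {ε : ℝ} (hε : 0 < ε) :
    ∃ n D', Deg V A n D' ∧ ∀ p, ‖D p - D' p‖ < ε := by
  let F : C(I, C(X, E)) := ContinuousMap.curry ⟨fun q : I × X => D (q.2, q.1), by fun_prop⟩
  have h := bernsteinApproximation_uniform F
  rw [Metric.tendsto_atTop] at h
  obtain ⟨N, hN⟩ := h (ε / 2) (half_pos hε)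
  specialize hN (N + 1) (by omega)
  have key : ∀ k : Fin (N + 1 + 1), ∃ n D', Deg V A n D' ∧ ∀ p : X × I,
      ‖bernstein (N + 1) k p.2 • D (p.1, bernstein.z k) - D' p‖ < ε / 2 / (N + 2) := by
    intro k
    by_cases hk : bernstein.z k = 0 ∨ bernstein.z k = 1
    · refine ⟨0, _, Deg.zero, fun p => ?_⟩
      rw [h0 (p.1, bernstein.z k) (Or.inr hk)]
      simp; positivity
    · have hk0 : (k : ℕ) ≠ 0 := by
        intro h; apply hk; left
        simp [bernstein.z, h]
      have hk1 : (k : ℕ) ≠ N + 1 := by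
        intro h; apply hk; right
        ext; simp only [bernstein.z, h]; push_cast; exact div_self (by positivity)
      have := mem_goodScalar (V := V) (A := A) (ψ := bernstein (N + 1) k)
        (by simp [bernstein_apply, hk0])
        (by rw [bernstein_apply]; simp; right; have := k.2; omega)
      exact this (fun x => D (x, bernstein.z k)) (by fun_prop) (fun x => hV _)
        (fun x hx => h0 _ (Or.inl hx)) _ (by positivity)
  choose n D' hD' hlt using key
  refine ⟨Finset.univ.sup n, fun p => ∑ k, D' k p, ?_, fun p => ?_⟩
  · have : ∀ s : Finset (Fin (N + 1 + 1)), Deg V A (Finset.univ.sup n) fun p => ∑ k ∈ s, D' k p := by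
      intro s
      induction s using Finset.induction_on with
      | empty => simpa using Deg.zero
      | insert a s ha ih =>
        simp only [Finset.sum_insert ha]
        exact ((hD' a).mono (Finset.le_sup (Finset.mem_univ a))).add ih
    exact this _
  · have e1 : ‖D p - bernsteinApproximation (N + 1) F p.2 p.1‖ < ε / 2 := by
      rw [← dist_eq_norm, dist_comm]
      exact ((ContinuousMap.dist_apply_le_dist p.1).trans
        (ContinuousMap.dist_apply_le_dist (f := bernsteinApproximation (N + 1) F) (g := F) p.2)).trans_lt hN
    have e2 : bernsteinApproximation (N + 1) F p.2 p.1 =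
        ∑ k : Fin (N + 1 + 1), bernstein (N + 1) k p.2 • D (p.1, bernstein.z k) := by
      rw [bernsteinApproximation.apply, ContinuousMap.sum_apply]
      rfl
    have e3 : ‖bernsteinApproximation (N + 1) F p.2 p.1 - ∑ k, D' k p‖ ≤ ε / 2 := by
      rw [e2, ← Finset.sum_sub_distrib]
      refine (norm_sum_le _ _).trans ((Finset.sum_le_sum fun k _ => (hlt k p).le).trans ?_)
      simp only [Finset.sum_const, Finset.card_univ, Fintype.card_fin, nsmul_eq_mul]
      push_cast
      have : ((N : ℝ) + 1 + 1) * (ε / 2 / (N + 2)) = ε / 2 := by field_simp; ring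
      rw [this]
    calc _ = ‖(D p - bernsteinApproximation (N + 1) F p.2 p.1) +
          (bernsteinApproximation (N + 1) F p.2 p.1 - ∑ k, D' k p)‖ := by congr 1; abel
      _ ≤ _ := norm_add_le _ _
      _ < ε := by linarith

end Approx

section MatApprox

open Matrix

variable {ι κ : Type*} [Fintype ι] [DecidableEq ι] [Fintype κ] [DecidableEq κ]

attribute [local instance] Matrix.normedAddCommGroup Matrix.normedSpace

/-- Approximating the nonlinear part of a family of invertible matrices. -/
theorem Mat.exists_deg_approx {X : Type*} [TopologicalSpace X] [CompactSpace X]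
    {V : Submodule ℝ (Mat ι κ)} {A : Set X} {F D : X × I → Mat ι κ} (hF : Continuous F)
    (hc : Continuous D) (hV : ∀ p, D p ∈ V) (h0 : ∀ p ∈ relEnds A, D p = 0)
    (hu : ∀ p, IsUnit (F p + D p)) :
    ∃ n D', Deg V A n D' ∧ ∀ p, ∀ τ ∈ Icc (0 : ℝ) 1,
      IsUnit (F p + ((1 - τ) • D p + τ • D' p)) := by
  obtain ⟨ε, hε, hsub⟩ := (isCompact_range (hF.add hc)).exists_thickening_subset_open
    (Mat.isOpen_isUnit (ι := ι) (κ := κ)) (by rintro _ ⟨p, rfl⟩; exact hu p)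
  obtain ⟨n, D', hD', h⟩ := Deg.exists_approx hc hV h0 hε
  refine ⟨n, D', hD', fun p τ hτ => ?_⟩
  refine hsub (Metric.mem_thickening_iff.2 ⟨F p + D p, mem_range_self p, ?_⟩)
  rw [dist_comm, dist_eq_norm]
  calc _ = ‖τ • (D p - D' p)‖ := by congr 1; module
    _ = τ * ‖D p - D' p‖ := by rw [norm_smul, Real.norm_eq_abs, abs_of_nonneg hτ.1]
    _ ≤ ‖D p - D' p‖ := mul_le_of_le_one_left (norm_nonneg _) hτ.2
    _ < ε := h p

end MatApprox

end Bott

open scoped Topology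

namespace Bott

open unitInterval Set Matrix

section Conj

variable {A : Type*} [Ring A] [StarRing A] [Algebra ℝ A] [StarModule ℝ A] {S : Set A} {x U J : A}

theorem conj_mem_skewAnti (hU : ∀ g ∈ S, U * g = g * U) (hU' : ∀ g ∈ S, star U * g = g * star U)
    (hx : x ∈ skewAnti S) : star U * x * U ∈ skewAnti S := by
  refine ⟨by simp [hx.1, mul_assoc], fun g hg => ?_⟩
  rw [mul_assoc, hU g hg, ← mul_assoc, mul_assoc (star U), hx.2 g hg, mul_neg, ← mul_assoc,
    hU' g hg]
  noncomm_ring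

theorem conj_mem_USkew (hU : ∀ g ∈ S, U * g = g * U) (hU' : ∀ g ∈ S, star U * g = g * star U)
    (hu : IsUnit U) (hx : x ∈ USkew S) : star U * x * U ∈ USkew S :=
  ⟨conj_mem_skewAnti hU hU' hx.1, (hu.star.mul hx.2).mul hu⟩

theorem conj_mem_Lin (hU : ∀ g ∈ S, U * g = g * U) (hU' : ∀ g ∈ S, star U * g = g * star U)
    (hu : IsUnit U) (hx : x ∈ Lin S J) : star U * x * U ∈ Lin S (star U * J * U) := by
  refine ⟨conj_mem_skewAnti hU hU' hx.1, fun c s h => ?_⟩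
  have := (hu.star.mul (hx.2 c s h)).mul hu
  convert! this using 1
  rw [mul_add, add_mul]
  simp only [smul_mul_assoc, mul_smul_comm]

end Conj

section Swap

variable {A : Type*} [Ring A] [StarRing A] [Algebra ℝ A] [StarModule ℝ A]

/-- The linearization block of a quadratic expression. -/
noncomputable def linBlock (J : A) (c s : ℝ) (P₁ Q P₂ : A) : Matrix (Fin 3) (Fin 3) A :=
  !![P₁, s • J, Q; s • J, 0, -(c • J); Q, -(c • J), P₂]

/-- The quadratic expression itself. -/
def quad (c s : ℝ) (P₁ Q P₂ : A) : A := c ^ 2 • P₁ + (2 * (c * s)) • Q + s ^ 2 • P₂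

/-- Block sum of an entry and a `3 × 3` matrix. -/
def sum4 (a : A) (M : Matrix (Fin 3) (Fin 3) A) : Matrix (Fin 4) (Fin 4) A :=
  !![a, 0, 0, 0; 0, M 0 0, M 0 1, M 0 2; 0, M 1 0, M 1 1, M 1 2; 0, M 2 0, M 2 1, M 2 2]

/-- The reflection turning `linBlock` into a triangular shape. -/
def refl4 (A : Type*) [Ring A] [Algebra ℝ A] (c s : ℝ) : Matrix (Fin 4) (Fin 4) A :=
  !![1, 0, 0, 0; 0, c • 1, 0, s • 1; 0, 0, 1, 0; 0, s • 1, 0, -(c • 1)]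

/-- The triangular shape. -/
def tri4 (J a b d Q P : A) : Matrix (Fin 4) (Fin 4) A :=
  !![a, b, 0, 0; b, d, 0, Q; 0, 0, 0, J; 0, Q, J, P]

theorem refl4_mul_self {c s : ℝ} (h : c ^ 2 + s ^ 2 = 1) : refl4 A c s * refl4 A c s = 1 := by
  have e1 : (c * c + s * s) • (1 : A) = 1 := by rw [← sq, ← sq, h, one_smul]
  have e2 : (s * s + c * c) • (1 : A) = 1 := by rw [← sq, ← sq, add_comm, h, one_smul]
  ext i j
  fin_cases i <;> fin_cases j <;>
    simp [refl4, Matrix.mul_apply, Fin.sum_univ_four, smul_smul, ← add_smul, e1, e2, mul_comm]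

theorem star_refl4 (c s : ℝ) : star (refl4 A c s) = refl4 A c s := by
  ext i j
  fin_cases i <;> fin_cases j <;> simp [refl4, star_apply]

theorem refl4_comm (c s : ℝ) (g : A) :
    refl4 A c s * scalar (Fin 4) g = scalar (Fin 4) g * refl4 A c s := by
  ext i j
  fin_cases i <;> fin_cases j <;> simp [refl4, mul_diagonal, diagonal_mul]

theorem refl4_conj {J : A} {c s : ℝ} (h : c ^ 2 + s ^ 2 = 1) (a P₁ Q P₂ : A) :
    refl4 A c s * sum4 a (linBlock J c s P₁ Q P₂) * refl4 A c s =
      tri4 J a 0 (quad c s P₁ Q P₂) ((c * s) • P₁ + (s ^ 2 - c ^ 2) • Q - (c * s) • P₂)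
        (s ^ 2 • P₁ - (2 * (c * s)) • Q + c ^ 2 • P₂) := by
  have e : J = (c ^ 2 + s ^ 2) • J := by rw [h, one_smul]
  ext i j
  fin_cases i <;> fin_cases j <;>
    simp [refl4, sum4, linBlock, tri4, quad, Matrix.mul_apply, Fin.sum_univ_four] <;>
    first | module | (conv_rhs => rw [e]); module

theorem sum4_eq {J : A} {c s : ℝ} (h : c ^ 2 + s ^ 2 = 1) (a P₁ Q P₂ : A) :
    sum4 a (linBlock J c s P₁ Q P₂) = star (refl4 A c s) *
      tri4 J a 0 (quad c s P₁ Q P₂) ((c * s) • P₁ + (s ^ 2 - c ^ 2) • Q - (c * s) • P₂)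
        (s ^ 2 • P₁ - (2 * (c * s)) • Q + c ^ 2 • P₂) * refl4 A c s := by
  rw [star_refl4, ← refl4_conj h, ← mul_assoc, ← mul_assoc, refl4_mul_self h, one_mul, mul_assoc,
    refl4_mul_self h, mul_one]

/-- A `2 × 2` matrix with entries `a, b, b, d` is invertible. -/
theorem isUnit_tri4 {J a b d Q P : A} (hJ : IsUnit J)
    (hK : ∃ x y z w : A, a * x + b * z = 1 ∧ a * y + b * w = 0 ∧ b * x + d * z = 0 ∧
      b * y + d * w = 1 ∧ x * a + y * b = 1 ∧ x * b + y * d = 0 ∧ z * a + w * b = 0 ∧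
      z * b + w * d = 1) : IsUnit (tri4 J a b d Q P) := by
  obtain ⟨u, rfl⟩ := hJ
  obtain ⟨x, y, z, w, h1, h2, h3, h4, h5, h6, h7, h8⟩ := hK
  let v : A := ((u⁻¹ : Aˣ) : A)
  have hv : v * (u : A) = 1 := u.inv_mul
  have hv' : (u : A) * v = 1 := u.mul_inv
  refine ⟨⟨_, !![x, y, -(y * Q * v), 0; z, w, -(w * Q * v), 0;
    -(v * Q * z), -(v * Q * w), v * (Q * w * Q - P) * v, v; 0, 0, v, 0], ?_, ?_⟩, rfl⟩
  · have e1 : ∀ t, (u : A) * (v * t) = t := fun t => by rw [← mul_assoc, hv', one_mul]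
    ext i j
    fin_cases i <;> fin_cases j <;>
      simp [tri4, Matrix.mul_apply, Fin.sum_univ_four, h1, h2, h3, h4, hv', mul_assoc, e1]
    · rw [← mul_assoc, ← mul_assoc b w, ← neg_add, ← add_mul, h2]; simp
    · rw [← mul_assoc, ← mul_assoc d w, ← neg_add, ← add_mul, h4]; simp
    · noncomm_ring
  · have e1 : ∀ t, v * ((u : A) * t) = t := fun t => by rw [← mul_assoc, hv, one_mul]
    ext i j
    fin_cases i <;> fin_cases j <;>
      simp [tri4, Matrix.mul_apply, Fin.sum_univ_four, h5, h6, h7, h8, hv, mul_assoc, e1]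
    · rw [← neg_add, ← mul_add, ← mul_add, h7]; simp
    · rw [← neg_add, ← mul_add, ← mul_add, h8, mul_one, neg_add_cancel]
    · rw [mul_sub]; abel

theorem isUnit_tri4_rot {J F F₀ Q P : A} (hJ : IsUnit J) (hF : IsUnit F) (hF₀ : IsUnit F₀)
    {C S : ℝ} (h : C ^ 2 + S ^ 2 = 1) :
    IsUnit (tri4 J (C ^ 2 • F₀ + S ^ 2 • F) ((C * S) • (F₀ - F)) (S ^ 2 • F₀ + C ^ 2 • F) Q P) := by
  obtain ⟨u, rfl⟩ := hF
  obtain ⟨v, rfl⟩ := hF₀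
  refine isUnit_tri4 hJ ⟨C ^ 2 • v⁻¹.1 + S ^ 2 • u⁻¹.1, (C * S) • (v⁻¹.1 - u⁻¹.1),
    (C * S) • (v⁻¹.1 - u⁻¹.1), S ^ 2 • v⁻¹.1 + C ^ 2 • u⁻¹.1, ?_, ?_, ?_, ?_, ?_, ?_, ?_, ?_⟩ <;>
  simp only [add_mul, mul_add, smul_mul_assoc, mul_smul_comm, mul_sub, sub_mul, Units.mul_inv,
    Units.inv_mul] <;>
  match_scalars <;> first | ring1 | linear_combination (C ^ 2 + S ^ 2 + 1) * h

variable [TopologicalSpace A]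

theorem tri4_mem_skewAnti {S : Set A} {J a b d Q P : A} (hJ : J ∈ skewAnti S) (ha : a ∈ skewAnti S)
    (hb : b ∈ skewAnti S) (hd : d ∈ skewAnti S) (hQ : Q ∈ skewAnti S) (hP : P ∈ skewAnti S) :
    tri4 J a b d Q P ∈ skewAnti (scalar (Fin 4) '' S) := by
  rw [mem_skewAnti_scalar]
  refine ⟨fun i j => ?_, fun g hg i j => ?_⟩
  · fin_cases i <;> fin_cases j <;> simp [tri4, hJ.1, ha.1, hb.1, hd.1, hQ.1, hP.1]
  · fin_cases i <;> fin_cases j <;>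
      simp [tri4, hJ.2 g hg, ha.2 g hg, hb.2 g hg, hd.2 g hg, hQ.2 g hg, hP.2 g hg]

theorem quad_mem {S : Set A} {c s : ℝ} {P₁ Q P₂ : A} (h₁ : P₁ ∈ skewAnti S) (hQ : Q ∈ skewAnti S)
    (h₂ : P₂ ∈ skewAnti S) : quad c s P₁ Q P₂ ∈ skewAnti S :=
  add_mem (add_mem (Submodule.smul_mem _ _ h₁) (Submodule.smul_mem _ _ hQ))
    (Submodule.smul_mem _ _ h₂)

variable [IsTopologicalRing A] [ContinuousSMul ℝ A]

/-- A quadratic expression and its linearization can be exchanged. -/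
theorem swap_linBlock {Y : Type*} [TopologicalSpace Y] {Y₀ : Set Y} {S : Set A} {J : A}
    (hJ : IsCplx S J) {c s : Y → ℝ} (hc : Continuous c) (hs : Continuous s)
    (hcs : ∀ y, c y ^ 2 + s y ^ 2 = 1) {P₁ Q P₂ P₁' Q' P₂' : Y → A}
    (hP₁ : Continuous P₁) (hQ : Continuous Q) (hP₂ : Continuous P₂)
    (hP₁' : Continuous P₁') (hQ' : Continuous Q') (hP₂' : Continuous P₂')
    (mP₁ : ∀ y, P₁ y ∈ skewAnti S) (mQ : ∀ y, Q y ∈ skewAnti S) (mP₂ : ∀ y, P₂ y ∈ skewAnti S)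
    (mP₁' : ∀ y, P₁' y ∈ skewAnti S) (mQ' : ∀ y, Q' y ∈ skewAnti S)
    (mP₂' : ∀ y, P₂' y ∈ skewAnti S)
    (e₁ : ∀ y ∈ Y₀, P₁' y = P₁ y) (eQ : ∀ y ∈ Y₀, Q' y = Q y) (e₂ : ∀ y ∈ Y₀, P₂' y = P₂ y)
    (hu : ∀ y, IsUnit (quad (c y) (s y) (P₁ y) (Q y) (P₂ y)))
    (hu' : ∀ y, IsUnit (quad (c y) (s y) (P₁' y) (Q' y) (P₂' y))) :
    HtpyRel (USkew (scalar (Fin 4) '' S)) Y₀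
      (fun y => sum4 (quad (c y) (s y) (P₁' y) (Q' y) (P₂' y))
        (linBlock J (c y) (s y) (P₁ y) (Q y) (P₂ y)))
      (fun y => sum4 (quad (c y) (s y) (P₁ y) (Q y) (P₂ y))
        (linBlock J (c y) (s y) (P₁' y) (Q' y) (P₂' y))) := by
  have hJu : IsUnit J := ⟨⟨J, -J, by rw [mul_neg, hJ.2, neg_neg], by rw [neg_mul, hJ.2, neg_neg]⟩, rfl⟩
  set F : Y → A := fun y => quad (c y) (s y) (P₁ y) (Q y) (P₂ y) with hF
  set F' : Y → A := fun y => quad (c y) (s y) (P₁' y) (Q' y) (P₂' y) with hF'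
  have hFc : Continuous F := by unfold F quad; fun_prop
  have hFc' : Continuous F' := by unfold F' quad; fun_prop
  have mF : ∀ y, F y ∈ skewAnti S := fun y => quad_mem (mP₁ y) (mQ y) (mP₂ y)
  have mF' : ∀ y, F' y ∈ skewAnti S := fun y => quad_mem (mP₁' y) (mQ' y) (mP₂' y)
  set q : Y → A := fun y => (c y * s y) • P₁ y + (s y ^ 2 - c y ^ 2) • Q y - (c y * s y) • P₂ y with hq
  set q' : Y → A := fun y => (c y * s y) • P₁' y + (s y ^ 2 - c y ^ 2) • Q' y - (c y * s y) • P₂' y with hq'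
  set p : Y → A := fun y => s y ^ 2 • P₁ y - (2 * (c y * s y)) • Q y + c y ^ 2 • P₂ y with hp
  set p' : Y → A := fun y => s y ^ 2 • P₁' y - (2 * (c y * s y)) • Q' y + c y ^ 2 • P₂' y with hp'
  have hqc : Continuous q := by unfold q; fun_prop
  have hqc' : Continuous q' := by unfold q'; fun_prop
  have hpc : Continuous p := by unfold p; fun_prop
  have hpc' : Continuous p' := by unfold p'; fun_prop
  have mm : ∀ (r : ℝ) {x : A}, x ∈ skewAnti S → r • x ∈ skewAnti S :=
    fun r x hx => Submodule.smul_mem _ _ hx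
  have mq : ∀ y, q y ∈ skewAnti S := fun y =>
    sub_mem (add_mem (mm _ (mP₁ y)) (mm _ (mQ y))) (mm _ (mP₂ y))
  have mq' : ∀ y, q' y ∈ skewAnti S := fun y =>
    sub_mem (add_mem (mm _ (mP₁' y)) (mm _ (mQ' y))) (mm _ (mP₂' y))
  have mp : ∀ y, p y ∈ skewAnti S := fun y =>
    add_mem (sub_mem (mm _ (mP₁ y)) (mm _ (mQ y))) (mm _ (mP₂ y))
  have mp' : ∀ y, p' y ∈ skewAnti S := fun y =>
    add_mem (sub_mem (mm _ (mP₁' y)) (mm _ (mQ' y))) (mm _ (mP₂' y))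
  have eF : ∀ y ∈ Y₀, F' y = F y := fun y hy => by simp only [F, F', e₁ y hy, eQ y hy, e₂ y hy]
  have eq : ∀ y ∈ Y₀, q' y = q y := fun y hy => by simp only [q, q', e₁ y hy, eQ y hy, e₂ y hy]
  have ep : ∀ y ∈ Y₀, p' y = p y := fun y hy => by simp only [p, p', e₁ y hy, eQ y hy, e₂ y hy]
  have hRc : Continuous fun y => refl4 A (c y) (s y) := by
    refine continuous_matrix fun i j => ?_
    fin_cases i <;> fin_cases j <;> simp [refl4] <;> fun_prop
  have hRu : ∀ y, IsUnit (refl4 A (c y) (s y)) := fun y =>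
    ⟨⟨_, _, refl4_mul_self (hcs y), refl4_mul_self (hcs y)⟩, rfl⟩
  have hcomm : ∀ (y : Y), ∀ g ∈ scalar (Fin 4) '' S, refl4 A (c y) (s y) * g = g * refl4 A (c y) (s y) := by
    rintro y _ ⟨g, -, rfl⟩; exact refl4_comm _ _ _
  have key : ∀ {T : Y → Matrix (Fin 4) (Fin 4) A} {T' : Y → Matrix (Fin 4) (Fin 4) A},
      HtpyRel (USkew (scalar (Fin 4) '' S)) Y₀ T T' → HtpyRel (USkew (scalar (Fin 4) '' S)) Y₀
      (fun y => star (refl4 A (c y) (s y)) * T y * refl4 A (c y) (s y))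
      (fun y => star (refl4 A (c y) (s y)) * T' y * refl4 A (c y) (s y)) := fun H => by
    simp only [star_refl4]
    have hRc' : Continuous fun p : Y × Matrix (Fin 4) (Fin 4) A => refl4 A (c p.1) (s p.1) :=
      hRc.comp continuous_fst
    refine H.map (fun y x => refl4 A (c y) (s y) * x * refl4 A (c y) (s y)) ?_ fun y x hx => ?_
    · exact (hRc'.mul continuous_snd).mul hRc'
    · have := conj_mem_USkew (hcomm y) (by rw [star_refl4]; exact hcomm y) (hRu y) hx
      rwa [star_refl4] at this
  have st1 : HtpyRel (USkew (scalar (Fin 4) '' S)) Y₀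
      (fun y => tri4 J (F' y) 0 (F y) (q y) (p y))
      (fun y => tri4 J (F' y) 0 (F y) (q' y) (p' y)) := by
    refine HtpyRel.of_real 1 zero_le_one (fun τ y => tri4 J (F' y) 0 (F y)
      ((1 - τ) • q y + τ • q' y) ((1 - τ) • p y + τ • p' y)) ?_ ?_ ?_ ?_ ?_
    · refine continuous_matrix fun i j => ?_
      fin_cases i <;> fin_cases j <;> simp [tri4] <;> fun_prop
    · intro τ _ y
      refine ⟨tri4_mem_skewAnti hJ.1 (mF' y) (zero_mem _) (mF y)
        (add_mem (mm _ (mq y)) (mm _ (mq' y))) (add_mem (mm _ (mp y)) (mm _ (mp' y))), ?_⟩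
      simpa using isUnit_tri4_rot (Q := (1 - τ) • q y + τ • q' y)
        (P := (1 - τ) • p y + τ • p' y) hJu (hu y) (hu' y) (C := 1) (S := 0) (by norm_num)
    · intro y; simp
    · intro y; simp
    · intro τ _ y hy
      simp only [eq y hy, ep y hy, ← add_smul, sub_add_cancel, one_smul]
  have st2 : HtpyRel (USkew (scalar (Fin 4) '' S)) Y₀
      (fun y => tri4 J (F' y) 0 (F y) (q' y) (p' y))
      (fun y => tri4 J (F y) 0 (F' y) (q' y) (p' y)) := by
    refine HtpyRel.of_real (Real.pi / 2) (by positivity) (fun τ y =>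
      tri4 J (Real.cos τ ^ 2 • F' y + Real.sin τ ^ 2 • F y) ((Real.cos τ * Real.sin τ) • (F' y - F y))
      (Real.sin τ ^ 2 • F' y + Real.cos τ ^ 2 • F y) (q' y) (p' y)) ?_ ?_ ?_ ?_ ?_
    · refine continuous_matrix fun i j => ?_
      fin_cases i <;> fin_cases j <;> simp [tri4] <;> fun_prop
    · intro τ _ y
      exact ⟨tri4_mem_skewAnti hJ.1 (add_mem (mm _ (mF' y)) (mm _ (mF y)))
        (mm _ (sub_mem (mF' y) (mF y))) (add_mem (mm _ (mF' y)) (mm _ (mF y))) (mq' y) (mp' y),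
        isUnit_tri4_rot hJu (hu y) (hu' y) (Real.cos_sq_add_sin_sq τ)⟩
    · intro y; simp
    · intro y; simp
    · intro τ _ y hy
      simp only [eF y hy, ← add_smul, Real.cos_sq_add_sin_sq, Real.sin_sq_add_cos_sq, one_smul,
        sub_self, smul_zero]
  refine (key (st1.trans st2)).congr (fun y => ?_) fun y => ?_
  · exact sum4_eq (hcs y) _ _ _ _
  · exact sum4_eq (hcs y) _ _ _ _

end Swap

end Bott

open scoped Topology

namespace Bott

open unitInterval Set Matrix

section Blocks

variable {A : Type*} [Ring A] [StarRing A] [Algebra ℝ A] [StarModule ℝ A]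

theorem IsCplx.isUnit {S : Set A} {J : A} (hJ : IsCplx S J) : IsUnit J :=
  ⟨⟨J, -J, by rw [mul_neg, hJ.2, neg_neg], by rw [neg_mul, hJ.2, neg_neg]⟩, rfl⟩

theorem isUnit_of_isUnit_sum4 {a : A} {M : Matrix (Fin 3) (Fin 3) A} (h : IsUnit (sum4 a M)) :
    IsUnit M := by
  obtain ⟨⟨x, y, h1, h2⟩, rfl : x = _⟩ := h
  refine ⟨⟨M, y.submatrix Fin.succ Fin.succ, ?_, ?_⟩, rfl⟩
  · ext i j
    have := congrFun (congrFun h1 i.succ) j.succ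
    rw [Matrix.mul_apply, Fin.sum_univ_succ] at this
    rw [Matrix.mul_apply]
    convert! this using 1
    · fin_cases i <;> simp [sum4, Fin.sum_univ_three]
    · simp [Matrix.one_apply]
  · ext i j
    have := congrFun (congrFun h2 i.succ) j.succ
    rw [Matrix.mul_apply, Fin.sum_univ_succ] at this
    rw [Matrix.mul_apply]
    convert! this using 1
    · fin_cases j <;> simp [sum4, Fin.sum_univ_three]
    · simp [Matrix.one_apply]

theorem isUnit_linBlock {J P₁ Q P₂ : A} (hJ : IsUnit J) {c s : ℝ} (h : c ^ 2 + s ^ 2 = 1)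
    (hu : IsUnit (quad c s P₁ Q P₂)) : IsUnit (linBlock J c s P₁ Q P₂) := by
  refine isUnit_of_isUnit_sum4 (a := 1) ?_
  rw [sum4_eq h, star_refl4]
  have hR : IsUnit (refl4 A c s) := ⟨⟨_, _, refl4_mul_self h, refl4_mul_self h⟩, rfl⟩
  refine (hR.mul ?_).mul hR
  have := isUnit_tri4_rot (Q := (c * s) • P₁ + (s ^ 2 - c ^ 2) • Q - (c * s) • P₂)
    (P := s ^ 2 • P₁ - (2 * (c * s)) • Q + c ^ 2 • P₂) hJ hu (isUnit_one) (C := 1) (S := 0)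
    (by norm_num)
  simpa using this

/-- The rotation normalizing the base point of a linearization block. -/
noncomputable def rotU (w : A) : Matrix (Fin 3) (Fin 3) A :=
  !![1, 0, 0; 0, (√2 / 2) • 1, (√2 / 2) • w; 0, -((√2 / 2) • 1), (√2 / 2) • w]

/-- The linear part of a linearization block. -/
noncomputable def linPre (J B : A) : Matrix (Fin 3) (Fin 3) A :=
  !![B, J, (1 / 2 : ℝ) • J; J, 0, 0; (1 / 2 : ℝ) • J, 0, B]

/-- The base point of a linearization block. -/
def basePre (J : A) : Matrix (Fin 3) (Fin 3) A := !![J, 0, 0; 0, 0, -J; 0, -J, 0]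

/-- The correction part of a linearization block. -/
def degPre (D₁ D₂ D₃ : A) : Matrix (Fin 3) (Fin 3) A := !![D₁, 0, D₂; 0, 0, 0; D₂, 0, D₃]

theorem linBlock_eq (J B D₁ D₂ D₃ : A) (c s : ℝ) :
    linBlock J c s (c • J + s • B + D₁) (s • (1 / 2 : ℝ) • J + D₂) (s • B + D₃) =
      c • basePre J + s • linPre J B + degPre D₁ D₂ D₃ := by
  ext i j
  fin_cases i <;> fin_cases j <;> simp [linBlock, basePre, linPre, degPre]

theorem quad_eq (J B D₁ D₂ D₃ : A) {c s : ℝ} (h : c ^ 2 + s ^ 2 = 1) :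
    quad c s (c • J + s • B + D₁) (s • (1 / 2 : ℝ) • J + D₂) (s • B + D₃) =
      c • J + s • B + quad c s D₁ D₂ D₃ := by
  have : c • J + s • B = (c ^ 2 + s ^ 2) • (c • J + s • B) := by rw [h, one_smul]
  conv_rhs => rw [this]
  unfold quad
  module

theorem half_sq : (√2 / 2) * (√2 / 2) + (√2 / 2) * (√2 / 2) = (1 : ℝ) := by
  have := Real.mul_self_sqrt (show (0 : ℝ) ≤ 2 by norm_num)
  linarith

variable {w : A}

theorem rotU_comm {g : A} (hg : w * g = g * w) :
    rotU w * scalar (Fin 3) g = scalar (Fin 3) g * rotU w := by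
  ext i j
  fin_cases i <;> fin_cases j <;> simp [rotU, mul_diagonal, diagonal_mul, hg]

theorem star_rotU (hw : star w = -w) : star (rotU w) =
    !![1, 0, 0; 0, (√2 / 2) • 1, -((√2 / 2) • 1); 0, -((√2 / 2) • w), -((√2 / 2) • w)] := by
  ext i j
  fin_cases i <;> fin_cases j <;> simp [rotU, star_apply, hw]

theorem star_rotU_comm (hw : star w = -w) {g : A} (hg : w * g = g * w) :
    star (rotU w) * scalar (Fin 3) g = scalar (Fin 3) g * star (rotU w) := by
  rw [star_rotU hw]
  ext i j
  fin_cases i <;> fin_cases j <;> simp [mul_diagonal, diagonal_mul, hg]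

theorem star_rotU_mul (hw : star w = -w) (hww : w * w = -1) : star (rotU w) * rotU w = 1 := by
  rw [star_rotU hw]
  ext i j
  fin_cases i <;> fin_cases j <;>
    simp [rotU, Matrix.mul_apply, Fin.sum_univ_three, smul_smul, ← add_smul, hww, half_sq]

theorem rotU_mul_star (hw : star w = -w) (hww : w * w = -1) : rotU w * star (rotU w) = 1 := by
  rw [star_rotU hw]
  ext i j
  fin_cases i <;> fin_cases j <;>
    simp [rotU, Matrix.mul_apply, Fin.sum_univ_three, smul_smul, ← add_smul, hww, half_sq]

theorem isUnit_rotU (hw : star w = -w) (hww : w * w = -1) : IsUnit (rotU w) :=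
  ⟨⟨_, _, rotU_mul_star hw hww, star_rotU_mul hw hww⟩, rfl⟩

theorem rotU_basePre (hw : star w = -w) (hww : w * w = -1) {J : A} (hJ : w * J = -(J * w)) :
    star (rotU w) * basePre J * rotU w = scalar (Fin 3) J := by
  have e : w * J * w = J := by rw [hJ, neg_mul, mul_assoc, hww, mul_neg, neg_neg, mul_one]
  rw [star_rotU hw]
  ext i j
  fin_cases i <;> fin_cases j <;>
    simp [rotU, basePre, Matrix.mul_apply, Fin.sum_univ_three, smul_smul, ← add_smul, half_sq, e]

theorem rotU_diag (hw : star w = -w) (hww : w * w = -1) {j j₀ : A} (hj : w * j₀ = j₀ * w) :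
    star (rotU w) * !![j, 0, 0; 0, j₀, 0; 0, 0, j₀] * rotU w =
      !![j, 0, 0; 0, j₀, 0; 0, 0, j₀] := by
  have e' : j₀ * w * w = -j₀ := by rw [mul_assoc, hww, mul_neg, mul_one]
  rw [star_rotU hw]
  ext i j
  fin_cases i <;> fin_cases j <;>
    simp [rotU, Matrix.mul_apply, Fin.sum_univ_three, smul_smul, ← add_smul, half_sq, e', hj]

/-- The linear map on correction parts induced by linearization. -/
noncomputable def degConj (w D₁ D₂ D₃ : A) : Matrix (Fin 3) (Fin 3) A :=
  star (rotU w) * degPre D₁ D₂ D₃ * rotU w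

/-- The map on endpoints induced by linearization. -/
noncomputable def linConj (w J B : A) : Matrix (Fin 3) (Fin 3) A :=
  star (rotU w) * linPre J B * rotU w

theorem conj_linBlock (hw : star w = -w) (hww : w * w = -1) {J : A} (hJ : w * J = -(J * w)) (B D₁ D₂ D₃ : A) (c s : ℝ) :
    star (rotU w) *
      linBlock J c s (c • J + s • B + D₁) (s • (1 / 2 : ℝ) • J + D₂) (s • B + D₃) * rotU w =
      c • scalar (Fin 3) J + s • linConj w J B + degConj w D₁ D₂ D₃ := by
  rw [linBlock_eq, ← rotU_basePre hw hww hJ, linConj, degConj]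
  simp only [mul_add, add_mul, mul_smul_comm, smul_mul_assoc]

theorem sum4_conj (a : A) (M V W : Matrix (Fin 3) (Fin 3) A) :
    sum4 1 V * sum4 a M * sum4 1 W = sum4 a (V * M * W) := by
  ext i j
  fin_cases i <;> fin_cases j <;>
    simp [sum4, Matrix.mul_apply, Fin.sum_univ_four, Fin.sum_univ_three, add_assoc]

theorem star_sum4 (V : Matrix (Fin 3) (Fin 3) A) : star (sum4 1 V) = sum4 1 (star V) := by
  ext i j
  fin_cases i <;> fin_cases j <;> simp [sum4, star_apply]

theorem sum4_mul_one (V W : Matrix (Fin 3) (Fin 3) A) : sum4 1 V * sum4 1 W = sum4 1 (V * W) := by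
  ext i j
  fin_cases i <;> fin_cases j <;>
    simp [sum4, Matrix.mul_apply, Fin.sum_univ_four, Fin.sum_univ_three]

theorem sum4_one : sum4 (1 : A) 1 = 1 := by
  ext i j
  fin_cases i <;> fin_cases j <;> simp [sum4]

theorem sum4_one_comm {g : A} {V : Matrix (Fin 3) (Fin 3) A}
    (h : V * scalar (Fin 3) g = scalar (Fin 3) g * V) :
    sum4 1 V * scalar (Fin 4) g = scalar (Fin 4) g * sum4 1 V := by
  have e : ∀ i j, V i j * g = g * V i j := fun i j => by
    simpa [mul_diagonal, diagonal_mul] using congrFun (congrFun h i) j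
  ext i j
  fin_cases i <;> fin_cases j <;> simp [sum4, mul_diagonal, diagonal_mul, e]

variable [TopologicalSpace A]

theorem degPre_mem {S : Set A} {D₁ D₂ D₃ : A} (h₁ : D₁ ∈ skewAnti S) (h₂ : D₂ ∈ skewAnti S)
    (h₃ : D₃ ∈ skewAnti S) : degPre D₁ D₂ D₃ ∈ skewAnti (scalar (Fin 3) '' S) := by
  rw [mem_skewAnti_scalar]
  refine ⟨fun i j => ?_, fun g hg i j => ?_⟩
  · fin_cases i <;> fin_cases j <;> simp [degPre, h₁.1, h₂.1, h₃.1]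
  · fin_cases i <;> fin_cases j <;> simp [degPre, h₁.2 g hg, h₂.2 g hg, h₃.2 g hg]

theorem linPre_mem {S : Set A} {J B : A} (hJ : J ∈ skewAnti S) (hB : B ∈ skewAnti S) :
    linPre J B ∈ skewAnti (scalar (Fin 3) '' S) := by
  rw [mem_skewAnti_scalar]
  refine ⟨fun i j => ?_, fun g hg i j => ?_⟩
  · fin_cases i <;> fin_cases j <;> simp [linPre, hJ.1, hB.1]
  · fin_cases i <;> fin_cases j <;> simp [linPre, hJ.2 g hg, hB.2 g hg]

section Mem

variable {S : Set A}

theorem degConj_mem (hw : star w = -w) (hS : ∀ g ∈ S, w * g = g * w) {D₁ D₂ D₃ : A} (h₁ : D₁ ∈ skewAnti S) (h₂ : D₂ ∈ skewAnti S)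
    (h₃ : D₃ ∈ skewAnti S) : degConj w D₁ D₂ D₃ ∈ skewAnti (scalar (Fin 3) '' S) :=
  conj_mem_skewAnti (forall_mem_image.2 fun g hg => rotU_comm (hS g hg))
    (forall_mem_image.2 fun g hg => star_rotU_comm hw (hS g hg)) (degPre_mem h₁ h₂ h₃)

theorem linConj_mem (hw : star w = -w) (hS : ∀ g ∈ S, w * g = g * w) {J B : A} (hJ : J ∈ skewAnti S) (hB : B ∈ skewAnti S) :
    linConj w J B ∈ skewAnti (scalar (Fin 3) '' S) :=
  conj_mem_skewAnti (forall_mem_image.2 fun g hg => rotU_comm (hS g hg))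
    (forall_mem_image.2 fun g hg => star_rotU_comm hw (hS g hg)) (linPre_mem hJ hB)

theorem isUnit_conj_linBlock (hw : star w = -w) (hww : w * w = -1) {J : A} (hJ : IsCplx S J) (hwJ : w * J = -(J * w)) {c s : ℝ}
    (h : c ^ 2 + s ^ 2 = 1) {B D₁ D₂ D₃ : A}
    (hu : IsUnit (c • J + s • B + quad c s D₁ D₂ D₃)) :
    IsUnit (c • scalar (Fin 3) J + s • linConj w J B + degConj w D₁ D₂ D₃) := by
  rw [← conj_linBlock hw hww hwJ]
  refine ((isUnit_rotU hw hww).star.mul (isUnit_linBlock hJ.isUnit h ?_)).mul (isUnit_rotU hw hww)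
  rwa [quad_eq _ _ _ _ _ h]

theorem linConj_mem_Lin (hw : star w = -w) (hww : w * w = -1) (hS : ∀ g ∈ S, w * g = g * w) {J B : A} (hJ : IsCplx S J) (hwJ : w * J = -(J * w)) (hB : B ∈ Lin S J) :
    linConj w J B ∈ Lin (scalar (Fin 3) '' S) (scalar (Fin 3) J) := by
  refine ⟨linConj_mem hw hS hJ.1 hB.1, fun c s h => ?_⟩
  have e : degConj w 0 0 0 = (0 : Matrix (Fin 3) (Fin 3) A) := by
    have : degPre (0 : A) 0 0 = 0 := by
      ext i j
      fin_cases i <;> fin_cases j <;> rfl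
    rw [degConj, this, mul_zero, zero_mul]
  have := isUnit_conj_linBlock hw hww hJ hwJ h (B := B) (D₁ := 0) (D₂ := 0) (D₃ := 0)
    (by simpa [quad] using hB.2 c s h)
  rwa [e, add_zero] at this

end Mem

variable [IsTopologicalRing A] [ContinuousSMul ℝ A]

theorem continuous_linConj (w J : A) : Continuous (linConj w J) := by
  have : Continuous (linPre J : A → _) := by
    refine continuous_matrix fun i j => ?_
    fin_cases i <;> fin_cases j <;> simp [linPre] <;> fun_prop
  exact (continuous_const.mul this).mul continuous_const

/-- `degConj` is the sum of three linear maps. -/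
theorem exists_degConj_clm (w : A) : ∃ f₁ f₂ f₃ : A →L[ℝ] Matrix (Fin 3) (Fin 3) A,
    ∀ D₁ D₂ D₃, degConj w D₁ D₂ D₃ = f₁ D₁ + f₂ D₂ + f₃ D₃ := by
  have key : ∀ E : Matrix (Fin 3) (Fin 3) ℝ, ∃ f : A →L[ℝ] Matrix (Fin 3) (Fin 3) A,
      ∀ D, f D = star (rotU w) * (E.map fun r => r • D) * rotU w := fun E => by
    refine ⟨⟨⟨⟨fun D => star (rotU w) * (E.map fun r => r • D) * rotU w, fun x y => ?_⟩,
      fun r x => ?_⟩, ?_⟩, fun _ => rfl⟩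
    · rw [← add_mul, ← mul_add]
      congr 2
      ext i j
      simp
    · have : (E.map fun t => t • r • x) = r • (E.map fun t => t • x) := by
        ext i j
        exact smul_comm _ _ _
      simp only [this, mul_smul_comm, smul_mul_assoc, RingHom.id_apply]
    · have : Continuous fun D : A => E.map fun t => t • D :=
        continuous_matrix fun i j => continuous_id.const_smul (E i j)
      exact (continuous_const.mul this).mul continuous_const
  obtain ⟨f₁, h₁⟩ := key !![1, 0, 0; 0, 0, 0; 0, 0, 0]
  obtain ⟨f₂, h₂⟩ := key !![0, 0, 1; 0, 0, 0; 1, 0, 0]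
  obtain ⟨f₃, h₃⟩ := key !![0, 0, 0; 0, 0, 0; 0, 0, 1]
  refine ⟨f₁, f₂, f₃, fun D₁ D₂ D₃ => ?_⟩
  rw [h₁, h₂, h₃, ← add_mul, ← add_mul, ← mul_add, ← mul_add, degConj]
  congr 2
  ext i j
  fin_cases i <;> fin_cases j <;> simp [degPre]

end Blocks

end Bott

open scoped Topology

namespace Bott

open unitInterval Set Matrix

section SkewUnit

variable {m : Type*} [Fintype m] [DecidableEq m]

theorem dotProduct_mulVec_skew {y : Matrix m m ℝ} (hy : yᵀ = -y) (v w : m → ℝ) :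
    (y *ᵥ v) ⬝ᵥ w = -(v ⬝ᵥ (y *ᵥ w)) := by
  rw [dotProduct_mulVec, ← mulVec_transpose, hy, neg_mulVec, neg_dotProduct, neg_neg]

theorem isUnit_skew_comb {y : Matrix m m ℝ} (hy : yᵀ = -y) (hu : IsUnit y) {c s a₀ a₁ b₀ b₁ : ℝ}
    (ha₀ : 0 ≤ a₀) (ha₁ : 0 ≤ a₁) (hb₀ : 0 ≤ b₀) (hb₁ : 0 ≤ b₁)
    (h : c ≠ 0 ∧ 0 < a₀ + a₁ ∨ s ≠ 0 ∧ 0 < b₀ + b₁) :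
    IsUnit (c • (a₀ • 1 + a₁ • (-(y * y))) + s • ((b₀ • 1 + b₁ • (-(y * y))) * y)) := by
  have hinj : ∀ v, y *ᵥ v = 0 → v = 0 := fun v hv => by
    have := (mulVec_injective_iff_isUnit.2 hu)
    exact this (by rw [hv, mulVec_zero])
  have hpos : ∀ v : m → ℝ, v ⬝ᵥ v = 0 → v = 0 := fun v hv => dotProduct_self_eq_zero.1 hv
  have hnn : ∀ v : m → ℝ, 0 ≤ v ⬝ᵥ v := fun v => by
    simpa using dotProduct_star_self_nonneg v
  let q : ℝ → ℝ → (m → ℝ) → (m → ℝ) := fun a b v => a • v - b • (y *ᵥ (y *ᵥ v))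
  have hq : ∀ {a b : ℝ}, 0 ≤ a → 0 ≤ b → 0 < a + b → ∀ v, q a b v = 0 → v = 0 := by
    intro a b ha hb hab v hv
    have e : v ⬝ᵥ q a b v = a * (v ⬝ᵥ v) + b * ((y *ᵥ v) ⬝ᵥ (y *ᵥ v)) := by
      rw [dotProduct_mulVec_skew hy]
      simp only [q, dotProduct_sub, dotProduct_smul, smul_eq_mul]
      ring
    rw [hv, dotProduct_zero] at e
    by_cases ha' : a = 0
    · subst ha'
      have : (y *ᵥ v) ⬝ᵥ (y *ᵥ v) = 0 := by
        rcases mul_eq_zero.1 (show b * ((y *ᵥ v) ⬝ᵥ (y *ᵥ v)) = 0 by linarith) with h | h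
        · linarith
        · exact h
      exact hinj _ (hpos _ this)
    · have ha'' := lt_of_le_of_ne ha (Ne.symm ha')
      have : v ⬝ᵥ v = 0 := by nlinarith [hnn v, hnn (y *ᵥ v), mul_nonneg hb (hnn (y *ᵥ v))]
      exact hpos _ this
  have hqy : ∀ a b v, q a b (y *ᵥ v) = y *ᵥ (q a b v) := fun a b v => by
    simp only [q, mulVec_sub, mulVec_smul]
  have hqs : ∀ a b v w, q a b v ⬝ᵥ w = v ⬝ᵥ q a b w := fun a b v w => by
    simp only [q, sub_dotProduct, smul_dotProduct, dotProduct_sub, dotProduct_smul,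
      dotProduct_mulVec_skew hy, neg_neg]
  have hqq : ∀ a b a' b' v, q a b (q a' b' v) = q a' b' (q a b v) := fun a b a' b' v => by
    simp only [q, mulVec_sub, mulVec_smul]
    module
  refine isUnit_of_mulVec fun v hv => ?_
  have e1 : c • q a₀ a₁ v + s • (y *ᵥ q b₀ b₁ v) = 0 := by
    rw [← hv]
    simp only [q, add_mulVec, smul_mulVec, ← mulVec_mulVec, one_mulVec, neg_mulVec, mulVec_add,
      mulVec_sub, mulVec_smul, smul_neg, mulVec_neg, sub_eq_add_neg]
  have e2 : q a₀ a₁ v ⬝ᵥ (y *ᵥ q b₀ b₁ v) = 0 := by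
    have h1 : q a₀ a₁ v ⬝ᵥ (y *ᵥ q b₀ b₁ v) = q b₀ b₁ v ⬝ᵥ (y *ᵥ q a₀ a₁ v) := by
      rw [hqs, ← hqy, ← hqy, hqq, ← hqs]
    have h2 := dotProduct_mulVec_skew hy (q b₀ b₁ v) (q a₀ a₁ v)
    rw [dotProduct_comm] at h2
    linarith
  have e3 : c * (q a₀ a₁ v ⬝ᵥ q a₀ a₁ v) = 0 := by
    have := congrArg (fun z => q a₀ a₁ v ⬝ᵥ z) e1
    simpa only [dotProduct_add, dotProduct_smul, e2, smul_eq_mul, mul_zero, add_zero,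
      dotProduct_zero] using this
  have e4 : s * ((y *ᵥ q b₀ b₁ v) ⬝ᵥ (y *ᵥ q b₀ b₁ v)) = 0 := by
    have := congrArg (fun z => (y *ᵥ q b₀ b₁ v) ⬝ᵥ z) e1
    rw [dotProduct_comm] at e2
    simpa only [dotProduct_add, dotProduct_smul, e2, smul_eq_mul, mul_zero, zero_add,
      dotProduct_zero] using this
  rcases h with ⟨hc, hp⟩ | ⟨hs, hp⟩
  · exact hq ha₀ ha₁ hp v (hpos _ ((mul_eq_zero.1 e3).resolve_left hc))
  · exact hq hb₀ hb₁ hp v (hinj _ (hpos _ ((mul_eq_zero.1 e4).resolve_left hs)))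

end SkewUnit

section Path

variable {ι κ : Type*} [Fintype ι] [DecidableEq ι] [Fintype κ] [DecidableEq κ]

theorem Mat.isUnit_skew_comb {y : Mat ι κ} (hy : star y = -y) (hu : IsUnit y)
    {c s a₀ a₁ b₀ b₁ : ℝ} (ha₀ : 0 ≤ a₀) (ha₁ : 0 ≤ a₁) (hb₀ : 0 ≤ b₀) (hb₁ : 0 ≤ b₁)
    (h : c ≠ 0 ∧ 0 < a₀ + a₁ ∨ s ≠ 0 ∧ 0 < b₀ + b₁) :
    IsUnit (c • (a₀ • 1 + a₁ • (-(y * y))) + s • ((b₀ • 1 + b₁ • (-(y * y))) * y)) := by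
  have hφ := isStarHomeo_comp (m := κ) (n := ι) (A := ℝ)
  set φ := (compAlgEquiv κ ι ℝ ℝ : Mat ι κ ≃ₐ[ℝ] _)
  have := Bott.isUnit_skew_comb (y := φ y) (by rw [← star_eq_transpose, ← hφ.map_star, hy, map_neg])
    ((MulEquiv.isUnit_map φ).2 hu) (c := c) (s := s) ha₀ ha₁ hb₀ hb₁ h
  rw [← MulEquiv.isUnit_map φ]
  simpa only [map_add, map_smul, map_mul, map_neg, map_one] using this

open Polynomial in
theorem isUnit_map_aeval {A : Type*} [Ring A] [Algebra ℝ A] {n : Type*} [Fintype n] [DecidableEq n]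
    (y : A) (E : Matrix n n ℝ[X]) (h : IsUnit (aeval y E.det)) : IsUnit (E.map (aeval y)) := by
  have h1 := congrArg (fun M : Matrix n n ℝ[X] => M.map (aeval y)) (mul_adjugate E)
  have h2 := congrArg (fun M : Matrix n n ℝ[X] => M.map (aeval y)) (adjugate_mul E)
  have e : (E.det • (1 : Matrix n n ℝ[X])).map (aeval y) = scalar n (aeval y E.det) := by
    ext i j
    by_cases hij : i = j
    · subst hij; simp
    · simp [hij]
  simp only [Matrix.map_mul, e] at h1 h2
  obtain ⟨u, hu⟩ := h.map (scalar n)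
  refine isUnit_iff_exists_and_exists.2 ⟨⟨E.adjugate.map (aeval y) * u⁻¹.1, ?_⟩,
    ⟨u⁻¹.1 * E.adjugate.map (aeval y), ?_⟩⟩
  · rw [← mul_assoc, h1, ← hu, Units.mul_inv]
  · rw [mul_assoc, h2, ← hu, Units.inv_mul]

/-- The family of linear parts used to contract a linearization block. -/
def pathPre {A : Type*} [Ring A] [Algebra ℝ A] (J j : A) (κ κ' b τ μ : ℝ) :
    Matrix (Fin 3) (Fin 3) A :=
  !![j, τ • J, μ • J; τ • J, κ • j + b • J, 0; μ • J, 0, κ' • j - b • J]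

theorem pathPre_mem {A : Type*} [Ring A] [StarRing A] [Algebra ℝ A] [StarModule ℝ A]
    [TopologicalSpace A] {S : Set A} {J j : A} (hJ : J ∈ skewAnti S)
    (hj : j ∈ skewAnti S) (κ κ' b τ μ : ℝ) :
    pathPre J j κ κ' b τ μ ∈ skewAnti (scalar (Fin 3) '' S) := by
  have h1 := (skewAnti S).smul_mem τ hJ
  have h2 := (skewAnti S).smul_mem μ hJ
  have h3 := add_mem ((skewAnti S).smul_mem κ hj) ((skewAnti S).smul_mem b hJ)
  have h4 := sub_mem ((skewAnti S).smul_mem κ' hj) ((skewAnti S).smul_mem b hJ)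
  rw [mem_skewAnti_scalar]
  refine ⟨fun i k => ?_, fun g hg i k => ?_⟩
  · fin_cases i <;> fin_cases k <;>
      simp only [pathPre, hj.1, h1.1, h2.1, h3.1, h4.1, of_apply, cons_val, Fin.zero_eta, Fin.mk_one,
        Fin.reduceFinMk, star_zero, neg_zero]
  · fin_cases i <;> fin_cases k <;>
      simp only [pathPre, hj.2 g hg, h1.2 g hg, h2.2 g hg, h3.2 g hg, h4.2 g hg, of_apply, cons_val,
        Fin.zero_eta, Fin.mk_one, Fin.reduceFinMk, zero_mul, mul_zero, neg_zero]

open Polynomial in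
/-- The matrix of polynomials behind `pathPre`. -/
noncomputable def pathPoly (c s p p' b τ μ : ℝ) : Matrix (Fin 3) (Fin 3) ℝ[X] :=
  !![C c + C s * X, C (s * τ), C (s * μ); C (s * τ), C (s * p) * X + C (s * b), -C c;
      C (s * μ), -C c, C (s * p') * X - C (s * b)]

open Polynomial in
theorem pathPre_eq {A : Type*} [Ring A] [Algebra ℝ A] (J y : A) (c s p p' b τ μ : ℝ) :
    c • basePre J + s • pathPre J (J * y) p p' b τ μ =
      scalar (Fin 3) J * (pathPoly c s p p' b τ μ).map (aeval y) := by
  ext i k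
  fin_cases i <;> fin_cases k <;>
    simp [pathPoly, basePre, pathPre, diagonal_mul, Algebra.algebraMap_eq_smul_one, mul_add,
      mul_sub, smul_smul, smul_add, smul_sub] <;> module

open Polynomial in
theorem det_pathPoly {c s p p' b τ μ a₀ a₁ b₀ b₁ : ℝ}
    (e₀ : c * (s * b * (s * b) + c ^ 2) + s * τ * (c * (s * μ) - s * τ * (s * b)) +
      s * μ * (c * (s * τ) + s * μ * (s * b)) = c * a₀)
    (e₁ : s * (s * b * (s * b) + c ^ 2) - c * (s * b * (s * p') - s * p * (s * b)) +
      s * τ * (s * τ * (s * p')) + s * μ * (s * μ * (s * p)) = s * b₀)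
    (e₂ : c * (s * p * (s * p')) + s * (s * b * (s * p') - s * p * (s * b)) = c * a₁)
    (e₃ : s * (s * p * (s * p')) = s * b₁) :
    (pathPoly c s p p' b τ μ).det =
      -(C c * (C a₀ + C a₁ * (-(X * X))) + C s * ((C b₀ + C b₁ * (-(X * X))) * X)) := by
  have e₀' := congrArg C e₀
  have e₁' := congrArg C e₁
  have e₂' := congrArg C e₂
  have e₃' := congrArg C e₃
  simp only [C_mul, C_add, C_sub, C_pow] at e₀' e₁' e₂' e₃'
  rw [det_fin_three]
  simp only [pathPoly, of_apply, cons_val, C_mul]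
  linear_combination (-e₀') - X * e₁' + X ^ 2 * e₂' + X ^ 3 * e₃'

open Polynomial in
theorem isUnit_pathPre {S : Set (Mat ι κ)} {J j : Mat ι κ} (hJ : IsCplx S J) (hj : j ∈ skewAnti S)
    (hjJ : j * J = -(J * j)) (hju : IsUnit j) {c s p p' b τ μ a₀ a₁ b₀ b₁ : ℝ}
    (ha₀ : 0 ≤ a₀) (ha₁ : 0 ≤ a₁) (hb₀ : 0 ≤ b₀) (hb₁ : 0 ≤ b₁)
    (h : c ≠ 0 ∧ 0 < a₀ + a₁ ∨ s ≠ 0 ∧ 0 < b₀ + b₁)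
    (e₀ : c * (s * b * (s * b) + c ^ 2) + s * τ * (c * (s * μ) - s * τ * (s * b)) +
      s * μ * (c * (s * τ) + s * μ * (s * b)) = c * a₀)
    (e₁ : s * (s * b * (s * b) + c ^ 2) - c * (s * b * (s * p') - s * p * (s * b)) +
      s * τ * (s * τ * (s * p')) + s * μ * (s * μ * (s * p)) = s * b₀)
    (e₂ : c * (s * p * (s * p')) + s * (s * b * (s * p') - s * p * (s * b)) = c * a₁)
    (e₃ : s * (s * p * (s * p')) = s * b₁) :
    IsUnit (c • basePre J + s • pathPre J j p p' b τ μ) := by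
  have hy : star (-(J * j)) = -(-(J * j)) := by rw [star_neg, star_mul, hj.1, hJ.1.1]; simp [hjJ]
  have hu : IsUnit (-(J * j)) := (hJ.isUnit.mul hju).neg
  have hJy : J * -(J * j) = j := by rw [mul_neg, ← mul_assoc, hJ.2]; simp
  generalize -(J * j) = y at *
  rw [← hJy, pathPre_eq]
  refine (hJ.isUnit.map (scalar (Fin 3))).mul (isUnit_map_aeval _ _ ?_)
  rw [det_pathPoly e₀ e₁ e₂ e₃]
  simpa [Algebra.algebraMap_eq_smul_one, -neg_add_rev] using
    (Mat.isUnit_skew_comb hy hu (c := c) (s := s) ha₀ ha₁ hb₀ hb₁ h).neg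

theorem isUnit_diag_block {A : Type*} [Ring A] {x x' p q q' r : A} (hx : IsUnit x)
    (hx' : IsUnit x') (h : IsUnit !![x', 0, 0; 0, p, q; 0, q', r]) :
    IsUnit !![x, 0, 0; 0, p, q; 0, q', r] := by
  obtain ⟨u, rfl⟩ := hx
  obtain ⟨v, rfl⟩ := hx'
  have e : !![u.1, 0, 0; 0, p, q; 0, q', r] =
      diagonal ![u.1 * v⁻¹.1, 1, 1] * !![v.1, 0, 0; 0, p, q; 0, q', r] := by
    ext i j
    fin_cases i <;> fin_cases j <;> simp [diagonal_mul]
  rw [e]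
  refine IsUnit.mul ⟨⟨diagonal ![u.1 * v⁻¹.1, 1, 1], diagonal ![v.1 * u⁻¹.1, 1, 1], ?_, ?_⟩, rfl⟩ h
  · rw [diagonal_mul_diagonal, ← diagonal_one]
    congr 1
    ext i
    fin_cases i <;> simp [mul_assoc]
  · rw [diagonal_mul_diagonal, ← diagonal_one]
    congr 1
    ext i
    fin_cases i <;> simp [mul_assoc]

theorem continuous_pathPre {A X : Type*} [Ring A] [Algebra ℝ A] [TopologicalSpace A]
    [IsTopologicalRing A] [ContinuousSMul ℝ A] [TopologicalSpace X] {J : A} {j : X → A}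
    {κ κ' b τ μ : X → ℝ} (hj : Continuous j) (h1 : Continuous κ) (h2 : Continuous κ')
    (h3 : Continuous b) (h4 : Continuous τ) (h5 : Continuous μ) :
    Continuous fun x => pathPre J (j x) (κ x) (κ' x) (b x) (τ x) (μ x) := by
  refine continuous_matrix fun i k => ?_
  fin_cases i <;> fin_cases k <;> simp [pathPre] <;> fun_prop

/-- The diagonal part at the end of the contraction. -/
def pathEnd {A : Type*} [Ring A] [Algebra ℝ A] (J j j₀ : A) (a b : ℝ) : Matrix (Fin 3) (Fin 3) A :=
  !![j, 0, 0; 0, a • j₀ + b • J, 0; 0, 0, a • j₀ - b • J]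

theorem continuous_pathEnd {A X : Type*} [Ring A] [Algebra ℝ A] [TopologicalSpace A]
    [IsTopologicalRing A] [ContinuousSMul ℝ A] [TopologicalSpace X] {J j₀ : A} {j : X → A}
    {a b : X → ℝ} (hj : Continuous j) (h1 : Continuous a) (h2 : Continuous b) :
    Continuous fun x => pathEnd J (j x) j₀ (a x) (b x) := by
  refine continuous_matrix fun i k => ?_
  fin_cases i <;> fin_cases k <;> simp [pathEnd] <;> fun_prop

theorem pathEnd_mem {A : Type*} [Ring A] [StarRing A] [Algebra ℝ A] [StarModule ℝ A]
    [TopologicalSpace A] {S : Set A} {J j j₀ : A} (hJ : J ∈ skewAnti S) (hj : j ∈ skewAnti S)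
    (hj₀ : j₀ ∈ skewAnti S) (a b : ℝ) :
    pathEnd J j j₀ a b ∈ skewAnti (scalar (Fin 3) '' S) := by
  have h3 := add_mem ((skewAnti S).smul_mem a hj₀) ((skewAnti S).smul_mem b hJ)
  have h4 := sub_mem ((skewAnti S).smul_mem a hj₀) ((skewAnti S).smul_mem b hJ)
  rw [mem_skewAnti_scalar]
  refine ⟨fun i k => ?_, fun g hg i k => ?_⟩
  · fin_cases i <;> fin_cases k <;>
      simp only [pathEnd, hj.1, h3.1, h4.1, of_apply, cons_val, Fin.zero_eta, Fin.mk_one,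
        Fin.reduceFinMk, star_zero, neg_zero]
  · fin_cases i <;> fin_cases k <;>
      simp only [pathEnd, hj.2 g hg, h3.2 g hg, h4.2 g hg, of_apply, cons_val,
        Fin.zero_eta, Fin.mk_one, Fin.reduceFinMk, zero_mul, mul_zero, neg_zero]

theorem pathPre_eq_pathEnd {A : Type*} [Ring A] [Algebra ℝ A] (J j : A) (a b : ℝ) :
    pathPre J j a a b 0 0 = pathEnd J j j a b := by
  simp [pathPre, pathEnd]

theorem smul_basePre_add_pathEnd {A : Type*} [Ring A] [Algebra ℝ A] (J j j₀ : A) (a b c s : ℝ) :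
    c • basePre J + s • pathEnd J j j₀ a b = !![c • J + s • j, 0, 0;
      0, s • (a • j₀ + b • J), -(c • J); 0, -(c • J), s • (a • j₀ - b • J)] := by
  ext i k
  fin_cases i <;> fin_cases k <;> simp [basePre, pathEnd]

/-- A linear part anticommuting with the base complex structure is stably trivial after
linearization. -/
theorem htpyRel_linConj {X : Type*} [TopologicalSpace X] {S : Set (Mat ι κ)} {J w j₀ : Mat ι κ}
    (hJ : IsCplx S J) (hw : star w = -w) (hww : w * w = -1) (hwJ : w * J = -(J * w))
    (hwS : ∀ g ∈ S, w * g = g * w) (hwj : w * j₀ = j₀ * w) (hj₀ : j₀ ∈ skewAnti S)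
    (hj₀J : j₀ * J = -(J * j₀)) (hj₀u : IsUnit j₀) {j : X → Mat ι κ} (hjc : Continuous j)
    (hj : ∀ x, j x ∈ skewAnti S) (hjJ : ∀ x, j x * J = -(J * j x)) (hju : ∀ x, IsUnit (j x)) :
    HtpyRel (Lin (scalar (Fin 3) '' S) (scalar (Fin 3) J)) ∅ (fun x => linConj w J (j x))
      (fun x => !![j x, 0, 0; 0, j₀, 0; 0, 0, j₀]) := by
  have key : HtpyRel (Lin (scalar (Fin 3) '' S) (basePre J)) ∅ (fun x => linPre J (j x))
      (fun x => pathEnd J (j x) j₀ 1 0) := by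
    have s0 : HtpyRel (Lin (scalar (Fin 3) '' S) (basePre J)) ∅
        (fun x => pathPre J (j x) 0 1 0 1 (1 / 2)) (fun x => pathPre J (j x) 0 1 0 1 0) := by
      refine HtpyRel.of_real 1 zero_le_one
        (fun τ x => pathPre J (j x) 0 1 0 1 ((1 - τ) / 2)) ?_ ?_ ?_ ?_ ?_
      · exact continuous_pathPre (hjc.comp continuous_snd) (by fun_prop) (by fun_prop)
          (by fun_prop) (by fun_prop) (by fun_prop)
      · intro τ hτ x
        refine ⟨pathPre_mem hJ.1 (hj x) _ _ _ _ _, fun c s h => ?_⟩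
        have h1 : 0 ≤ 1 - τ := by linarith [hτ.2]
        refine isUnit_pathPre hJ (hj x) (hjJ x) (hju x) (a₀ := c ^ 2 + s ^ 2 * (1 - τ)) (a₁ := 0)
          (b₀ := c ^ 2 + s ^ 2) (b₁ := 0) (by positivity) le_rfl (by positivity) le_rfl ?_
          (by ring) (by ring) (by ring) (by ring)
        by_cases hc : c = 0
        · right; subst hc
          exact ⟨by rintro rfl; norm_num at h, by linarith⟩
        · left; exact ⟨hc, by have := pow_pos (abs_pos.2 hc) 2; rw [sq_abs] at this; positivity⟩
      · intro x; norm_num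
      · intro x; norm_num
      · simp
    have s1 : HtpyRel (Lin (scalar (Fin 3) '' S) (basePre J)) ∅
        (fun x => pathPre J (j x) 0 1 0 1 0) (fun x => pathPre J (j x) 1 1 0 0 0) := by
      refine HtpyRel.of_real 1 zero_le_one
        (fun τ x => pathPre J (j x) τ 1 0 (1 - τ) 0) ?_ ?_ ?_ ?_ ?_
      · exact continuous_pathPre (hjc.comp continuous_snd) (by fun_prop) (by fun_prop)
          (by fun_prop) (by fun_prop) (by fun_prop)
      · intro τ hτ x
        refine ⟨pathPre_mem hJ.1 (hj x) _ _ _ _ _, fun c s h => ?_⟩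
        have h1 : 0 ≤ τ := hτ.1
        refine isUnit_pathPre hJ (hj x) (hjJ x) (hju x) (a₀ := c ^ 2) (a₁ := τ * s ^ 2)
          (b₀ := c ^ 2 + s ^ 2 * (1 - τ) ^ 2) (b₁ := τ * s ^ 2) (by positivity) (by positivity)
          (by positivity) (by positivity) ?_ (by ring) (by ring) (by ring) (by ring)
        by_cases hc : c = 0
        · right; subst hc
          have hs : s ^ 2 = 1 := by linarith
          refine ⟨by rintro rfl; norm_num at h, ?_⟩
          rw [hs]; nlinarith [sq_nonneg τ]
        · left; exact ⟨hc, by have := pow_pos (abs_pos.2 hc) 2; rw [sq_abs] at this; positivity⟩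
      · intro x; norm_num
      · intro x; norm_num
      · simp
    have hb : ∀ (c s τ : ℝ), c ^ 2 + s ^ 2 = 1 → 0 < s ^ 2 * τ ^ 2 + c ^ 2 + s ^ 2 * (1 - τ) ^ 2 := by
      intro c s τ h
      have h1 : 0 < τ ^ 2 + (1 - τ) ^ 2 := by nlinarith [sq_nonneg (2 * τ - 1)]
      rcases eq_or_lt_of_le (sq_nonneg s) with hs | hs
      · rw [← hs]; linarith
      · nlinarith [mul_pos hs h1, sq_nonneg c]
    have huu : ∀ {k : Mat ι κ}, k ∈ skewAnti S → k * J = -(J * k) → IsUnit k → ∀ (τ c s : ℝ),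
        c ^ 2 + s ^ 2 = 1 → IsUnit (c • basePre J + s • pathEnd J k k (1 - τ) τ) := by
      intro k hk hkJ hku τ c s h
      rw [← pathPre_eq_pathEnd]
      refine isUnit_pathPre hJ hk hkJ hku (a₀ := s ^ 2 * τ ^ 2 + c ^ 2)
        (a₁ := s ^ 2 * (1 - τ) ^ 2) (b₀ := s ^ 2 * τ ^ 2 + c ^ 2)
        (b₁ := s ^ 2 * (1 - τ) ^ 2) (by positivity) (by positivity)
        (by positivity) (by positivity) ?_ (by ring) (by ring) (by ring) (by ring)
      by_cases hc : c = 0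
      · right; exact ⟨by rintro rfl; subst hc; norm_num at h, hb c s τ h⟩
      · left; exact ⟨hc, hb c s τ h⟩
    have hlu : ∀ {k : Mat ι κ}, k ∈ skewAnti S → k * J = -(J * k) → IsUnit k → ∀ (c s : ℝ),
        c ^ 2 + s ^ 2 = 1 → IsUnit (c • J + s • k) := by
      intro k hk hkJ hku c s h
      have hkk : (-(J * k)) * (-(J * k)) = k * k := by
        rw [neg_mul_neg, mul_assoc, ← mul_assoc k, hkJ, neg_mul, mul_neg, ← mul_assoc, ← mul_assoc,
          hJ.2]; simp
      have hy : star (-(J * k)) = -(-(J * k)) := by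
        rw [star_neg, star_mul, hk.1, hJ.1.1]; simp [hkJ]
      have := Mat.isUnit_skew_comb hy (hJ.isUnit.mul hku).neg (c := c) (s := s) (a₀ := 1) (a₁ := 0)
        (b₀ := 1) (b₁ := 0) zero_le_one le_rfl zero_le_one le_rfl
        (by by_cases hc : c = 0
            · right; exact ⟨by rintro rfl; subst hc; norm_num at h, by norm_num⟩
            · left; exact ⟨hc, by norm_num⟩)
      have e : c • J + s • k = J * (c • ((1 : ℝ) • 1 + (0 : ℝ) • (-(-(J * k) * -(J * k)))) +
          s • (((1 : ℝ) • 1 + (0 : ℝ) • (-(-(J * k) * -(J * k)))) * -(J * k))) := by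
        simp only [one_smul, zero_smul, add_zero, one_mul, mul_add, mul_smul_comm, mul_one]
        rw [mul_neg, ← mul_assoc, hJ.2, neg_mul, one_mul, neg_neg]
      rw [e]
      exact hJ.isUnit.mul this
    have s2 : HtpyRel (Lin (scalar (Fin 3) '' S) (basePre J)) ∅
        (fun x => pathPre J (j x) 1 1 0 0 0) (fun x => pathEnd J (j x) (j x) 0 1) := by
      refine HtpyRel.of_real 1 zero_le_one
        (fun τ x => pathPre J (j x) (1 - τ) (1 - τ) τ 0 0) ?_ ?_ ?_ ?_ ?_
      · exact continuous_pathPre (hjc.comp continuous_snd) (by fun_prop) (by fun_prop)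
          (by fun_prop) (by fun_prop) (by fun_prop)
      · intro τ hτ x
        refine ⟨pathPre_mem hJ.1 (hj x) _ _ _ _ _, fun c s h => ?_⟩
        rw [pathPre_eq_pathEnd]
        exact huu (hj x) (hjJ x) (hju x) τ c s h
      · intro x; norm_num
      · intro x; norm_num [pathPre_eq_pathEnd]
      · simp
    have s3 : HtpyRel (Lin (scalar (Fin 3) '' S) (basePre J)) ∅
        (fun x => pathEnd J (j x) j₀ 1 0) (fun x => pathEnd J (j x) j₀ 0 1) := by
      refine HtpyRel.of_real 1 zero_le_one
        (fun τ x => pathEnd J (j x) j₀ (1 - τ) τ) ?_ ?_ ?_ ?_ ?_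
      · exact continuous_pathEnd (hjc.comp continuous_snd) (by fun_prop) (by fun_prop)
      · intro τ hτ x
        refine ⟨pathEnd_mem hJ.1 (hj x) hj₀ _ _, fun c s h => ?_⟩
        rw [smul_basePre_add_pathEnd]
        have := huu hj₀ hj₀J hj₀u τ c s h
        rw [smul_basePre_add_pathEnd] at this
        exact isUnit_diag_block (hlu (hj x) (hjJ x) (hju x) c s h) (hlu hj₀ hj₀J hj₀u c s h) this
      · intro x; norm_num
      · intro x; norm_num
      · simp
    have e0 : ∀ x, linPre J (j x) = pathPre J (j x) 0 1 0 1 (1 / 2) := fun x => by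
      simp [linPre, pathPre]
    have e1 : ∀ x, pathEnd J (j x) (j x) 0 1 = pathEnd J (j x) j₀ 0 1 := fun x => by
      simp [pathEnd]
    exact ((s0.congr e0 fun _ => rfl).trans s1).trans
      ((s2.congr (fun _ => rfl) fun x => (e1 x).symm).trans s3.symm)
  have e2 : ∀ x, star (rotU w) * pathEnd J (j x) j₀ 1 0 * rotU w =
      !![j x, 0, 0; 0, j₀, 0; 0, 0, j₀] := fun x => by
    rw [← rotU_diag hw hww hwj]; simp [pathEnd]
  have := key.map (fun _ M => star (rotU w) * M * rotU w)
    (Y' := Lin (scalar (Fin 3) '' S) (scalar (Fin 3) J))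
    ((continuous_const.mul continuous_snd).mul continuous_const) fun x M hM => by
      rw [← rotU_basePre hw hww hwJ]
      exact conj_mem_Lin (forall_mem_image.2 fun g hg => rotU_comm (hwS g hg))
        (forall_mem_image.2 fun g hg => star_rotU_comm hw (hwS g hg)) (isUnit_rotU hw hww) hM
  exact this.congr (fun _ => rfl) fun x => (e2 x).symm

end Path

end Bott

open scoped Topology

namespace Bott

open unitInterval Set Matrix

section SwapConj

variable {A : Type*} [Ring A] [StarRing A] [Algebra ℝ A] [StarModule ℝ A] [TopologicalSpace A]
  [IsTopologicalRing A] [ContinuousSMul ℝ A]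

/-- A quadratic correction can be exchanged for its linearization. -/
theorem swap_conj {Y : Type*} [TopologicalSpace Y] {Y₀ : Set Y} {S : Set A} {J w : A}
    (hJ : IsCplx S J) (hw : star w = -w) (hww : w * w = -1) (hwJ : w * J = -(J * w))
    (hwS : ∀ g ∈ S, w * g = g * w) {c s : Y → ℝ} (hc : Continuous c) (hs : Continuous s)
    (hcs : ∀ y, c y ^ 2 + s y ^ 2 = 1) {B D₁ D₂ D₃ : Y → A} (hB : Continuous B)
    (hD₁ : Continuous D₁) (hD₂ : Continuous D₂) (hD₃ : Continuous D₃)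
    (mB : ∀ y, B y ∈ skewAnti S) (mD₁ : ∀ y, D₁ y ∈ skewAnti S) (mD₂ : ∀ y, D₂ y ∈ skewAnti S)
    (mD₃ : ∀ y, D₃ y ∈ skewAnti S)
    (e₁ : ∀ y ∈ Y₀, D₁ y = 0) (e₂ : ∀ y ∈ Y₀, D₂ y = 0) (e₃ : ∀ y ∈ Y₀, D₃ y = 0)
    (hu : ∀ y, IsUnit (c y • J + s y • B y + quad (c y) (s y) (D₁ y) (D₂ y) (D₃ y)))
    (hu' : ∀ y, IsUnit (c y • J + s y • B y)) :
    HtpyRel (USkew (scalar (Fin 4) '' S)) Y₀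
      (fun y => sum4 (c y • J + s y • B y + quad (c y) (s y) (D₁ y) (D₂ y) (D₃ y))
        (c y • scalar (Fin 3) J + s y • linConj w J (B y)))
      (fun y => sum4 (c y • J + s y • B y)
        (c y • scalar (Fin 3) J + s y • linConj w J (B y) +
          degConj w (D₁ y) (D₂ y) (D₃ y))) := by
  have mm : ∀ (r : ℝ) {x : A}, x ∈ skewAnti S → r • x ∈ skewAnti S :=
    fun r x hx => Submodule.smul_mem _ _ hx
  have hd0 : degConj w 0 0 0 = (0 : Matrix (Fin 3) (Fin 3) A) := by
    have : degPre (0 : A) 0 0 = 0 := by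
      ext i j
      fin_cases i <;> fin_cases j <;> rfl
    rw [degConj, this, mul_zero, zero_mul]
  have hq0 : ∀ c s : ℝ, quad c s (0 : A) 0 0 = 0 := fun c s => by simp [quad]
  have H := swap_linBlock (Y₀ := Y₀) hJ hc hs hcs
    (P₁ := fun y => c y • J + s y • B y + 0) (Q := fun y => s y • (1 / 2 : ℝ) • J + 0)
    (P₂ := fun y => s y • B y + 0)
    (P₁' := fun y => c y • J + s y • B y + D₁ y) (Q' := fun y => s y • (1 / 2 : ℝ) • J + D₂ y)
    (P₂' := fun y => s y • B y + D₃ y) (by fun_prop) (by fun_prop) (by fun_prop) (by fun_prop)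
    (by fun_prop) (by fun_prop)
    (fun y => add_mem (add_mem (mm _ hJ.1) (mm _ (mB y))) (zero_mem _))
    (fun y => add_mem (mm _ (mm _ hJ.1)) (zero_mem _))
    (fun y => add_mem (mm _ (mB y)) (zero_mem _))
    (fun y => add_mem (add_mem (mm _ hJ.1) (mm _ (mB y))) (mD₁ y))
    (fun y => add_mem (mm _ (mm _ hJ.1)) (mD₂ y)) (fun y => add_mem (mm _ (mB y)) (mD₃ y))
    (fun y hy => by rw [e₁ y hy]) (fun y hy => by rw [e₂ y hy]) (fun y hy => by rw [e₃ y hy])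
    (fun y => by rw [quad_eq _ _ _ _ _ (hcs y), hq0, add_zero]; exact hu' y)
    (fun y => by rw [quad_eq _ _ _ _ _ (hcs y)]; exact hu y)
  have hVu : IsUnit (sum4 1 (rotU w)) := by
    refine ⟨⟨sum4 1 (rotU w), sum4 1 (star (rotU w)), ?_, ?_⟩, rfl⟩
    · rw [sum4_mul_one, rotU_mul_star hw hww, sum4_one]
    · rw [sum4_mul_one, star_rotU_mul hw hww, sum4_one]
  have K := H.map (fun _ M => star (sum4 1 (rotU w)) * M * sum4 1 (rotU w))
    (Y' := USkew (scalar (Fin 4) '' S))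
    ((continuous_const.mul continuous_snd).mul continuous_const) fun y M hM =>
      conj_mem_USkew (forall_mem_image.2 fun g hg => sum4_one_comm (rotU_comm (hwS g hg)))
        (forall_mem_image.2 fun g hg => by
          rw [star_sum4]; exact sum4_one_comm (star_rotU_comm hw (hwS g hg))) hVu hM
  refine K.congr (fun y => ?_) fun y => ?_
  · rw [star_sum4, sum4_conj, conj_linBlock hw hww hwJ, quad_eq _ _ _ _ _ (hcs y), hd0, add_zero]
  · rw [star_sum4, sum4_conj, conj_linBlock hw hww hwJ, quad_eq _ _ _ _ _ (hcs y), hq0, add_zero]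

end SwapConj

section Reindex

variable {ι κ : Type*} [Fintype ι] [DecidableEq ι] [Fintype κ] [DecidableEq κ]

/-- The splitting of four blocks as one block and three blocks. -/
def splitFour (κ : Type*) : Fin 4 × κ ≃ κ ⊕ Fin 3 × κ where
  toFun p := Fin.cases (motive := fun _ => κ ⊕ Fin 3 × κ) (Sum.inl p.2) (fun i => Sum.inr (i, p.2)) p.1
  invFun q := q.elim (fun k => (0, k)) fun p => (p.1.succ, p.2)
  left_inv := by
    rintro ⟨i, k⟩
    refine Fin.cases ?_ (fun i => ?_) i <;> rfl
  right_inv := by rintro (k | ⟨i, k⟩) <;> rfl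

theorem reindex_sum4 (a : Mat ι κ) (M : Matrix (Fin 3) (Fin 3) (Mat ι κ)) :
    reindexAlgEquiv ℝ (Matrix ι ι ℝ) (splitFour κ) (compAlgEquiv (Fin 4) κ (Matrix ι ι ℝ) ℝ (sum4 a M)) =
      fromBlocks a 0 0 (compAlgEquiv (Fin 3) κ (Matrix ι ι ℝ) ℝ M) := by
  ext1 (i | ⟨i, k⟩) (j | ⟨j, l⟩)
  · rfl
  · fin_cases j <;> rfl
  · fin_cases i <;> rfl
  · fin_cases i <;> fin_cases j <;> rfl

end Reindex

end Bott

open scoped Topology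

namespace Bott

open unitInterval Set Matrix

variable {ι κ κ' : Type} [Fintype ι] [DecidableEq ι] [Fintype κ] [DecidableEq κ] [Fintype κ']
  [DecidableEq κ']

/-- The data of one step of the periodicity argument: a complex structure `J`, an auxiliary rotation
`w` and a base point `j` of the next space. -/
structure StepData (S : Set (Matrix ι ι ℝ)) (J j w : Matrix ι ι ℝ) : Prop where
  cplx : IsCplx S J
  star_w : star w = -w
  w_sq : w * w = -1
  w_J : w * J = -(J * w)
  w_comm : ∀ g ∈ S, w * g = g * w
  w_j : w * j = j * w
  j_mem : j ∈ skewAnti S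
  j_J : j * J = -(J * j)
  j_sq : j * j = -1

/-- Skew block matrices anticommuting with `S`. -/
abbrev SK (S : Set (Matrix ι ι ℝ)) (κ : Type) [Fintype κ] [DecidableEq κ] :
    Submodule ℝ (Mat ι κ) := skewAnti (scalar κ '' S)

/-- Invertible skew block matrices anticommuting with `S`. -/
abbrev US (S : Set (Matrix ι ι ℝ)) (κ : Type) [Fintype κ] [DecidableEq κ] : Set (Mat ι κ) :=
  USkew (scalar κ '' S)

/-- Directions of invertible linear pencils through `J`. -/
abbrev LI (S : Set (Matrix ι ι ℝ)) (J : Matrix ι ι ℝ) (κ : Type) [Fintype κ] [DecidableEq κ] :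
    Set (Mat ι κ) := Lin (scalar κ '' S) (scalar κ J)

/-- The half circle from `J` to `-J` through `B`. -/
noncomputable def linF (J : Matrix ι ι ℝ) (B : Mat ι κ) (t : I) : Mat ι κ :=
  cosI t • scalar κ J + sinI t • B

/-- The linearization of a linear part. -/
noncomputable def linM (w J : Matrix ι ι ℝ) (B : Mat ι κ) : Mat ι (Fin 3 × κ) :=
  compAlgEquiv (Fin 3) κ (Matrix ι ι ℝ) ℝ (linConj (scalar κ w) (scalar κ J) B)

/-- Block sum of block matrices. -/
def bs (x : Mat ι κ) (y : Mat ι κ') : Mat ι (κ ⊕ κ') := fromBlocks x 0 0 y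

theorem cont_linF {Y : Type*} [TopologicalSpace Y] (J : Matrix ι ι ℝ) {B : Y → Mat ι κ}
    {t : Y → I} (hB : Continuous B) (ht : Continuous t) : Continuous fun y => linF J (B y) (t y) := by
  have h1 : Continuous fun y => cosI (t y) := by fun_prop
  have h2 : Continuous fun y => sinI (t y) := by fun_prop
  refine continuous_matrix fun i k => continuous_matrix fun a b => ?_
  have h3 : Continuous fun y => B y i k a b := by fun_prop
  exact (h1.mul continuous_const).add (h2.mul h3)

theorem continuous_bs : Continuous fun p : Mat ι κ × Mat ι κ' => bs p.1 p.2 := by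
  unfold bs
  exact continuous_fst.matrix_fromBlocks continuous_const continuous_const continuous_snd

theorem cont_bs {Y : Type*} [TopologicalSpace Y] {x : Y → Mat ι κ} {z : Y → Mat ι κ'}
    (hx : Continuous x) (hz : Continuous z) : Continuous fun y => bs (x y) (z y) :=
  continuous_bs.comp (hx.prodMk hz)

theorem bs_linF (J : Matrix ι ι ℝ) (x : Mat ι κ) (y : Mat ι κ') (t : I) :
    bs (linF J x t) (linF J y t) = linF J (bs x y) t := by
  simp only [bs, linF, scalar_sum, fromBlocks_smul, fromBlocks_add, smul_zero, add_zero]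

variable {S : Set (Matrix ι ι ℝ)} {J j w : Matrix ι ι ℝ}

theorem bs_mem_US {x : Mat ι κ} {y : Mat ι κ'} (hx : x ∈ US S κ) (hy : y ∈ US S κ') :
    bs x y ∈ US S (κ ⊕ κ') := fromBlocks_mem_USkew hx hy

theorem bs_mem_LI {x : Mat ι κ} {y : Mat ι κ'} (hx : x ∈ LI S J κ) (hy : y ∈ LI S J κ') :
    bs x y ∈ LI S J (κ ⊕ κ') := fromBlocks_mem_Lin hx hy

theorem linF_mem_SK (hJ : J ∈ skewAnti S) {B : Mat ι κ} (hB : B ∈ SK S κ) (t : I) :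
    linF J B t ∈ SK S κ :=
  add_mem (Submodule.smul_mem _ _ (scalar_mem_skewAnti hJ)) (Submodule.smul_mem _ _ hB)

theorem linF_mem_US (hJ : J ∈ skewAnti S) {B : Mat ι κ} (hB : B ∈ LI S J κ) (t : I) :
    linF J B t ∈ US S κ :=
  ⟨linF_mem_SK hJ hB.1 t, hB.2 _ _ (cosI_sq_add t)⟩

theorem scalar_comm {a b : Matrix ι ι ℝ} (h : a * b = b * a) :
    scalar κ a * scalar κ b = scalar κ b * scalar κ a := by
  rw [← map_mul, h, map_mul]

theorem scalar_anti {a b : Matrix ι ι ℝ} (h : a * b = -(b * a)) :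
    scalar κ a * scalar κ b = -(scalar κ b * scalar κ a) := by
  rw [← map_mul, h, map_neg, map_mul]

theorem star_scalar (a : Matrix ι ι ℝ) : star (scalar κ a) = scalar κ (star a) := by
  ext1 i j
  by_cases h : i = j
  · subst h; simp
  · simp [h, Ne.symm h]

theorem mem_LI_of_anti (hJ : IsCplx S J) {B : Mat ι κ} (hB : B ∈ SK S κ)
    (h : B * scalar κ J = -(scalar κ J * B)) (hu : IsUnit B) : B ∈ LI S J κ := by
  have hJJ : scalar κ J * scalar κ J = -1 := hJ.scalar.2
  have hJu : IsUnit (scalar κ J) := hJ.isUnit.map (scalar κ)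
  have hs : star (-(scalar κ J * B)) = -(-(scalar κ J * B)) := by
    rw [star_neg, star_mul, hB.1, (hJ.scalar (m := κ)).1.1, neg_mul_neg, h, neg_neg]
  refine ⟨hB, fun c s hcs => ?_⟩
  have key := Mat.isUnit_skew_comb hs (hJu.mul hu).neg (c := c) (s := s) (a₀ := 1) (a₁ := 0)
    (b₀ := 1) (b₁ := 0) zero_le_one le_rfl zero_le_one le_rfl (by
      by_cases hc : c = 0
      · right; subst hc
        exact ⟨by rintro rfl; norm_num at hcs, by norm_num⟩
      · left; exact ⟨hc, by norm_num⟩)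
  rw [one_smul, zero_smul, add_zero, one_mul] at key
  have := hJu.mul key
  rwa [mul_add, mul_smul_comm, mul_smul_comm, mul_one, mul_neg, ← mul_assoc, hJJ, neg_one_mul,
    neg_neg] at this

namespace StepData


theorem star_sw (h : StepData S J j w) : star (scalar κ w) = -scalar κ w := by rw [star_scalar, h.star_w, map_neg]

theorem sw_sq (h : StepData S J j w) : scalar κ w * scalar κ w = -1 := by rw [← map_mul, h.w_sq, map_neg, map_one]

theorem sw_sJ (h : StepData S J j w) : scalar κ w * scalar κ J = -(scalar κ J * scalar κ w) := scalar_anti h.w_J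

theorem sw_comm (h : StepData S J j w) : ∀ g ∈ scalar κ '' S, scalar κ w * g = g * scalar κ w :=
  forall_mem_image.2 fun g hg => scalar_comm (h.w_comm g hg)

theorem sj_mem (h : StepData S J j w) : scalar κ j ∈ SK S κ := scalar_mem_skewAnti h.j_mem

theorem sj_mem_LI (h : StepData S J j w) : scalar κ j ∈ LI S J κ :=
  mem_LI_of_anti h.cplx h.sj_mem (scalar_anti h.j_J)
    ((IsCplx.isUnit (S := S) ⟨h.j_mem, h.j_sq⟩).map (scalar κ))

theorem sj_mem_US (h : StepData S J j w) : scalar κ j ∈ US S κ := ⟨h.sj_mem, Lin.isUnit h.sj_mem_LI⟩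

theorem linM_mem (h : StepData S J j w) {B : Mat ι κ} (hB : B ∈ SK S κ) : linM w J B ∈ SK S (Fin 3 × κ) := by
  rw [SK, ← comp_image_scalar]
  exact isStarHomeo_comp.mem_skewAnti.2 (linConj_mem h.star_sw h.sw_comm h.cplx.scalar.1 hB)

theorem linM_mem_LI (h : StepData S J j w) {B : Mat ι κ} (hB : B ∈ LI S J κ) : linM w J B ∈ LI S J (Fin 3 × κ) := by
  rw [LI, ← comp_image_scalar, ← comp_scalar_scalar]
  exact isStarHomeo_comp.mem_Lin.2
    (linConj_mem_Lin h.star_sw h.sw_sq h.sw_comm h.cplx.scalar h.sw_sJ hB)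

theorem continuous_linM : Continuous (linM w J : Mat ι κ → _) :=
  isStarHomeo_comp.continuous.comp (continuous_linConj _ _)

theorem linF_linM (B : Mat ι κ) (t : I) : linF J (linM w J B) t =
    compAlgEquiv (Fin 3) κ (Matrix ι ι ℝ) ℝ (cosI t • scalar (Fin 3) (scalar κ J) +
      sinI t • linConj (scalar κ w) (scalar κ J) B) := by
  rw [map_add, map_smul, map_smul, comp_scalar_scalar, linF, linM]

/-- The degree of the nonlinear part can be lowered by one. -/
theorem lower (h : StepData S J j w) {X : Type*} [TopologicalSpace X] {A : Set X} {n : ℕ} {B : X → Mat ι κ}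
    (hBc : Continuous B) (hB : ∀ x, B x ∈ SK S κ) {D : X × I → Mat ι κ}
    (hD : Deg (SK S κ) A (n + 1) D) (hu : ∀ p : X × I, IsUnit (linF J (B p.1) p.2 + D p)) :
    ∃ D' : X × I → Mat ι (Fin 3 × κ), Deg (SK S (Fin 3 × κ)) A n D' ∧
      (∀ p : X × I, IsUnit (linF J (linM w J (B p.1)) p.2 + D' p)) ∧
      ((∀ x, B x ∈ LI S J κ) → HtpyRel (US S (κ ⊕ Fin 3 × κ)) (relEnds A)
        (fun p => bs (linF J (B p.1) p.2 + D p) (linF J (linM w J (B p.1)) p.2))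
        (fun p => bs (linF J (B p.1) p.2) (linF J (linM w J (B p.1)) p.2 + D' p))) := by
  obtain ⟨D₁, D₂, D₃, h₁, h₂, h₃, e⟩ := hD
  obtain ⟨f₁, f₂, f₃, hf⟩ := exists_degConj_clm (scalar κ w)
  have hm := fun {x y z : Mat ι κ} => degConj_mem (w := scalar κ w) (S := scalar κ '' S)
    (D₁ := x) (D₂ := y) (D₃ := z) h.star_sw h.sw_comm
  have hφ := isStarHomeo_comp (m := Fin 3) (n := κ) (A := Matrix ι ι ℝ)
  let φ : Matrix (Fin 3) (Fin 3) (Mat ι κ) →L[ℝ] Mat ι (Fin 3 × κ) :=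
    ⟨(compAlgEquiv (Fin 3) κ (Matrix ι ι ℝ) ℝ).toLinearMap, hφ.continuous⟩
  have hφm : ∀ M ∈ skewAnti (scalar (Fin 3) '' (scalar κ '' S)), φ M ∈ SK S (Fin 3 × κ) :=
    fun M hM => by
      rw [SK, ← comp_image_scalar]
      exact hφ.mem_skewAnti.2 hM
  have hq : ∀ p, D p = quad (cosI p.2) (sinI p.2) (D₁ p) (D₂ p) (D₃ p) := e
  have heq : ∀ p : X × I, linF J (linM w J (B p.1)) p.2 +
      φ (degConj (scalar κ w) (D₁ p) (D₂ p) (D₃ p)) =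
      compAlgEquiv (Fin 3) κ (Matrix ι ι ℝ) ℝ (cosI p.2 • scalar (Fin 3) (scalar κ J) +
        sinI p.2 • linConj (scalar κ w) (scalar κ J) (B p.1) +
          degConj (scalar κ w) (D₁ p) (D₂ p) (D₃ p)) := fun p => by
    rw [map_add, ← linF_linM]; rfl
  refine ⟨fun p => φ (degConj (scalar κ w) (D₁ p) (D₂ p) (D₃ p)), ?_, fun p => ?_, fun hL => ?_⟩
  · refine (((h₁.map (φ.comp f₁) fun v hv => ?_).add (h₂.map (φ.comp f₂) fun v hv => ?_)).add
      (h₃.map (φ.comp f₃) fun v hv => ?_)).congr fun p => ?_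
    · have := hf v 0 0
      rw [map_zero, map_zero, add_zero, add_zero] at this
      rw [ContinuousLinearMap.comp_apply, ← this]
      exact hφm _ (hm hv (zero_mem _) (zero_mem _))
    · have := hf 0 v 0
      rw [map_zero, map_zero, add_zero, zero_add] at this
      rw [ContinuousLinearMap.comp_apply, ← this]
      exact hφm _ (hm (zero_mem _) hv (zero_mem _))
    · have := hf 0 0 v
      rw [map_zero, map_zero, add_zero, zero_add] at this
      rw [ContinuousLinearMap.comp_apply, ← this]
      exact hφm _ (hm (zero_mem _) (zero_mem _) hv)
    · rw [hf, map_add, map_add]; rfl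
  · rw [heq]
    refine IsUnit.map _ (isUnit_conj_linBlock h.star_sw h.sw_sq h.cplx.scalar h.sw_sJ
      (cosI_sq_add p.2) ?_)
    rw [← hq]; exact hu p
  · have K := swap_conj (Y₀ := relEnds A) h.cplx.scalar h.star_sw h.sw_sq h.sw_sJ h.sw_comm
      (c := fun p : X × I => cosI p.2) (s := fun p : X × I => sinI p.2) (by fun_prop) (by fun_prop)
      (fun p => cosI_sq_add p.2) (hBc.comp continuous_fst) h₁.continuous h₂.continuous
      h₃.continuous (fun p => hB p.1) h₁.mem h₂.mem h₃.mem (fun p => h₁.eq_zero)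
      (fun p => h₂.eq_zero) (fun p => h₃.eq_zero)
      (fun p => by rw [← hq]; exact hu p) (fun p => (linF_mem_US h.cplx.1 (hL p.1) p.2).2)
    have h4 := isStarHomeo_comp (m := Fin 4) (n := κ) (A := Matrix ι ι ℝ)
    have h5 := isStarHomeo_reindex (A := Matrix ι ι ℝ) (splitFour κ)
    have K' := K.map (Y' := US S (κ ⊕ Fin 3 × κ)) (fun _ M => reindexAlgEquiv ℝ (Matrix ι ι ℝ) (splitFour κ)
      (compAlgEquiv (Fin 4) κ (Matrix ι ι ℝ) ℝ M))
      (h5.continuous.comp (h4.continuous.comp continuous_snd)) fun p M hM => by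
        rw [US, ← reindex_image_scalar (splitFour κ), ← comp_image_scalar]
        exact h5.mem_USkew.2 (h4.mem_USkew.2 hM)
    refine K'.congr (fun p => ?_) fun p => ?_
    · rw [reindex_sum4, ← linF_linM, ← hq]; rfl
    · rw [reindex_sum4, heq]; rfl

end StepData

end Bott

open scoped Topology

namespace Bott

open unitInterval Set Matrix

section Cube

variable {n : ℕ} {E : Type*} [TopologicalSpace E] {Y : Set E}

theorem relEnds_iff_cons {x : Fin n → I} {t : I} :
    (Fin.cons t x : Fin (n + 1) → I) ∈ Cube.boundary (Fin (n + 1)) ↔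
      (x, t) ∈ relEnds (Cube.boundary (Fin n)) := by
  simp only [Cube.boundary, relEnds, mem_ofPred_eq, Fin.exists_fin_succ, Fin.cons_zero,
    Fin.cons_succ]
  exact or_comm

theorem relEnds_iff_tail {y : Fin (n + 1) → I} :
    y ∈ Cube.boundary (Fin (n + 1)) ↔ (Fin.tail y, y 0) ∈ relEnds (Cube.boundary (Fin n)) := by
  rw [← relEnds_iff_cons, Fin.cons_self_tail]

theorem continuous_cons : Continuous fun p : (Fin n → I) × I => (Fin.cons p.2 p.1 : Fin (n + 1) → I) := by
  refine continuous_pi fun i => ?_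
  refine Fin.cases ?_ (fun i => ?_) i
  · exact continuous_snd
  · exact (continuous_apply i).comp continuous_fst

theorem continuous_tail : Continuous fun y : Fin (n + 1) → I => (Fin.tail y, y 0) :=
  (continuous_pi fun i => continuous_apply i.succ).prodMk (continuous_apply 0)

/-- A version of `HtpyRel.transfer` for families of paths. -/
theorem HtpyRel.transfer_prod {H K : I × ((Fin n → I) × I) → E} (hH : Continuous H)
    (hK : Continuous K) (hHY : ∀ q, H q ∈ Y) (hKY : ∀ q, K q ∈ Y)
    (hHK : ∀ t, ∀ y ∈ relEnds (Cube.boundary (Fin n)), H (t, y) = K (t, y))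
    (R : HtpyRel Y (relEnds (Cube.boundary (Fin n))) (fun y => H (0, y)) (fun y => K (0, y))) :
    HtpyRel Y (relEnds (Cube.boundary (Fin n))) (fun y => H (1, y)) (fun y => K (1, y)) := by
  have hc : Continuous fun q : I × (Fin (n + 1) → I) => (q.1, (Fin.tail q.2, q.2 0)) :=
    continuous_fst.prodMk (continuous_tail.comp continuous_snd)
  have := (HtpyRel.transfer (H := fun q => H (q.1, (Fin.tail q.2, q.2 0)))
    (K := fun q => K (q.1, (Fin.tail q.2, q.2 0))) (hH.comp hc) (hK.comp hc) (fun q => hHY _)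
    (fun q => hKY _) (fun t y hy => hHK _ _ (relEnds_iff_tail.1 hy))
    (R.comp (fun y : Fin (n + 1) → I => (Fin.tail y, y 0)) continuous_tail
      fun y hy => relEnds_iff_tail.1 hy)).comp _ continuous_cons fun x hx => relEnds_iff_cons.2 hx
  exact this

end Cube

variable {ι κ κ' κ'' : Type} [Fintype ι] [DecidableEq ι] [Fintype κ] [DecidableEq κ] [Fintype κ']
  [DecidableEq κ'] [Fintype κ''] [DecidableEq κ'']
variable {S : Set (Matrix ι ι ℝ)} {J j w : Matrix ι ι ℝ}

section Ri

/-- Relabelling of block matrices. -/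
def ri (e : κ ≃ κ') (x : Mat ι κ) : Mat ι κ' := reindexAlgEquiv ℝ (Matrix ι ι ℝ) e x

variable (e : κ ≃ κ')

theorem continuous_ri : Continuous (ri e : Mat ι κ → Mat ι κ') := (isStarHomeo_reindex e).continuous

theorem ri_scalar (g : Matrix ι ι ℝ) : ri e (scalar κ g) = scalar κ' g := reindex_scalar e g

theorem ri_mem_US {x : Mat ι κ} : ri e x ∈ US S κ' ↔ x ∈ US S κ := by
  rw [US, ← reindex_image_scalar e]; exact (isStarHomeo_reindex e).mem_USkew

theorem ri_mem_LI {x : Mat ι κ} : ri e x ∈ LI S J κ' ↔ x ∈ LI S J κ := by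
  rw [LI, ← reindex_image_scalar e, ← reindex_scalar e]; exact (isStarHomeo_reindex e).mem_Lin

theorem ri_linF (x : Mat ι κ) (t : I) : ri e (linF J x t) = linF J (ri e x) t := by
  simp only [ri, linF, map_add, map_smul, reindex_scalar]

theorem ri_assoc (x : Mat ι κ) (y : Mat ι κ') (z : Mat ι κ'') :
    ri (Equiv.sumAssoc κ κ' κ'') (bs (bs x y) z) = bs x (bs y z) := by
  ext1 (i | i | i) (k | k | k) <;> rfl

theorem bs_scalar (g : Matrix ι ι ℝ) : bs (scalar κ g) (scalar κ' g) = scalar (κ ⊕ κ') g :=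
  (scalar_sum g).symm

end Ri

section Htpy

variable {X : Type*} [TopologicalSpace X] {A : Set X}

theorem HtpyRel.bs_US {f g : X → Mat ι κ} {f' g' : X → Mat ι κ'} (H : HtpyRel (US S κ) A f g)
    (K : HtpyRel (US S κ') A f' g') :
    HtpyRel (US S (κ ⊕ κ')) A (fun x => bs (f x) (f' x)) (fun x => bs (g x) (g' x)) :=
  H.map₂ K (fun _ x y => bs x y) (continuous_bs.comp continuous_snd)
    fun _ _ hx _ hy => bs_mem_US hx hy

theorem HtpyRel.bs_LI {f g : X → Mat ι κ} {f' g' : X → Mat ι κ'} (H : HtpyRel (LI S J κ) A f g)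
    (K : HtpyRel (LI S J κ') A f' g') :
    HtpyRel (LI S J (κ ⊕ κ')) A (fun x => bs (f x) (f' x)) (fun x => bs (g x) (g' x)) :=
  H.map₂ K (fun _ x y => bs x y) (continuous_bs.comp continuous_snd)
    fun _ _ hx _ hy => bs_mem_LI hx hy

theorem HtpyRel.ri_US {f g : X → Mat ι κ} (H : HtpyRel (US S κ) A f g) (e : κ ≃ κ') :
    HtpyRel (US S κ') A (fun x => ri e (f x)) (fun x => ri e (g x)) :=
  H.map (fun _ => ri e) ((continuous_ri e).comp continuous_snd) fun _ _ hx => (ri_mem_US e).2 hx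

theorem HtpyRel.ri_LI {f g : X → Mat ι κ} (H : HtpyRel (LI S J κ) A f g) (e : κ ≃ κ') :
    HtpyRel (LI S J κ') A (fun x => ri e (f x)) (fun x => ri e (g x)) :=
  H.map (fun _ => ri e) ((continuous_ri e).comp continuous_snd) fun _ _ hx => (ri_mem_LI e).2 hx

end Htpy

theorem linF_ends (B B' : Mat ι κ) {t : I} (ht : t = 0 ∨ t = 1) : linF J B t = linF J B' t := by
  have : sinI t = 0 := by
    rcases ht with rfl | rfl <;> simp [sinI]
  simp [linF, this]

theorem mem_LI_of_linF {B : Mat ι κ} (hB : B ∈ SK S κ) (h : ∀ t, IsUnit (linF J B t)) :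
    B ∈ LI S J κ := by
  have key : ∀ c s : ℝ, c ^ 2 + s ^ 2 = 1 → 0 ≤ s → IsUnit (c • scalar κ J + s • B) := by
    intro c s hcs hs
    have h1 : -1 ≤ c := by nlinarith
    have h2 : c ≤ 1 := by nlinarith
    have hpi := Real.pi_pos
    have hm : Real.arccos c / Real.pi ∈ I :=
      ⟨div_nonneg (Real.arccos_nonneg c) hpi.le, (div_le_one hpi).2 (Real.arccos_le_pi c)⟩
    have e : Real.pi * (Real.arccos c / Real.pi) = Real.arccos c := by field_simp
    have := h ⟨_, hm⟩
    have e1 : cosI ⟨_, hm⟩ = c := by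
      simp only [cosI, ContinuousMap.coe_mk, e, Real.cos_arccos h1 h2]
    have e2 : sinI ⟨_, hm⟩ = s := by
      simp only [sinI, ContinuousMap.coe_mk, e, Real.sin_arccos]
      rw [show 1 - c ^ 2 = s ^ 2 by linarith, Real.sqrt_sq hs]
    rwa [linF, e1, e2] at this
  refine ⟨hB, fun c s hcs => ?_⟩
  rcases le_total 0 s with hs | hs
  · exact key c s hcs hs
  · have := (key (-c) (-s) (by linarith [neg_sq c, neg_sq s]) (by linarith)).neg
    convert this using 1
    module

theorem mem_LI_empty (B : Mat ι Empty) : B ∈ LI S J Empty :=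
  ⟨by rw [Subsingleton.elim B 0]; exact zero_mem _, fun _ _ _ => isUnit_of_subsingleton _⟩

/-- The block matrix `diag(g, j, j)`. -/
def d3 (j : Matrix ι ι ℝ) (g : Mat ι κ) : Mat ι (Fin 3 × κ) :=
  compAlgEquiv (Fin 3) κ (Matrix ι ι ℝ) ℝ !![g, 0, 0; 0, scalar κ j, 0; 0, 0, scalar κ j]

theorem d3_scalar : d3 j (scalar κ j) = scalar (Fin 3 × κ) j := by
  rw [← comp_scalar_scalar, d3]
  congr 1
  ext1 i k
  fin_cases i <;> fin_cases k <;> rfl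

namespace StepData


theorem htpyRel_linM (h : StepData S J j w) {X : Type*} [TopologicalSpace X] {g : X → Mat ι κ} (hgc : Continuous g)
    (hg : ∀ x, g x ∈ US S κ) (hgJ : ∀ x, g x * scalar κ J = -(scalar κ J * g x)) :
    HtpyRel (LI S J (Fin 3 × κ)) ∅ (fun x => linM w J (g x)) (fun x => d3 j (g x)) := by
  have := htpyRel_linConj h.cplx.scalar h.star_sw h.sw_sq h.sw_sJ h.sw_comm (scalar_comm h.w_j)
    h.sj_mem (scalar_anti h.j_J) (Lin.isUnit h.sj_mem_LI) hgc (fun x => (hg x).1) hgJ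
    fun x => (hg x).2
  refine this.map (Y' := LI S J (Fin 3 × κ)) (fun _ => compAlgEquiv (Fin 3) κ (Matrix ι ι ℝ) ℝ)
    (isStarHomeo_comp.continuous.comp continuous_snd) fun x M hM => ?_
  rw [LI, ← comp_image_scalar, ← comp_scalar_scalar]
  exact isStarHomeo_comp.mem_Lin.2 hM

theorem path_linM (h : StepData S J j w) {B : Mat ι κ}
    (hB : HtpyRel (LI S J κ) ∅ (fun _ : Unit => B) (fun _ => scalar κ j)) :
    HtpyRel (LI S J (Fin 3 × κ)) ∅ (fun _ : Unit => linM w J B) (fun _ => scalar (Fin 3 × κ) j) := by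
  have h1 := hB.map (Y' := LI S J (Fin 3 × κ)) (fun _ => linM w J)
    (continuous_linM.comp continuous_snd) fun _ _ hx => h.linM_mem_LI hx
  have h2 := h.htpyRel_linM (X := Unit) (g := fun _ => scalar κ j) continuous_const
    (fun _ => h.sj_mem_US) fun _ => scalar_anti h.j_J
  exact (h1.trans h2).congr (fun _ => rfl) fun _ => d3_scalar.symm

theorem lift_deg (h : StepData S J j w) {X : Type*} [TopologicalSpace X] {A : Set X} (n : ℕ) :
    ∀ (κ : Type) [Fintype κ] [DecidableEq κ] (B : Mat ι κ)
      (_ : HtpyRel (LI S J κ) ∅ (fun _ : Unit => B) (fun _ => scalar κ j))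
      (D : X × I → Mat ι κ) (_ : Deg (SK S κ) A n D)
      (_ : ∀ p : X × I, IsUnit (linF J B p.2 + D p)),
      ∃ (κ' : Type) (_ : Fintype κ') (_ : DecidableEq κ') (E : Mat ι κ') (b : X → Mat ι (κ ⊕ κ')),
        HtpyRel (LI S J κ') ∅ (fun _ : Unit => E) (fun _ => scalar κ' j) ∧
        Continuous b ∧ (∀ x, b x ∈ LI S J (κ ⊕ κ')) ∧ (∀ x ∈ A, b x = bs B E) ∧
        HtpyRel (US S (κ ⊕ κ')) (relEnds A)
          (fun p => bs (linF J B p.2 + D p) (linF J E p.2)) (fun p => linF J (b p.1) p.2) := by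
  induction n with
  | zero =>
    rintro κ _ _ B hB D ⟨d, hdc, hd, hdA, e⟩ hu
    have hBL : B ∈ LI S J κ := hB.mem_left ()
    have hb : ∀ x, bs (B + d x) (0 : Mat ι Empty) ∈ LI S J (κ ⊕ Empty) := fun x =>
      bs_mem_LI (mem_LI_of_linF (add_mem hBL.1 (hd x)) fun t => by
        have := hu (x, t)
        rw [e] at this
        convert this using 1
        rw [linF, linF, smul_add, add_assoc]) (mem_LI_empty _)
    have hbc : Continuous fun x => bs (B + d x) (0 : Mat ι Empty) :=
      cont_bs (continuous_const.add hdc) continuous_const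
    refine ⟨Empty, inferInstance, inferInstance, 0, fun x => bs (B + d x) 0, ?_, hbc, hb,
      fun x hx => by beta_reduce; rw [hdA x hx, add_zero], ?_⟩
    · rw [Subsingleton.elim (scalar Empty j) (0 : Mat ι Empty)]
      exact HtpyRel.refl continuous_const fun _ => mem_LI_empty _
    · refine (HtpyRel.refl (cont_linF J (hbc.comp continuous_fst) continuous_snd)
        fun p => linF_mem_US h.cplx.1 (hb _) _).congr (fun p => ?_) fun p => rfl
      simp only [Function.comp]
      rw [← bs_linF, e, linF, linF, linF, smul_add, add_assoc]
  | succ n ih =>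
    intro κ _ _ B hB D hD hu
    have hBL : B ∈ LI S J κ := hB.mem_left ()
    obtain ⟨D', hD', hu', hH⟩ := h.lower (B := fun _ => B) continuous_const (fun _ => hBL.1) hD hu
    obtain ⟨κ', _, _, E, b, hE, hbc, hb, hbA, hK⟩ := ih (Fin 3 × κ) (linM w J B)
      (h.path_linM hB) D' hD' hu'
    have hEL : E ∈ LI S J κ' := hE.mem_left ()
    refine ⟨(Fin 3 × κ) ⊕ κ', inferInstance, inferInstance, bs (linM w J B) E,
      fun x => bs B (b x), ?_, cont_bs continuous_const hbc, fun x => bs_mem_LI hBL (hb x),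
      fun x hx => by beta_reduce; rw [hbA x hx], ?_⟩
    · exact ((h.path_linM hB).bs_LI hE).congr (fun _ => rfl) fun _ => (bs_scalar j).symm
    · have c1 : ∀ {κ : Type} [Fintype κ] [DecidableEq κ] {C : Mat ι κ}, C ∈ LI S J κ →
          HtpyRel (US S κ) (relEnds A) (fun p : X × I => linF J C p.2) fun p => linF J C p.2 :=
        fun hC => HtpyRel.refl (cont_linF J continuous_const continuous_snd)
          fun p => linF_mem_US h.cplx.1 hC _
      have k1 := ((hH fun _ => hBL).bs_US (c1 hEL)).ri_US (Equiv.sumAssoc κ (Fin 3 × κ) κ')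
      have k2 := (c1 hBL).bs_US hK
      simp only [ri_assoc] at k1
      refine (k1.trans k2).congr (fun p => ?_) fun p => ?_
      · rw [bs_linF]
      · rw [bs_linF]

theorem mem_insert_iff {x : Mat ι κ} :
    x ∈ US (insert J S) κ ↔ x ∈ US S κ ∧ x * scalar κ J = -(scalar κ J * x) := by
  simp only [USkew, mem_ofPred_eq, mem_skewAnti, image_insert_eq, forall_mem_insert]
  tauto

/-- **Surjectivity**: stably every family of paths is a family of half circles. -/
theorem surj (h : StepData S J j w) {n : ℕ} {F : (Fin n → I) × I → Mat ι κ} (hFc : Continuous F)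
    (hF : ∀ p, F p ∈ US S κ)
    (hFA : ∀ p ∈ relEnds (Cube.boundary (Fin n)), F p = linF J (scalar κ j) p.2) :
    ∃ (κ' : Type) (_ : Fintype κ') (_ : DecidableEq κ') (b : (Fin n → I) → Mat ι (κ ⊕ κ')),
      Continuous b ∧ (∀ x, b x ∈ US (insert J S) (κ ⊕ κ')) ∧
      (∀ x ∈ Cube.boundary (Fin n), b x = scalar (κ ⊕ κ') j) ∧
      HtpyRel (US S (κ ⊕ κ')) (relEnds (Cube.boundary (Fin n)))
        (fun p => bs (F p) (linF J (scalar κ' j) p.2)) (fun p => linF J (b p.1) p.2) := by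
  have hlc : Continuous fun p : (Fin n → I) × I => linF J (scalar κ j) p.2 :=
    cont_linF J continuous_const continuous_snd
  have hsub : ∀ p, linF J (scalar κ j) p.2 + (F p - linF J (scalar κ j) p.2) = F p :=
    fun p => by abel
  have hls : ∀ p : (Fin n → I) × I, linF J (scalar κ j) p.2 ∈ SK S κ := fun p =>
    linF_mem_SK h.cplx.1 h.sj_mem _
  obtain ⟨N, D, hD, hu⟩ := Mat.exists_deg_approx (V := SK S κ) (A := Cube.boundary (Fin n))
    (F := fun p => linF J (scalar κ j) p.2)
    (D := fun p => F p - linF J (scalar κ j) p.2) hlc (hFc.sub hlc)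
    (fun p => sub_mem (hF p).1 (hls p)) (fun p hp => by rw [hFA p hp, sub_self])
    (fun p => by rw [hsub]; exact (hF p).2)
  have H1 : HtpyRel (US S κ) (relEnds (Cube.boundary (Fin n))) F
      (fun p => linF J (scalar κ j) p.2 + D p) := by
    refine HtpyRel.of_real 1 zero_le_one (fun τ p => linF J (scalar κ j) p.2 +
      ((1 - τ) • (F p - linF J (scalar κ j) p.2) + τ • D p)) ?_ (fun τ hτ p => ⟨?_, hu p τ hτ⟩)
      (fun p => ?_) (fun p => ?_) fun τ _ p hp => ?_
    · have hDc := hD.continuous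
      have c1 : Continuous fun p : ℝ × ((Fin n → I) × I) => linF J (scalar κ j) p.2.2 :=
        cont_linF J continuous_const (by fun_prop)
      exact c1.add (((continuous_const.sub continuous_fst).smul
        ((hFc.comp continuous_snd).sub c1)).add
        (continuous_fst.smul (hDc.comp continuous_snd)))
    · exact add_mem (hls p) (add_mem (Submodule.smul_mem _ _ (sub_mem (hF p).1 (hls p)))
        (Submodule.smul_mem _ _ (hD.mem p)))
    · simp
    · simp
    · rw [hFA p hp, hD.eq_zero hp]; simp
  obtain ⟨κ', _, _, E, b, hE, hbc, hb, hbA, hK⟩ := h.lift_deg N κ (scalar κ j)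
    (HtpyRel.refl continuous_const fun _ => h.sj_mem_LI) D hD
    fun p => by simpa using hu p 1 (by norm_num)
  have hEL : E ∈ LI S J κ' := hE.mem_left ()
  have R : HtpyRel (US S (κ ⊕ κ')) (relEnds (Cube.boundary (Fin n)))
      (fun p => bs (F p) (linF J E p.2)) (fun p => linF J (b p.1) p.2) :=
    (H1.bs_US (HtpyRel.refl (cont_linF J continuous_const continuous_snd)
      fun p => linF_mem_US h.cplx.1 hEL _)).trans hK
  obtain ⟨e, hec, heY, he0, he1, -⟩ := hE
  obtain ⟨H, hHc, hHY, hH0, hHA⟩ := cube_hep hbc hb (fun q => bs (scalar κ j) (e (q.1, ())))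
    (by exact cont_bs continuous_const (by fun_prop)) (fun q => bs_mem_LI h.sj_mem_LI (heY _))
    fun y hy => by rw [hbA y hy, he0]
  have R' := HtpyRel.transfer_prod (Y := US S (κ ⊕ κ'))
    (H := fun q : I × ((Fin n → I) × I) => bs (F q.2) (linF J (e (q.1, ())) q.2.2))
    (K := fun q => linF J (H (q.1, q.2.1)) q.2.2)
    (cont_bs (by fun_prop) (cont_linF J (by fun_prop) (by fun_prop)))
    (cont_linF J (by fun_prop) (by fun_prop))
    (fun q => bs_mem_US (hF _) (linF_mem_US h.cplx.1 (heY _) _))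
    (fun q => linF_mem_US h.cplx.1 (hHY _) _)
    (fun t p hp => by
      simp only [hFA p hp, bs_linF]
      rcases hp with hp | hp
      · rw [hHA t _ hp]
      · exact linF_ends _ _ hp)
    (R.congr (fun p => by simp only [he0]) fun p => by simp only [hH0])
  have hH1A : ∀ x ∈ Cube.boundary (Fin n), H (1, x) = scalar (κ ⊕ κ') j := fun x hx => by
    rw [hHA 1 x hx, he1, bs_scalar]
  obtain ⟨G, hGc, hGY, hG0, hG1, -, hG3⟩ := Mat.lin_retract (h.cplx.scalar (m := κ ⊕ κ'))
    (B := fun x => H (1, x)) (by fun_prop) (fun x => hHY _)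
  have hGA : ∀ t, ∀ x ∈ Cube.boundary (Fin n), G (t, x) = scalar (κ ⊕ κ') j := fun t x hx => by
    rw [hG3 x (by rw [hH1A x hx]; exact scalar_anti h.j_J)
      (by rw [hH1A x hx, ← map_mul, h.j_sq, map_neg, map_one]) t, hH1A x hx]
  refine ⟨κ', inferInstance, inferInstance, fun x => G (1, x), by fun_prop,
    fun x => mem_insert_iff.2 ⟨⟨(hGY _).1, Lin.isUnit (hGY _)⟩, hG1 x⟩, hGA 1, ?_⟩
  refine (R'.trans ?_).congr (fun p => by simp only [he1]) fun p => rfl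
  refine ⟨fun q => linF J (G (q.1, q.2.1)) q.2.2, cont_linF J (by fun_prop) (by fun_prop),
    fun q => linF_mem_US h.cplx.1 (hGY _) _, fun p => by simp only [hG0], fun p => rfl,
    fun t p hp => ?_⟩
  rcases hp with hp | hp
  · simp only [hGA t p.1 hp, hH1A p.1 hp]
  · exact linF_ends _ _ hp

end StepData

end Bott

open scoped Topology

namespace Bott

open unitInterval Set Matrix

section Concat

variable {X E : Type*} [TopologicalSpace X] [TopologicalSpace E]

/-- Concatenation of two homotopies. -/
noncomputable def cat (H K : I × X → E) (p : I × X) : E :=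
  if (p.1 : ℝ) ≤ 1 / 2 then H (projIcc 0 1 zero_le_one (2 * p.1), p.2)
    else K (projIcc 0 1 zero_le_one (2 * p.1 - 1), p.2)

variable {H K : I × X → E}

theorem continuous_cat (hH : Continuous H) (hK : Continuous K) (e : ∀ x, H (1, x) = K (0, x)) :
    Continuous (cat H K) := by
  unfold cat
  refine Continuous.if_le ?_ ?_ (by fun_prop) (by fun_prop) ?_
  · exact hH.comp ((continuous_projIcc.comp (by fun_prop)).prodMk continuous_snd)
  · exact hK.comp ((continuous_projIcc.comp (by fun_prop)).prodMk continuous_snd)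
  · intro p hp
    rw [hp]; norm_num [e]

theorem cat_mem {Y : Set E} (hH : ∀ p, H p ∈ Y) (hK : ∀ p, K p ∈ Y) (p : I × X) :
    cat H K p ∈ Y := by
  unfold cat; split_ifs
  · exact hH _
  · exact hK _

theorem cat_zero (x : X) : cat H K (0, x) = H (0, x) := by simp [cat]

theorem cat_one (x : X) : cat H K (1, x) = K (1, x) := by
  unfold cat; norm_num

theorem cat_eq {H' K' : I × X → E} {x : X} (hH : ∀ t, H (t, x) = H' (t, x))
    (hK : ∀ t, K (t, x) = K' (t, x)) (t : I) : cat H K (t, x) = cat H' K' (t, x) := by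
  simp only [cat, hH, hK]

end Concat

variable {ι κ κ' κ'' : Type} [Fintype ι] [DecidableEq ι] [Fintype κ] [DecidableEq κ] [Fintype κ']
  [DecidableEq κ'] [Fintype κ''] [DecidableEq κ'']
variable {S : Set (Matrix ι ι ℝ)} {J j w : Matrix ι ι ℝ}

/-- The splitting of three blocks as one block and two blocks. -/
def splitThree (κ : Type*) : Fin 3 × κ ≃ κ ⊕ Fin 2 × κ where
  toFun p := Fin.cases (motive := fun _ => κ ⊕ Fin 2 × κ) (Sum.inl p.2) (fun i => Sum.inr (i, p.2)) p.1
  invFun q := q.elim (fun k => (0, k)) fun p => (p.1.succ, p.2)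
  left_inv := by
    rintro ⟨i, k⟩
    refine Fin.cases ?_ (fun i => ?_) i <;> rfl
  right_inv := by rintro (k | ⟨i, k⟩) <;> rfl

theorem ri_d3 (g : Mat ι κ) : ri (splitThree κ) (d3 j g) = bs g (scalar (Fin 2 × κ) j) := by
  have e : (scalar (Fin 2 × κ) j : Mat ι (Fin 2 × κ)) =
      compAlgEquiv (Fin 2) κ (Matrix ι ι ℝ) ℝ !![scalar κ j, 0; 0, scalar κ j] := by
    rw [← comp_scalar_scalar]
    congr 1
    ext1 i k
    fin_cases i <;> fin_cases k <;> rfl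
  rw [e]
  ext1 (i | ⟨i, k⟩) (l | ⟨l, m⟩)
  · rfl
  · fin_cases l <;> rfl
  · fin_cases i <;> rfl
  · fin_cases i <;> fin_cases l <;> rfl

theorem ri_bs (e : κ ≃ κ'') (x : Mat ι κ) (y : Mat ι κ') :
    ri (Equiv.sumCongr e (Equiv.refl κ')) (bs x y) = bs (ri e x) y := by
  ext1 (i | i) (k | k) <;> rfl

namespace StepData


/-- A canonical path from `linM w J g` to `diag(g, j, j)`, depending on `g` only. -/
theorem exists_path (h : StepData S J j w) (κ : Type) [Fintype κ] [DecidableEq κ] :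
    ∃ P : I × US (insert J S) κ → Mat ι (Fin 3 × κ), Continuous P ∧
      (∀ q, P q ∈ LI S J (Fin 3 × κ)) ∧ (∀ g, P (0, g) = linM w J g.1) ∧
      ∀ g, P (1, g) = d3 j g.1 := by
  obtain ⟨P, h1, h2, h3, h4, -⟩ := h.htpyRel_linM (X := US (insert J S) κ) (g := fun g => g.1)
    continuous_subtype_val (fun g => (mem_insert_iff.1 g.2).1) fun g => (mem_insert_iff.1 g.2).2
  exact ⟨P, h1, h2, h3, h4⟩

theorem compress_deg (h : StepData S J j w) {m : ℕ} (n : ℕ) :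
    ∀ (κ : Type) [Fintype κ] [DecidableEq κ] (B : I × (Fin m → I) → Mat ι κ) (_ : Continuous B)
      (_ : ∀ q, B q ∈ SK S κ)
      (_ : ∀ t, ∀ x ∈ Cube.boundary (Fin m), B (t, x) = B (0, x))
      (D : (I × (Fin m → I)) × I → Mat ι κ)
      (_ : Deg (SK S κ) {q | q.1 = 0 ∨ q.1 = 1 ∨ q.2 ∈ Cube.boundary (Fin m)} n D)
      (_ : ∀ p : (I × (Fin m → I)) × I, IsUnit (linF J (B p.1) p.2 + D p))
      (g₀ g₁ : (Fin m → I) → Mat ι κ) (_ : Continuous g₀) (_ : Continuous g₁)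
      (_ : ∀ x, g₀ x ∈ US (insert J S) κ) (_ : ∀ x, g₁ x ∈ US (insert J S) κ)
      (K₀ K₁ : I × (Fin m → I) → Mat ι κ) (_ : Continuous K₀) (_ : Continuous K₁)
      (_ : ∀ q, K₀ q ∈ LI S J κ) (_ : ∀ q, K₁ q ∈ LI S J κ)
      (_ : ∀ x, K₀ (0, x) = B (0, x)) (_ : ∀ x, K₁ (0, x) = B (1, x))
      (_ : ∀ x, K₀ (1, x) = g₀ x) (_ : ∀ x, K₁ (1, x) = g₁ x)
      (_ : ∀ t, ∀ x ∈ Cube.boundary (Fin m), K₀ (t, x) = K₁ (t, x)),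
      ∃ (κ' : Type) (_ : Fintype κ') (_ : DecidableEq κ'),
        HtpyRel (LI S J (κ ⊕ κ')) (Cube.boundary (Fin m)) (fun x => bs (g₀ x) (scalar κ' j))
          (fun x => bs (g₁ x) (scalar κ' j)) := by
  induction n with
  | zero =>
    rintro κ _ _ B hBc hB hBA D ⟨d, hdc, hd, hdA, e⟩ hu g₀ g₁ hg₀c hg₁c hg₀ hg₁ K₀ K₁ hK₀c hK₁c
      hK₀ hK₁ h00 h10 h01 h11 hKK
    have hb : ∀ q, B q + d q ∈ LI S J κ := fun q =>
      mem_LI_of_linF (add_mem (hB q) (hd q)) fun t => by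
        have := hu (q, t)
        rw [e] at this
        convert this using 1
        rw [linF, linF, smul_add, add_assoc]
    have R : HtpyRel (LI S J κ) (Cube.boundary (Fin m)) (fun x => K₀ (0, x))
        (fun x => K₁ (0, x)) := by
      refine ⟨fun q => B q + d q, hBc.add hdc, hb, fun x => ?_, fun x => ?_, fun t x hx => ?_⟩
      · beta_reduce; rw [hdA _ (Or.inl rfl), add_zero, h00]
      · beta_reduce; rw [hdA _ (Or.inr (Or.inl rfl)), add_zero, h10]
      · beta_reduce; rw [hdA _ (Or.inr (Or.inr hx)), add_zero, hBA t x hx, h00]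
    have R' := (HtpyRel.transfer hK₀c hK₁c hK₀ hK₁ hKK R).congr (fun x => (h01 x).symm)
      fun x => (h11 x).symm
    refine ⟨Empty, inferInstance, inferInstance, R'.bs_LI ?_⟩
    exact HtpyRel.refl continuous_const fun _ => h.sj_mem_LI
  | succ n ih =>
    intro κ _ _ B hBc hB hBA D hD hu g₀ g₁ hg₀c hg₁c hg₀ hg₁ K₀ K₁ hK₀c hK₁c
      hK₀ hK₁ h00 h10 h01 h11 hKK
    obtain ⟨D', hD', hu', -⟩ := h.lower hBc hB hD hu
    obtain ⟨P, hPc, hP, hP0, hP1⟩ := h.exists_path κ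
    have hlc := continuous_linM (ι := ι) (κ := κ) (w := w) (J := J)
    have d3c : ∀ g : (Fin m → I) → Mat ι κ, Continuous g → (∀ x, g x ∈ US (insert J S) κ) →
        Continuous (fun x => d3 j (g x)) ∧ ∀ x, d3 j (g x) ∈ US (insert J S) (Fin 3 × κ) :=
      fun g hgc hg => by
        have e : ∀ x, d3 j (g x) = ri (splitThree κ).symm (bs (g x) (scalar (Fin 2 × κ) j)) :=
          fun x => by
          rw [← ri_d3]
          ext1 i k
          simp [ri, reindexAlgEquiv_apply]
        refine ⟨?_, fun x => ?_⟩
        · simp only [e]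
          exact (continuous_ri _).comp (cont_bs hgc continuous_const)
        · rw [e, ri_mem_US]
          exact bs_mem_US (hg x) (mem_insert_iff.2 ⟨h.sj_mem_US, scalar_anti h.j_J⟩)
    have cK : ∀ (K : I × (Fin m → I) → Mat ι κ) (g : (Fin m → I) → Mat ι κ)
        (hg : ∀ x, g x ∈ US (insert J S) κ), Continuous K → Continuous g →
        (∀ q, K q ∈ LI S J κ) → (∀ x, K (1, x) = g x) →
        Continuous (cat (fun q => linM w J (K q)) fun q => P (q.1, ⟨g q.2, hg q.2⟩)) ∧
        (∀ q, cat (fun q => linM w J (K q)) (fun q => P (q.1, ⟨g q.2, hg q.2⟩)) q ∈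
          LI S J (Fin 3 × κ)) := fun K g hg hKc hgc hK h1 =>
      ⟨continuous_cat (hlc.comp hKc) (by fun_prop) fun x => by rw [hP0, h1],
        cat_mem (fun q => h.linM_mem_LI (hK q)) fun q => hP _⟩
    obtain ⟨κ', _, _, R⟩ := ih (Fin 3 × κ) (fun q => linM w J (B q)) (hlc.comp hBc)
      (fun q => h.linM_mem (hB q)) (fun t x hx => by simp only [hBA t x hx]) D' hD' hu'
      (fun x => d3 j (g₀ x)) (fun x => d3 j (g₁ x)) (d3c g₀ hg₀c hg₀).1 (d3c g₁ hg₁c hg₁).1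
      (d3c g₀ hg₀c hg₀).2 (d3c g₁ hg₁c hg₁).2 _ _ (cK K₀ g₀ hg₀ hK₀c hg₀c hK₀ h01).1
      (cK K₁ g₁ hg₁ hK₁c hg₁c hK₁ h11).1 (cK K₀ g₀ hg₀ hK₀c hg₀c hK₀ h01).2
      (cK K₁ g₁ hg₁ hK₁c hg₁c hK₁ h11).2 (fun x => by rw [cat_zero, h00])
      (fun x => by rw [cat_zero, h10]) (fun x => by rw [cat_one, hP1]) (fun x => by rw [cat_one, hP1])
      fun t x hx => by
        have e : g₀ x = g₁ x := by rw [← h01, ← h11, hKK 1 x hx]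
        refine cat_eq (fun t => by simp only [hKK t x hx]) (fun t => by simp only [e]) t
    refine ⟨(Fin 2 × κ) ⊕ κ', inferInstance, inferInstance, ?_⟩
    have R' := (R.ri_LI (Equiv.sumCongr (splitThree κ) (Equiv.refl κ'))).ri_LI (Equiv.sumAssoc _ _ _)
    simpa only [ri_bs, ri_d3, ri_assoc, bs_scalar] using R'

/-- **Injectivity**: homotopic families of half circles are stably homotopic. -/
theorem inj (h : StepData S J j w) {m : ℕ} {f₀ f₁ : (Fin m → I) → Mat ι κ} (hf₀c : Continuous f₀) (hf₁c : Continuous f₁)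
    (hf₀ : ∀ x, f₀ x ∈ US (insert J S) κ) (hf₁ : ∀ x, f₁ x ∈ US (insert J S) κ)
    (hf₀A : ∀ x ∈ Cube.boundary (Fin m), f₀ x = scalar κ j)
    (hf₁A : ∀ x ∈ Cube.boundary (Fin m), f₁ x = scalar κ j)
    (R : HtpyRel (US S κ) (relEnds (Cube.boundary (Fin m))) (fun p => linF J (f₀ p.1) p.2)
      (fun p => linF J (f₁ p.1) p.2)) :
    ∃ (κ' : Type) (_ : Fintype κ') (_ : DecidableEq κ'),
      HtpyRel (US (insert J S) (κ ⊕ κ')) (Cube.boundary (Fin m))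
        (fun x => bs (f₀ x) (scalar κ' j)) (fun x => bs (f₁ x) (scalar κ' j)) := by
  obtain ⟨H, hHc, hH, hH0, hH1, hHA⟩ := R
  have hT : ∀ x : Mat ι κ, x ∈ US (insert J S) κ → x ∈ LI S J κ := fun x hx =>
    mem_LI_of_anti h.cplx (mem_insert_iff.1 hx).1.1 (mem_insert_iff.1 hx).2 (mem_insert_iff.1 hx).1.2
  set B : I × (Fin m → I) → Mat ι κ := fun q => (1 - (q.1 : ℝ)) • f₀ q.2 + (q.1 : ℝ) • f₁ q.2 with hBd
  have hBc : Continuous B := by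
    have : Continuous fun q : I × (Fin m → I) => (q.1 : ℝ) := by fun_prop
    exact ((continuous_const.sub this).smul (hf₀c.comp continuous_snd)).add
      (this.smul (hf₁c.comp continuous_snd))
  have hB : ∀ q, B q ∈ SK S κ := fun q => add_mem (Submodule.smul_mem _ _ (hT _ (hf₀ _)).1)
    (Submodule.smul_mem _ _ (hT _ (hf₁ _)).1)
  have hB0 : ∀ x, B (0, x) = f₀ x := fun x => by simp [hBd]
  have hB1 : ∀ x, B (1, x) = f₁ x := fun x => by simp [hBd]
  have hBA : ∀ t, ∀ x ∈ Cube.boundary (Fin m), B (t, x) = f₀ x := fun t x hx => by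
    simp only [hBd, hf₁A x hx, hf₀A x hx]
    module
  have hlc : Continuous fun p : (I × (Fin m → I)) × I => linF J (B p.1) p.2 :=
    cont_linF J (hBc.comp continuous_fst) continuous_snd
  have hFc : Continuous fun p : (I × (Fin m → I)) × I => H (p.1.1, (p.1.2, p.2)) :=
    hHc.comp (by fun_prop)
  obtain ⟨N, D, hD, hu⟩ := Mat.exists_deg_approx (V := SK S κ)
    (A := {q | q.1 = 0 ∨ q.1 = 1 ∨ q.2 ∈ Cube.boundary (Fin m)})
    (F := fun p : (I × (Fin m → I)) × I => linF J (B p.1) p.2)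
    (D := fun p => H (p.1.1, (p.1.2, p.2)) - linF J (B p.1) p.2) hlc (hFc.sub hlc)
    (fun p => sub_mem (hH _).1 (linF_mem_SK h.cplx.1 (hB _) _)) (fun p hp => by
      rw [sub_eq_zero]
      obtain ⟨⟨τ, x⟩, t⟩ := p
      rcases hp with (hp | hp | hp) | hp
      · simp only at hp; subst hp; rw [hH0, hB0]
      · simp only at hp; subst hp; rw [hH1, hB1]
      · rw [hHA _ _ (Or.inl hp), hBA _ _ hp]
      · rw [hHA _ _ (Or.inr hp)]; exact linF_ends _ _ hp)
    (fun p => by rw [add_sub_cancel]; exact (hH _).2)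
  obtain ⟨κ', _, _, G, hGc, hG, hG0, hG1, hGA⟩ := h.compress_deg N κ B hBc hB
    (fun t x hx => by rw [hBA t x hx, hB0]) D hD
    (fun p => by simpa using hu p 1 (by norm_num)) f₀ f₁ hf₀c hf₁c hf₀ hf₁ (fun q => f₀ q.2)
    (fun q => f₁ q.2) (by fun_prop) (by fun_prop) (fun q => hT _ (hf₀ _)) (fun q => hT _ (hf₁ _))
    (fun x => (hB0 x).symm) (fun x => (hB1 x).symm) (fun x => rfl) (fun x => rfl)
    (fun t x hx => by simp only [hf₀A x hx, hf₁A x hx])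
  refine ⟨κ', inferInstance, inferInstance, ?_⟩
  obtain ⟨L, hLc, hL, hL0, hL1, hL2, hL3⟩ := Mat.lin_retract (h.cplx.scalar (m := κ ⊕ κ')) hGc hG
  have hGj : ∀ t, ∀ x ∈ Cube.boundary (Fin m), G (t, x) = scalar (κ ⊕ κ') j := fun t x hx => by
    rw [hGA t x hx]; beta_reduce; rw [hf₀A x hx, bs_scalar]
  have hLj : ∀ s t, ∀ x ∈ Cube.boundary (Fin m), L (s, (t, x)) = scalar (κ ⊕ κ') j :=
    fun s t x hx => by
      rw [hL3 _ (by rw [hGj t x hx]; exact scalar_anti h.j_J)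
        (by rw [hGj t x hx, ← map_mul, h.j_sq, map_neg, map_one]) s, hGj t x hx]
  have hbsT : ∀ f : (Fin m → I) → Mat ι κ, (∀ x, f x ∈ US (insert J S) κ) →
      ∀ x, bs (f x) (scalar κ' j) ∈ US (insert J S) (κ ⊕ κ') := fun f hf x =>
    bs_mem_US (hf x) (mem_insert_iff.2 ⟨h.sj_mem_US, scalar_anti h.j_J⟩)
  have end_ : ∀ (t : I) (f : (Fin m → I) → Mat ι κ), (∀ x, f x ∈ US (insert J S) κ) →
      (∀ x, G (t, x) = bs (f x) (scalar κ' j)) →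
      HtpyRel (US (insert J S) (κ ⊕ κ')) (Cube.boundary (Fin m))
        (fun x => bs (f x) (scalar κ' j)) (fun x => L (1, (t, x))) := fun t f hf hGt =>
    ⟨fun q => L (q.1, (t, q.2)), by fun_prop, fun q => mem_insert_iff.2
      ⟨⟨(hL _).1, Lin.isUnit (hL _)⟩, hL2 _ (by
        rw [hGt]; exact (mem_insert_iff.1 (hbsT f hf _)).2) _⟩,
      fun x => by simp only [hL0, hGt], fun x => rfl,
      fun s x hx => by simp only [hLj s t x hx, ← hGt, hGj t x hx]⟩
  refine ((end_ 0 f₀ hf₀ hG0).trans ?_).trans (end_ 1 f₁ hf₁ hG1).symm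
  exact ⟨fun q => L (1, q), by fun_prop, fun q => mem_insert_iff.2
    ⟨⟨(hL _).1, Lin.isUnit (hL _)⟩, hL1 _⟩, fun x => rfl, fun x => rfl,
    fun t x hx => by simp only [hLj _ _ x hx]⟩

end StepData

end Bott

open scoped Topology

namespace Bott

open unitInterval Set Matrix

section Loops

variable {E : Type*} [TopologicalSpace E] {Y : Set E} {e : E} {n : ℕ}

/-- Loops, parametrized by a cube, in a subset of a space. -/
structure IsLoop (Y : Set E) (e : E) (f : (Fin n → I) → E) : Prop where
  cont : Continuous f
  mem : ∀ x, f x ∈ Y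
  bdry : ∀ x ∈ Cube.boundary (Fin n), f x = e

/-- Concatenation of functions on a cube in the direction `i`. -/
noncomputable def tr (i : Fin n) (f g : (Fin n → I) → E) (t : Fin n → I) : E :=
  if (t i : ℝ) ≤ 1 / 2 then f (Function.update t i (projIcc 0 1 zero_le_one (2 * t i)))
    else g (Function.update t i (projIcc 0 1 zero_le_one (2 * t i - 1)))

theorem tr_comp {E' : Type*} (φ : E → E') (i : Fin n) (f g : (Fin n → I) → E) :
    (fun x => φ (tr i f g x)) = tr i (fun x => φ (f x)) fun x => φ (g x) := by
  funext x
  unfold tr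
  split_ifs <;> rfl

end Loops

variable {ι κ κ' κ'' : Type} [Fintype ι] [DecidableEq ι] [Fintype κ] [DecidableEq κ] [Fintype κ']
  [DecidableEq κ'] [Fintype κ''] [DecidableEq κ'']
variable {S : Set (Matrix ι ι ℝ)} {J j w : Matrix ι ι ℝ}

section RotJ

/-- The rotation by half the angle in the plane spanned by `J` and `j`. -/
noncomputable def rotJ (J j : Matrix ι ι ℝ) (t : I) : Matrix ι ι ℝ :=
  Real.cos (Real.pi * t / 2) • (1 : Matrix ι ι ℝ) + Real.sin (Real.pi * t / 2) • (J * j)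

/-- The inverse of `rotJ`. -/
noncomputable def rotJ' (J j : Matrix ι ι ℝ) (t : I) : Matrix ι ι ℝ :=
  Real.cos (Real.pi * t / 2) • (1 : Matrix ι ι ℝ) - Real.sin (Real.pi * t / 2) • (J * j)

theorem continuous_rotJ : Continuous (rotJ J j) := by
  refine continuous_matrix fun a b => ?_
  simp only [rotJ, Matrix.add_apply, Matrix.smul_apply]
  fun_prop

theorem continuous_rotJ' : Continuous (rotJ' J j) := by
  refine continuous_matrix fun a b => ?_
  simp only [rotJ', Matrix.sub_apply, Matrix.smul_apply]
  fun_prop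

/-- Conjugation by `rotJ`. -/
noncomputable def cj (J j : Matrix ι ι ℝ) (t : I) (x : Mat ι κ) : Mat ι κ :=
  scalar κ (rotJ' J j t) * x * scalar κ (rotJ J j t)

/-- The inverse of `cj`. -/
noncomputable def cj' (J j : Matrix ι ι ℝ) (t : I) (x : Mat ι κ) : Mat ι κ :=
  scalar κ (rotJ J j t) * x * scalar κ (rotJ' J j t)

end RotJ

namespace StepData


theorem Jj_sq (h : StepData S J j w) : (J * j) * (J * j) = -1 := by
  rw [mul_assoc, ← mul_assoc j, h.j_J, neg_mul, mul_neg, mul_assoc J j j, h.j_sq, mul_neg, mul_one,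
    mul_neg, neg_neg, h.cplx.2]

theorem star_rotJ (h : StepData S J j w) (t : I) : star (rotJ J j t) = rotJ' J j t := by
  have hJ : star J = -J := h.cplx.1.1
  have hj : star j = -j := h.j_mem.1
  rw [rotJ, rotJ', star_add, star_smul, star_smul, star_mul, hJ, hj, neg_mul_neg, h.j_J, star_one]
  simp only [star_trivial, smul_neg, sub_eq_add_neg]

theorem rotJ_mul_rotJ' (h : StepData S J j w) (t : I) : rotJ J j t * rotJ' J j t = 1 := by
  have := Real.cos_sq_add_sin_sq (Real.pi * t / 2)
  simp only [rotJ, rotJ', add_mul, mul_sub, smul_mul_smul_comm, one_mul, mul_one, h.Jj_sq]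
  rw [← sub_eq_zero]
  have e : ∀ a b : ℝ, ∀ x : Matrix ι ι ℝ, (a * a) • (1 : Matrix ι ι ℝ) + (b * a) • x -
      ((a * b) • x + (b * b) • (-1 : Matrix ι ι ℝ)) - 1 = (a ^ 2 + b ^ 2 - 1) • 1 := by
    intro a b x; module
  rw [e, this]; simp

theorem rotJ'_mul_rotJ (h : StepData S J j w) (t : I) : rotJ' J j t * rotJ J j t = 1 :=
  mul_eq_one_comm.1 (h.rotJ_mul_rotJ' t)

theorem rotJ_conj (h : StepData S J j w) (t : I) : rotJ' J j t * (cosI t • J + sinI t • j) * rotJ J j t = J := by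
  have hc : cosI t = Real.cos (Real.pi * t / 2) ^ 2 - Real.sin (Real.pi * t / 2) ^ 2 := by
    rw [← Real.cos_two_mul', mul_div_cancel₀ _ two_ne_zero]; rfl
  have hs : sinI t = 2 * Real.sin (Real.pi * t / 2) * Real.cos (Real.pi * t / 2) := by
    rw [← Real.sin_two_mul, mul_div_cancel₀ _ two_ne_zero]; rfl
  have hcs := Real.cos_sq_add_sin_sq (Real.pi * t / 2)
  have hJ : J * J = -1 := h.cplx.2
  have hj : j * j = -1 := h.j_sq
  have h1 : J * j * J = j := by rw [mul_assoc, h.j_J, mul_neg, ← mul_assoc, hJ, neg_one_mul, neg_neg]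
  have h2 : J * j * j = -J := by rw [mul_assoc, hj, mul_neg_one]
  have h3 : J * (J * j) = -j := by rw [← mul_assoc, hJ, neg_one_mul]
  have h4 : j * (J * j) = J := by
    rw [← mul_assoc, h.j_J, neg_mul, h2, neg_neg]
  rw [hc, hs]
  simp only [rotJ, rotJ']
  generalize Real.cos (Real.pi * t / 2) = c at *
  generalize Real.sin (Real.pi * t / 2) = s at *
  simp only [sub_mul, mul_add, add_mul, smul_mul_assoc, mul_smul_comm, one_mul, mul_one, h1, h2, h3,
    h4, smul_add, smul_sub, smul_neg, neg_mul, neg_neg, smul_smul]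
  rw [← sub_eq_zero]
  trans ((c ^ 2 + s ^ 2) ^ 2 - 1) • J
  · module
  · rw [hcs]; simp

theorem rotJ_comm (h : StepData S J j w) {g : Matrix ι ι ℝ} (hg : g ∈ S) (t : I) : rotJ J j t * g = g * rotJ J j t := by
  have hJ := h.cplx.1.2 g hg
  have hj := h.j_mem.2 g hg
  have : J * j * g = g * (J * j) := by
    rw [mul_assoc, hj, mul_neg, ← mul_assoc, hJ, neg_mul, neg_neg, mul_assoc]
  simp only [rotJ, add_mul, mul_add, smul_mul_assoc, mul_smul_comm, one_mul, mul_one, this]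

end StepData

end Bott

open scoped Topology

namespace Bott

open unitInterval Set Matrix

variable {ι κ κ' κ'' : Type} [Fintype ι] [DecidableEq ι] [Fintype κ] [DecidableEq κ] [Fintype κ']
  [DecidableEq κ'] [Fintype κ''] [DecidableEq κ'']
variable {S : Set (Matrix ι ι ℝ)} {J j w : Matrix ι ι ℝ}

theorem continuous_scalar : Continuous (scalar κ : Matrix ι ι ℝ → Mat ι κ) := by
  refine continuous_matrix fun a b => ?_
  simp only [scalar_apply, diagonal_apply]
  split_ifs
  · exact continuous_id
  · exact continuous_const

theorem cont_cj {X : Type*} [TopologicalSpace X] {t : X → I} {x : X → Mat ι κ} (ht : Continuous t)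
    (hx : Continuous x) : Continuous fun p => cj J j (t p) (x p) :=
  ((continuous_scalar.comp (continuous_rotJ'.comp ht)).matrix_mul hx).matrix_mul
    (continuous_scalar.comp (continuous_rotJ.comp ht))

theorem cont_cj' {X : Type*} [TopologicalSpace X] {t : X → I} {x : X → Mat ι κ} (ht : Continuous t)
    (hx : Continuous x) : Continuous fun p => cj' J j (t p) (x p) :=
  ((continuous_scalar.comp (continuous_rotJ.comp ht)).matrix_mul hx).matrix_mul
    (continuous_scalar.comp (continuous_rotJ'.comp ht))

theorem conj_mem_US {a b : Mat ι κ} (hab : a * b = 1) (hs : star b = a)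
    (hb : ∀ g ∈ scalar κ '' S, b * g = g * b) {x : Mat ι κ} (hx : x ∈ US S κ) :
    a * x * b ∈ US S κ := by
  have hba : b * a = 1 := mul_eq_one_comm.1 hab
  refine ⟨⟨?_, fun g hg => ?_⟩, ?_⟩
  · rw [star_mul, star_mul, hs, hx.1.1, ← hs, star_star, hs, neg_mul, mul_neg, mul_assoc]
  · have ha : a * g = g * a := by
      rw [← mul_one (a * g), ← hba, ← mul_assoc, mul_assoc a, ← hb g hg, ← mul_assoc, hab, one_mul]
    rw [mul_assoc, hb g hg, ← mul_assoc, mul_assoc a, hx.1.2 g hg, mul_neg, neg_mul, ← mul_assoc, ha]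
    simp only [mul_assoc]
  · exact (IsUnit.mul ⟨⟨a, b, hab, hba⟩, rfl⟩ hx.2).mul ⟨⟨b, a, hba, hab⟩, rfl⟩

theorem cj_bs (t : I) (x : Mat ι κ) (y : Mat ι κ') :
    cj J j t (bs x y) = bs (cj J j t x) (cj J j t y) := by
  simp only [cj, ← bs_scalar, bs, fromBlocks_multiply, Matrix.mul_zero, Matrix.zero_mul, add_zero,
    zero_add]

theorem cj_ri (e : κ ≃ κ') (t : I) (x : Mat ι κ) :
    cj J j t (ri e x) = ri e (cj J j t x) := by
  simp only [cj, ← ri_scalar e, ri, map_mul]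

/-- The loop obtained from a family of half circles. -/
noncomputable def gam (J j : Matrix ι ι ℝ) {n : ℕ} (f : (Fin n → I) → Mat ι κ)
    (y : Fin (n + 1) → I) : Mat ι κ :=
  cj J j (y 0) (linF J (f (Fin.tail y)) (y 0))

namespace StepData


theorem srot (h : StepData S J j w) (t : I) : scalar κ (rotJ J j t) * scalar κ (rotJ' J j t) = 1 := by
  rw [← map_mul, h.rotJ_mul_rotJ', map_one]

theorem srot' (h : StepData S J j w) (t : I) : scalar κ (rotJ' J j t) * scalar κ (rotJ J j t) = 1 := by
  rw [← map_mul, h.rotJ'_mul_rotJ, map_one]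

theorem cj_cj' (h : StepData S J j w) (t : I) (x : Mat ι κ) : cj J j t (cj' J j t x) = x := by
  rw [cj, cj', mul_assoc, mul_assoc _ (scalar κ (rotJ' J j t)), h.srot', mul_one, ← mul_assoc,
    h.srot', one_mul]

theorem cj'_cj (h : StepData S J j w) (t : I) (x : Mat ι κ) : cj' J j t (cj J j t x) = x := by
  rw [cj, cj', mul_assoc, mul_assoc _ (scalar κ (rotJ J j t)), h.srot, mul_one, ← mul_assoc,
    h.srot, one_mul]

theorem cj_mem (h : StepData S J j w) (t : I) {x : Mat ι κ} (hx : x ∈ US S κ) : cj J j t x ∈ US S κ :=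
  conj_mem_US (h.srot' t) (by rw [star_scalar, h.star_rotJ])
    (by rintro _ ⟨g, hg, rfl⟩; exact scalar_comm (h.rotJ_comm hg t)) hx

theorem cj'_mem (h : StepData S J j w) (t : I) {x : Mat ι κ} (hx : x ∈ US S κ) : cj' J j t x ∈ US S κ :=
  conj_mem_US (h.srot t) (by rw [star_scalar, ← h.star_rotJ, star_star])
    (by
      rintro _ ⟨g, hg, rfl⟩
      refine scalar_comm ?_
      rw [← mul_one (_ * g), ← h.rotJ_mul_rotJ' t, ← mul_assoc, mul_assoc _ g, ← h.rotJ_comm hg,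
        ← mul_assoc, h.rotJ'_mul_rotJ, one_mul]) hx

theorem cj_linF (h : StepData S J j w) (t : I) : cj J j t (linF J (scalar κ j) t) = scalar κ J := by
  have : linF J (scalar κ j) t = scalar κ (cosI t • J + sinI t • j) := by
    rw [linF, map_add]
    congr 1 <;> · ext1 a b; simp [scalar_apply, diagonal_apply]
  rw [this, cj, ← map_mul, ← map_mul, h.rotJ_conj]

theorem cj'_J (h : StepData S J j w) (t : I) : cj' J j t (scalar κ J) = linF J (scalar κ j) t := by
  rw [← h.cj_linF t, h.cj'_cj]

theorem mem_LI (h : StepData S J j w) {x : Mat ι κ} (hx : x ∈ US (insert J S) κ) : x ∈ LI S J κ :=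
  mem_LI_of_anti h.cplx (mem_insert_iff.1 hx).1.1 (mem_insert_iff.1 hx).2 (mem_insert_iff.1 hx).1.2

theorem gam_loop (h : StepData S J j w) {n : ℕ} {f : (Fin n → I) → Mat ι κ}
    (hf : IsLoop (US (insert J S) κ) (scalar κ j) f) :
    IsLoop (US S κ) (scalar κ J) (gam J j f) := by
  refine ⟨?_, fun y => h.cj_mem _ (linF_mem_US h.cplx.1 (h.mem_LI (hf.mem _)) _), fun y hy => ?_⟩
  · have h1 := continuous_tail (n := n)
    exact cont_cj (continuous_apply 0) (cont_linF J (hf.cont.comp (continuous_fst.comp h1))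
      (continuous_apply 0))
  · rw [gam]
    rcases relEnds_iff_tail.1 hy with hy | hy
    · simp only at hy
      rw [hf.bdry _ hy, h.cj_linF]
    · rw [linF_ends (f _) (scalar κ j) hy, h.cj_linF]

theorem gam_htpy (h : StepData S J j w) {n : ℕ} {f g : (Fin n → I) → Mat ι κ}
    (R : HtpyRel (US (insert J S) κ) (Cube.boundary (Fin n)) f g) :
    HtpyRel (US S κ) (Cube.boundary (Fin (n + 1))) (gam J j f) (gam J j g) := by
  obtain ⟨H, hc, hY, h0, h1, hA⟩ := R
  have ht := continuous_tail (n := n)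
  refine ⟨fun p => cj J j (p.2 0) (linF J (H (p.1, Fin.tail p.2)) (p.2 0)), ?_, fun p =>
    h.cj_mem _ (linF_mem_US h.cplx.1 (h.mem_LI (hY _)) _), fun x => ?_, fun x => ?_, fun t x hx => ?_⟩
  · have h2 : Continuous fun p : I × (Fin (n + 1) → I) => p.2 0 := by fun_prop
    exact cont_cj h2 (cont_linF J (hc.comp (continuous_fst.prodMk
      ((continuous_fst.comp ht).comp continuous_snd))) h2)
  · beta_reduce; rw [h0]; rfl
  · beta_reduce; rw [h1]; rfl
  · beta_reduce
    rw [gam]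
    rcases relEnds_iff_tail.1 hx with hx | hx
    · rw [hA t _ hx]
    · rw [linF_ends _ (f (Fin.tail x)) hx]

theorem gam_bs (h : StepData S J j w) {n : ℕ} (f : (Fin n → I) → Mat ι κ) (κ' : Type) [Fintype κ'] [DecidableEq κ'] :
    gam J j (fun x => bs (f x) (scalar κ' j)) = fun y => bs (gam J j f y) (scalar κ' J) := by
  funext y
  rw [gam, ← bs_linF, cj_bs, h.cj_linF, gam]

theorem gam_ri {n : ℕ} (f : (Fin n → I) → Mat ι κ) (e : κ ≃ κ') :
    gam J j (fun x => ri e (f x)) = fun y => ri e (gam J j f y) := by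
  funext y
  rw [gam, ← ri_linF, cj_ri, gam]

theorem gam_tr {n : ℕ} (f g : (Fin n → I) → Mat ι κ) (i : Fin n) :
    gam J j (tr i f g) = tr i.succ (gam J j f) (gam J j g) := by
  funext y
  simp only [gam, tr, Fin.tail_update_succ, Function.update_of_ne (Fin.succ_ne_zero i).symm]
  split_ifs with h1 h2 h2
  · rfl
  · exact absurd h1 h2
  · exact absurd h2 h1
  · rfl

theorem gam_inj (h : StepData S J j w) {n : ℕ} {f g : (Fin n → I) → Mat ι κ}
    (hf : IsLoop (US (insert J S) κ) (scalar κ j) f)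
    (hg : IsLoop (US (insert J S) κ) (scalar κ j) g)
    (R : HtpyRel (US S κ) (Cube.boundary (Fin (n + 1))) (gam J j f) (gam J j g)) :
    ∃ (κ' : Type) (_ : Fintype κ') (_ : DecidableEq κ'),
      HtpyRel (US (insert J S) (κ ⊕ κ')) (Cube.boundary (Fin n))
        (fun x => bs (f x) (scalar κ' j)) (fun x => bs (g x) (scalar κ' j)) := by
  refine h.inj hf.cont hg.cont hf.mem hg.mem hf.bdry hg.bdry ?_
  have R' := (R.comp (fun p : (Fin n → I) × I => (Fin.cons p.2 p.1 : Fin (n + 1) → I)) continuous_cons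
    fun p hp => relEnds_iff_cons.2 hp).map (Y' := US S κ) (fun p x => cj' J j p.2 x)
    (cont_cj' (continuous_snd.comp continuous_fst) continuous_snd) fun p x hx => h.cj'_mem _ hx
  refine R'.congr (fun p => ?_) fun p => ?_
  · beta_reduce; rw [gam, Fin.cons_zero, Fin.tail_cons, h.cj'_cj]
  · beta_reduce; rw [gam, Fin.cons_zero, Fin.tail_cons, h.cj'_cj]

theorem gam_surj (h : StepData S J j w) {n : ℕ} {a : (Fin (n + 1) → I) → Mat ι κ}
    (ha : IsLoop (US S κ) (scalar κ J) a) :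
    ∃ (κ' : Type) (_ : Fintype κ') (_ : DecidableEq κ') (b : (Fin n → I) → Mat ι (κ ⊕ κ')),
      IsLoop (US (insert J S) (κ ⊕ κ')) (scalar (κ ⊕ κ') j) b ∧
      HtpyRel (US S (κ ⊕ κ')) (Cube.boundary (Fin (n + 1)))
        (fun y => bs (a y) (scalar κ' J)) (gam J j b) := by
  obtain ⟨κ', _, _, b, hbc, hb, hbA, R⟩ := h.surj (n := n) (κ := κ)
    (F := fun p => cj' J j p.2 (a (Fin.cons p.2 p.1)))
    (cont_cj' continuous_snd (ha.cont.comp continuous_cons)) (fun p => h.cj'_mem _ (ha.mem _))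
    fun p hp => by beta_reduce; rw [ha.bdry _ (relEnds_iff_cons.2 hp), h.cj'_J]
  refine ⟨κ', inferInstance, inferInstance, b, ⟨hbc, hb, fun x hx => ?_⟩, ?_⟩
  · rw [hbA x hx]
  have R' := (R.comp (fun y : Fin (n + 1) → I => (Fin.tail y, y 0)) continuous_tail
    fun p hp => relEnds_iff_tail.1 hp).map (Y' := US S (κ ⊕ κ')) (fun y x => cj J j (y 0) x)
    (cont_cj ((continuous_apply 0).comp continuous_fst) continuous_snd) fun p x hx => h.cj_mem _ hx
  refine R'.congr (fun p => ?_) fun p => rfl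
  beta_reduce
  rw [cj_bs, h.cj_cj', h.cj_linF, Fin.cons_self_tail]

end StepData

end Bott

open scoped Topology

namespace Bott

open unitInterval Set Matrix

variable {ι κ κ' κ'' : Type} [Fintype ι] [DecidableEq ι] [Fintype κ] [DecidableEq κ] [Fintype κ']
  [DecidableEq κ'] [Fintype κ''] [DecidableEq κ'']
variable {S S' S'' : Set (Matrix ι ι ℝ)} {J j j' j'' w : Matrix ι ι ℝ} {m m' m'' : ℕ}

theorem IsLoop.bs {f : (Fin m → I) → Mat ι κ} (hf : IsLoop (US S κ) (scalar κ j) f)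
    (hj : scalar κ' j ∈ US S κ') :
    IsLoop (US S (κ ⊕ κ')) (scalar (κ ⊕ κ') j) fun x => bs (f x) (scalar κ' j) :=
  ⟨cont_bs hf.cont continuous_const, fun x => bs_mem_US (hf.mem x) hj,
    fun x hx => by rw [hf.bdry x hx, bs_scalar]⟩

theorem IsLoop.ri {f : (Fin m → I) → Mat ι κ} (hf : IsLoop (US S κ) (scalar κ j) f)
    (e : κ ≃ κ') : IsLoop (US S κ') (scalar κ' j) fun x => ri e (f x) :=
  ⟨(continuous_ri e).comp hf.cont, fun x => (ri_mem_US e).2 (hf.mem x),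
    fun x hx => by rw [hf.bdry x hx, ri_scalar]⟩

/-- A natural operation on loops of block matrices which is stably bijective up to homotopy. -/
structure StabIso (S S' : Set (Matrix ι ι ℝ)) (j j' : Matrix ι ι ℝ) (i : Fin m) (i' : Fin m') where
  /-- The operation. -/
  Γ : ∀ (κ : Type) [Fintype κ] [DecidableEq κ], ((Fin m → I) → Mat ι κ) → (Fin m' → I) → Mat ι κ
  base : ∀ (κ : Type) [Fintype κ] [DecidableEq κ], scalar κ j ∈ US S κ
  base' : ∀ (κ : Type) [Fintype κ] [DecidableEq κ], scalar κ j' ∈ US S' κ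
  loop : ∀ {κ : Type} [Fintype κ] [DecidableEq κ] {f : (Fin m → I) → Mat ι κ},
    IsLoop (US S κ) (scalar κ j) f → IsLoop (US S' κ) (scalar κ j') (Γ κ f)
  htpy : ∀ {κ : Type} [Fintype κ] [DecidableEq κ] {f g : (Fin m → I) → Mat ι κ},
    HtpyRel (US S κ) (Cube.boundary (Fin m)) f g →
      HtpyRel (US S' κ) (Cube.boundary (Fin m')) (Γ κ f) (Γ κ g)
  inj : ∀ {κ : Type} [Fintype κ] [DecidableEq κ] {f g : (Fin m → I) → Mat ι κ},
    IsLoop (US S κ) (scalar κ j) f → IsLoop (US S κ) (scalar κ j) g →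
    HtpyRel (US S' κ) (Cube.boundary (Fin m')) (Γ κ f) (Γ κ g) →
    ∃ (κ' : Type) (_ : Fintype κ') (_ : DecidableEq κ'),
      HtpyRel (US S (κ ⊕ κ')) (Cube.boundary (Fin m))
        (fun x => bs (f x) (scalar κ' j)) (fun x => bs (g x) (scalar κ' j))
  surj : ∀ {κ : Type} [Fintype κ] [DecidableEq κ] {a : (Fin m' → I) → Mat ι κ},
    IsLoop (US S' κ) (scalar κ j') a →
    ∃ (κ' : Type) (_ : Fintype κ') (_ : DecidableEq κ') (b : (Fin m → I) → Mat ι (κ ⊕ κ')),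
      IsLoop (US S (κ ⊕ κ')) (scalar (κ ⊕ κ') j) b ∧
      HtpyRel (US S' (κ ⊕ κ')) (Cube.boundary (Fin m'))
        (fun y => bs (a y) (scalar κ' j')) (Γ (κ ⊕ κ') b)
  tr_eq : ∀ (κ : Type) [Fintype κ] [DecidableEq κ] (f g : (Fin m → I) → Mat ι κ),
    Γ κ (tr i f g) = tr i' (Γ κ f) (Γ κ g)
  bs_eq : ∀ {κ : Type} (κ' : Type) [Fintype κ] [DecidableEq κ] [Fintype κ'] [DecidableEq κ']
    (f : (Fin m → I) → Mat ι κ),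
    Γ (κ ⊕ κ') (fun x => bs (f x) (scalar κ' j)) = fun y => bs (Γ κ f y) (scalar κ' j')
  ri_eq : ∀ {κ κ' : Type} [Fintype κ] [DecidableEq κ] [Fintype κ'] [DecidableEq κ']
    (f : (Fin m → I) → Mat ι κ) (e : κ ≃ κ'),
    Γ κ' (fun x => ri e (f x)) = fun y => ri e (Γ κ f y)

theorem bs_assoc_htpy {f g : (Fin m → I) → Mat ι κ} {A : Set (Fin m → I)}
    (R : HtpyRel (US S ((κ ⊕ κ') ⊕ κ'')) A
      (fun x => bs (bs (f x) (scalar κ' j)) (scalar κ'' j))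
      (fun x => bs (bs (g x) (scalar κ' j)) (scalar κ'' j))) :
    HtpyRel (US S (κ ⊕ (κ' ⊕ κ''))) A (fun x => bs (f x) (scalar (κ' ⊕ κ'') j))
      (fun x => bs (g x) (scalar (κ' ⊕ κ'') j)) := by
  have R' := R.ri_US (Equiv.sumAssoc κ κ' κ'')
  refine R'.congr (fun x => ?_) fun x => ?_ <;> rw [ri_assoc, bs_scalar]

/-- Composition of stably bijective operations. -/
def StabIso.comp {i : Fin m} {i' : Fin m'} {i'' : Fin m''} (P : StabIso S S' j j' i i')
    (Q : StabIso S' S'' j' j'' i' i'') : StabIso S S'' j j'' i i'' where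
  Γ κ _ _ f := Q.Γ κ (P.Γ κ f)
  base := P.base
  base' := Q.base'
  loop hf := Q.loop (P.loop hf)
  htpy R := Q.htpy (P.htpy R)
  inj {κ _ _ f g} hf hg R := by
    obtain ⟨κ₁, _, _, R₁⟩ := Q.inj (P.loop hf) (P.loop hg) R
    rw [← P.bs_eq, ← P.bs_eq] at R₁
    obtain ⟨κ₂, _, _, R₂⟩ := P.inj (hf.bs (P.base _)) (hg.bs (P.base _)) R₁
    exact ⟨κ₁ ⊕ κ₂, inferInstance, inferInstance, bs_assoc_htpy R₂⟩
  surj {κ _ _ a} ha := by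
    obtain ⟨κ₁, _, _, b, hb, R₁⟩ := Q.surj ha
    obtain ⟨κ₂, _, _, c, hc, R₂⟩ := P.surj hb
    have R₃ := Q.htpy R₂
    rw [Q.bs_eq] at R₃
    have R₄ := (R₁.bs_US (HtpyRel.refl (f := fun _ => scalar κ₂ j'') continuous_const
      fun _ => Q.base' κ₂)).trans R₃
    refine ⟨κ₁ ⊕ κ₂, inferInstance, inferInstance,
      fun x => ri (Equiv.sumAssoc κ κ₁ κ₂) (c x), hc.ri _, ?_⟩
    have R₅ := R₄.ri_US (Equiv.sumAssoc κ κ₁ κ₂)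
    rw [P.ri_eq, Q.ri_eq]
    exact R₅.congr (fun x => by rw [ri_assoc, bs_scalar]) fun x => rfl
  tr_eq κ _ _ f g := by rw [P.tr_eq, Q.tr_eq]
  bs_eq κ' _ _ _ _ f := by rw [P.bs_eq, Q.bs_eq]
  ri_eq f e := by rw [P.ri_eq, Q.ri_eq]

/-- One step of the periodicity. -/
noncomputable def StepData.stabIso (h : StepData S J j w) (i : Fin m) :
    StabIso (insert J S) S j J i i.succ where
  Γ κ _ _ f := gam J j f
  base κ _ _ := mem_insert_iff.2 ⟨h.sj_mem_US, scalar_anti h.j_J⟩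
  base' κ _ _ := ⟨scalar_mem_skewAnti h.cplx.1, by
    simpa [linF] using (linF_mem_US (κ := κ) h.cplx.1 h.sj_mem_LI 0).2⟩
  loop hf := h.gam_loop hf
  htpy R := h.gam_htpy R
  inj hf hg R := h.gam_inj hf hg R
  surj ha := h.gam_surj ha
  tr_eq κ _ _ f g := gam_tr f g i
  bs_eq κ' _ _ _ _ f := h.gam_bs f κ'
  ri_eq f e := gam_ri f e

end Bott

open scoped Topology

namespace Bott

open unitInterval Set Matrix

section Octonion

/-- The exponents of the sign changes in the generators `ugen`. -/
def uexp (i : Fin 7) : ℕ := if i.1 = 0 then 1 else if i.1 = 1 then 3 else if i.1 = 2 then 6 else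
  if i.1 = 3 then 7 else if i.1 = 4 then 4 else if i.1 = 5 then 5 else 2

/-- The signs `±1` given by the parity of the number of common binary digits. -/
def bitSign (b c : ℕ) : ℤ :=
  if ((Nat.land b c) % 2 + (Nat.land b c) / 2 % 2 + (Nat.land b c) / 4 % 2) % 2 = 0 then 1 else -1

/-- Seven anticommuting skew signed permutation matrices of size eight. -/
def ugen (i : Fin 7) : Matrix (Fin 8) (Fin 8) ℤ :=
  of fun r c => if r.1 = Nat.xor c.1 (i.1 + 1) then bitSign (uexp i) c.1 else 0

theorem ugen_sq (i : Fin 7) : ugen i * ugen i = -1 := by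
  revert i; decide +kernel

theorem ugen_anti (i k : Fin 7) (h : i ≠ k) : ugen i * ugen k = -(ugen k * ugen i) := by
  revert i k; decide +kernel

theorem ugen_star (i : Fin 7) : (ugen i)ᵀ = -ugen i := by
  revert i; decide +kernel

/-- The diagonal products of the generators. -/
def udiag : Fin 3 → Matrix (Fin 8) (Fin 8) ℤ :=
  ![ugen 0 * ugen 1 * ugen 2, ugen 0 * ugen 3 * ugen 4, ugen 1 * ugen 3 * ugen 5]

theorem udiag_diag (l : Fin 3) (a b : Fin 8) (h : a ≠ b) : udiag l a b = 0 := by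
  have : ∀ l : Fin 3, udiag l = diagonal fun a => udiag l a a := by decide +kernel
  rw [this l, diagonal_apply_ne _ h]

theorem udiag_sep (a b : Fin 8) (h : a ≠ b) : ∃ l, udiag l a a ≠ udiag l b b := by
  revert a b; decide +kernel

theorem ugen_zero (a : Fin 8) (h : a ≠ 0) : ∃ i, ugen i a 0 ≠ 0 := by
  revert a; decide +kernel

theorem ugen_prod : ∃ c : ℤ, c * c = 1 ∧
    ugen 0 * ugen 1 * ugen 2 * ugen 3 * ugen 4 * ugen 5 * ugen 6 = c • 1 := by
  have : ugen 0 * ugen 1 * ugen 2 * ugen 3 * ugen 4 * ugen 5 * ugen 6 = 1 ∨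
    ugen 0 * ugen 1 * ugen 2 * ugen 3 * ugen 4 * ugen 5 * ugen 6 = -1 := by decide +kernel
  rcases this with h | h
  · exact ⟨1, rfl, by rw [h, one_smul]⟩
  · exact ⟨-1, rfl, by rw [h, neg_one_smul]⟩

/-- The real version of `ugen`. -/
noncomputable def ur (i : Fin 7) : Matrix (Fin 8) (Fin 8) ℝ := (Int.castRingHom ℝ).mapMatrix (ugen i)

theorem ur_sq (i : Fin 7) : ur i * ur i = -1 := by
  rw [ur, ← map_mul, ugen_sq, map_neg, map_one]

theorem ur_anti (i k : Fin 7) (h : i ≠ k) : ur i * ur k = -(ur k * ur i) := by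
  simp only [ur]
  rw [← map_mul, ugen_anti i k h, map_neg, map_mul]

theorem ur_star (i : Fin 7) : star (ur i) = -ur i := by
  rw [ur, ← map_neg, ← ugen_star]
  ext a b
  simp [star_apply]

theorem ur_prod : ∃ c : ℝ, c * c = 1 ∧ ur 0 * ur 1 * ur 2 * ur 3 * ur 4 * ur 5 * ur 6 = c • 1 := by
  obtain ⟨c, hc, h⟩ := ugen_prod
  refine ⟨c, by exact_mod_cast hc, ?_⟩
  simp only [ur, ← map_mul]
  rw [h, zsmul_eq_mul, map_mul, map_intCast, map_one, mul_one, Algebra.smul_def, mul_one]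
  simp

/-- The commutant of the generators consists of scalars. -/
theorem ur_commutant {q : Matrix (Fin 8) (Fin 8) ℝ} (h : ∀ i, q * ur i = ur i * q) :
    q = q 0 0 • 1 := by
  have h3 : ∀ i k l, q * (ur i * ur k * ur l) = ur i * ur k * ur l * q := fun i k l => by
    rw [← mul_assoc, ← mul_assoc, h, mul_assoc (ur i), h, ← mul_assoc, mul_assoc (ur i * ur k), h,
      ← mul_assoc]
  have hd : ∀ l, q * (Int.castRingHom ℝ).mapMatrix (udiag l) =
      (Int.castRingHom ℝ).mapMatrix (udiag l) * q := by
    intro l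
    fin_cases l
    · have := h3 0 1 2
      simp only [ur, ← map_mul] at this
      exact this
    · have := h3 0 3 4
      simp only [ur, ← map_mul] at this
      exact this
    · have := h3 1 3 5
      simp only [ur, ← map_mul] at this
      exact this
  have hdd : ∀ l, (Int.castRingHom ℝ).mapMatrix (udiag l) =
      diagonal fun a => (udiag l a a : ℝ) := by
    intro l
    ext a b
    by_cases hab : a = b
    · subst hab; simp
    · simp [hab, udiag_diag l a b hab]
  have hq : ∀ a b, a ≠ b → q a b = 0 := by
    intro a b hab
    obtain ⟨l, hl⟩ := udiag_sep a b hab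
    have h1 := congrFun (congrFun (hd l) a) b
    rw [hdd, mul_diagonal, diagonal_mul] at h1
    have h2 : (udiag l a a : ℝ) - udiag l b b ≠ 0 := by
      rw [sub_ne_zero]; exact_mod_cast hl
    have h3 : ((udiag l a a : ℝ) - udiag l b b) * q a b = 0 := by linear_combination -h1
    exact (mul_eq_zero.1 h3).resolve_left h2
  have hqd : q = diagonal fun a => q a a := by
    ext a b
    by_cases hab : a = b
    · subst hab; simp
    · simp [hab, hq a b hab]
  ext a b
  by_cases hab : a = b
  · subst hab
    by_cases ha : a = 0
    · subst ha; simp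
    · obtain ⟨i, hi⟩ := ugen_zero a ha
      have h1 := congrFun (congrFun (h i) a) 0
      rw [hqd, mul_diagonal, diagonal_mul] at h1
      have h2 : ur i a 0 ≠ 0 := by simpa [ur] using hi
      have := mul_right_cancel₀ h2 (h1.trans (mul_comm _ _))
      simp [this]
  · simp [hab, hq a b hab]

end Octonion

section Gens

variable {ι : Type} [Fintype ι] [DecidableEq ι]

/-- A family of anticommuting matrices, all but the first one skew with square `-1`. -/
structure Gens (g : ℕ → Matrix ι ι ℝ) : Prop where
  star_eq : ∀ i, 1 ≤ i → i ≤ 10 → star (g i) = -g i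
  sq : ∀ i, 1 ≤ i → i ≤ 10 → g i * g i = -1
  anti : ∀ i k, i ≤ 10 → k ≤ 10 → i ≠ k → g i * g k = -(g k * g i)

/-- The first generators. -/
def gs (g : ℕ → Matrix ι ι ℝ) (k : ℕ) : Set (Matrix ι ι ℝ) := g '' {i | i ≤ k}

theorem insert_gs (g : ℕ → Matrix ι ι ℝ) (k : ℕ) : insert (g (k + 1)) (gs g k) = gs g (k + 1) := by
  have : {i | i ≤ k + 1} = insert (k + 1) {i | i ≤ k} := by
    ext i; simp only [mem_ofPred_eq, mem_insert_iff]; omega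
  rw [gs, gs, this, image_insert_eq]

theorem Gens.stepData {g : ℕ → Matrix ι ι ℝ} (hg : Gens g) {k : ℕ} (hk : k ≤ 7) :
    StepData (gs g k) (g (k + 1)) (g (k + 2)) (g (k + 1) * g (k + 3)) := by
  have mem : ∀ l, k < l → l ≤ 10 → g l ∈ skewAnti (gs g k) := by
    rintro l hl hl'
    refine ⟨hg.star_eq l (by omega) hl', ?_⟩
    rintro _ ⟨i, hi, rfl⟩
    simp only [mem_ofPred_eq] at hi
    exact hg.anti _ _ hl' (by omega) (by omega)
  have h13 := hg.anti (k + 1) (k + 3) (by omega) (by omega) (by omega)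
  have h12 := hg.anti (k + 2) (k + 1) (by omega) (by omega) (by omega)
  have h32 := hg.anti (k + 3) (k + 2) (by omega) (by omega) (by omega)
  have q1 := hg.sq (k + 1) (by omega) (by omega)
  have q3 := hg.sq (k + 3) (by omega) (by omega)
  have comm : ∀ x : Matrix ι ι ℝ, g (k + 1) * x = -(x * g (k + 1)) →
      g (k + 3) * x = -(x * g (k + 3)) → g (k + 1) * g (k + 3) * x = x * (g (k + 1) * g (k + 3)) :=
    fun x h1 h3 => by
      rw [mul_assoc, h3, mul_neg, ← mul_assoc, h1, neg_mul, neg_neg, mul_assoc]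
  refine ⟨⟨mem _ (by omega) (by omega), q1⟩, ?_, ?_, ?_, ?_, ?_, mem _ (by omega) (by omega), h12,
    hg.sq _ (by omega) (by omega)⟩
  · rw [star_mul, hg.star_eq _ (by omega) (by omega), hg.star_eq _ (by omega) (by omega),
      neg_mul_neg, h13, neg_neg]
  · rw [mul_assoc, ← mul_assoc (g (k + 3)), show g (k + 3) * g (k + 1) = -(g (k + 1) * g (k + 3)) by
      rw [h13, neg_neg], neg_mul, mul_neg, ← mul_assoc, ← mul_assoc, q1, mul_assoc, q3]
    simp
  · rw [mul_assoc, show g (k + 3) * g (k + 1) = -(g (k + 1) * g (k + 3)) by rw [h13, neg_neg],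
      mul_neg]
  · rintro _ ⟨i, hi, rfl⟩
    simp only [mem_ofPred_eq] at hi
    exact comm _ (hg.anti _ _ (by omega) (by omega) (by omega))
      (hg.anti _ _ (by omega) (by omega) (by omega))
  · exact comm _ (by rw [h12, neg_neg]) h32

/-- The eightfold periodicity. -/
noncomputable def Gens.stabIso {g : ℕ → Matrix ι ι ℝ} (hg : Gens g) {m : ℕ} (i : Fin m) :
    StabIso (m := m) (m' := m + 8) (gs g 8) (gs g 0) (g 9) (g 1) i
      i.succ.succ.succ.succ.succ.succ.succ.succ :=
  have s : ∀ (k : ℕ) (hk : k ≤ 7) {m : ℕ} (i : Fin m),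
      Nonempty (StabIso (gs g (k + 1)) (gs g k) (g (k + 2)) (g (k + 1)) i i.succ) := fun k hk m i => by
    have := (hg.stepData hk).stabIso i
    rw [insert_gs] at this
    exact ⟨this⟩
  have t : ∀ (k : ℕ) (hk : k ≤ 7) {m : ℕ} (i : Fin m),
    StabIso (gs g (k + 1)) (gs g k) (g (k + 2)) (g (k + 1)) i i.succ := fun k hk m i =>
      (s k hk i).some
  (t 7 (by omega) i).comp <| (t 6 (by omega) i.succ).comp <| (t 5 (by omega) i.succ.succ).comp <|
    (t 4 (by omega) i.succ.succ.succ).comp <| (t 3 (by omega) i.succ.succ.succ.succ).comp <|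
    (t 2 (by omega) i.succ.succ.succ.succ.succ).comp <|
    (t 1 (by omega) i.succ.succ.succ.succ.succ.succ).comp <|
    t 0 (by omega) i.succ.succ.succ.succ.succ.succ.succ

end Gens

end Bott

open scoped Topology

namespace Bott

open unitInterval Set Matrix

section Blocks

variable {α κ κ' : Type} [Fintype α] [DecidableEq α] [Fintype κ] [DecidableEq κ] [Fintype κ']
  [DecidableEq κ']

/-- The block decomposition of the entries of a block matrix. -/
def blk (a b c d : Mat α κ) : Mat (α ⊕ α) κ :=
  of fun k l => fromBlocks (a k l) (b k l) (c k l) (d k l)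

theorem blk_mul (a b c d a' b' c' d' : Mat α κ) : blk a b c d * blk a' b' c' d' =
    blk (a * a' + b * c') (a * b' + b * d') (c * a' + d * c') (c * b' + d * d') := by
  ext k l i j
  rcases i with i | i <;> rcases j with j | j <;>
    simp [blk, Matrix.mul_apply, Matrix.sum_apply, Finset.sum_add_distrib]

theorem blk_star (a b c d : Mat α κ) :
    star (blk a b c d) = blk (star a) (star c) (star b) (star d) := by
  ext k l i j
  rcases i with i | i <;> rcases j with j | j <;> simp [blk, star_apply]

theorem blk_neg (a b c d : Mat α κ) : -blk a b c d = blk (-a) (-b) (-c) (-d) := by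
  ext k l i j
  rcases i with i | i <;> rcases j with j | j <;> simp [blk, Matrix.neg_apply]

theorem blk_one : blk 1 0 0 1 = (1 : Mat (α ⊕ α) κ) := by
  ext k l i j
  by_cases h : k = l
  · subst h
    rcases i with i | i <;> rcases j with j | j <;> simp [blk, Matrix.one_apply]
  · rcases i with i | i <;> rcases j with j | j <;> simp [blk, h]

theorem scalar_blk (a b c d : Matrix α α ℝ) : scalar κ (fromBlocks a b c d) =
    blk (scalar κ a) (scalar κ b) (scalar κ c) (scalar κ d) := by
  ext k l i j
  by_cases h : k = l
  · subst h
    rcases i with i | i <;> rcases j with j | j <;> simp [blk]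
  · rcases i with i | i <;> rcases j with j | j <;> simp [blk, h]

theorem blk_inj {a b c d a' b' c' d' : Mat α κ} :
    blk a b c d = blk a' b' c' d' ↔ a = a' ∧ b = b' ∧ c = c' ∧ d = d' := by
  constructor
  · intro h
    have h' : ∀ k l, fromBlocks (a k l) (b k l) (c k l) (d k l) =
        fromBlocks (a' k l) (b' k l) (c' k l) (d' k l) := fun k l => congrFun (congrFun h k) l
    simp only [fromBlocks_inj] at h'
    refine ⟨?_, ?_, ?_, ?_⟩ <;> ext1 k l
    exacts [(h' k l).1, (h' k l).2.1, (h' k l).2.2.1, (h' k l).2.2.2]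
  · rintro ⟨rfl, rfl, rfl, rfl⟩; rfl

theorem exists_blk (x : Mat (α ⊕ α) κ) : ∃ a b c d, x = blk a b c d :=
  ⟨of fun k l => (x k l).toBlocks₁₁, of fun k l => (x k l).toBlocks₁₂,
    of fun k l => (x k l).toBlocks₂₁, of fun k l => (x k l).toBlocks₂₂, by
      ext1 k l; simp [blk, fromBlocks_toBlocks]⟩

/-- The lower left part of a block matrix. -/
def low (x : Mat (α ⊕ α) κ) : Mat α κ := of fun k l => (x k l).toBlocks₂₁

theorem low_blk (a b c d : Mat α κ) : low (blk a b c d) = c := by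
  ext1 k l; simp [blk, low]

theorem continuous_low : Continuous (low : Mat (α ⊕ α) κ → Mat α κ) := by
  unfold low toBlocks₂₁
  refine continuous_matrix fun k l => continuous_matrix fun i j => ?_
  have h : Continuous fun x : Mat (α ⊕ α) κ => x k l := continuous_id.matrix_elem k l
  exact h.matrix_elem (Sum.inr i) (Sum.inl j)

theorem continuous_blk {X : Type*} [TopologicalSpace X] {a b c d : X → Mat α κ} (ha : Continuous a)
    (hb : Continuous b) (hc : Continuous c) (hd : Continuous d) :
    Continuous fun x => blk (a x) (b x) (c x) (d x) := by
  unfold blk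
  refine continuous_matrix fun k l => ?_
  exact Continuous.matrix_fromBlocks (ha.matrix_elem k l) (hb.matrix_elem k l) (hc.matrix_elem k l)
    (hd.matrix_elem k l)

theorem blk_bs (a b c d : Mat α κ) (a' b' c' d' : Mat α κ') :
    blk (bs a a') (bs b b') (bs c c') (bs d d') = bs (blk a b c d) (blk a' b' c' d') := by
  ext1 k l
  rcases k with k | k <;> rcases l with l | l <;> simp [bs, blk]

theorem star_bs (a : Mat α κ) (a' : Mat α κ') : star (bs a a') = bs (star a) (star a') := by
  simp [bs, star_eq_conjTranspose, fromBlocks_conjTranspose]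

theorem isUnit_blk_anti {b c : Mat α κ} : IsUnit (blk 0 b c 0) ↔ IsUnit b ∧ IsUnit c := by
  constructor
  · rintro ⟨u, hu⟩
    obtain ⟨a', b', c', d', h'⟩ := exists_blk (u⁻¹ : (Mat (α ⊕ α) κ)ˣ).1
    have h1 := u.mul_inv
    have h2 := u.inv_mul
    rw [hu, h', blk_mul, ← blk_one, blk_inj] at h1 h2
    simp only [zero_mul, zero_add, mul_zero, add_zero] at h1 h2
    exact ⟨⟨⟨b, c', h1.1, h2.2.2.2⟩, rfl⟩, ⟨⟨c, b', h1.2.2.2, h2.1⟩, rfl⟩⟩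
  · rintro ⟨⟨u, rfl⟩, ⟨v, rfl⟩⟩
    refine ⟨⟨blk 0 u.1 v.1 0, blk 0 (v⁻¹).1 (u⁻¹).1 0, ?_, ?_⟩, rfl⟩ <;>
    · rw [blk_mul, ← blk_one]; simp

end Blocks

section Ident

variable {α ι β κ κ' : Type} [Fintype α] [DecidableEq α] [Fintype κ] [DecidableEq κ] [Fintype κ']
  [DecidableEq κ'] [Fintype ι] [DecidableEq ι] [Fintype β] [DecidableEq β]

/-- A natural parametrization of a space of skew block matrices by all invertible matrices. -/
structure Ident (β : Type) [Fintype β] [DecidableEq β] (S : Set (Matrix ι ι ℝ))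
    (j : Matrix ι ι ℝ) where
  /-- The parametrization. -/
  ψ : ∀ (κ : Type) [Fintype κ] [DecidableEq κ], Mat β κ → Mat ι κ
  /-- The inverse of the parametrization. -/
  χ : ∀ (κ : Type) [Fintype κ] [DecidableEq κ], Mat ι κ → Mat β κ
  cont_ψ : ∀ (κ : Type) [Fintype κ] [DecidableEq κ], Continuous (ψ κ)
  cont_χ : ∀ (κ : Type) [Fintype κ] [DecidableEq κ], Continuous (χ κ)
  ψ_mem : ∀ {κ : Type} [Fintype κ] [DecidableEq κ] {A : Mat β κ}, IsUnit A → ψ κ A ∈ US S κ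
  χ_mem : ∀ {κ : Type} [Fintype κ] [DecidableEq κ] {x : Mat ι κ}, x ∈ US S κ → IsUnit (χ κ x)
  χ_ψ : ∀ {κ : Type} [Fintype κ] [DecidableEq κ] (A : Mat β κ), χ κ (ψ κ A) = A
  ψ_χ : ∀ {κ : Type} [Fintype κ] [DecidableEq κ] {x : Mat ι κ}, x ∈ US S κ → ψ κ (χ κ x) = x
  ψ_one : ∀ (κ : Type) [Fintype κ] [DecidableEq κ], ψ κ 1 = scalar κ j
  ψ_bs : ∀ {κ κ' : Type} [Fintype κ] [DecidableEq κ] [Fintype κ'] [DecidableEq κ'] (A : Mat β κ)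
    (B : Mat β κ'), ψ (κ ⊕ κ') (bs A B) = bs (ψ κ A) (ψ κ' B)

/-- Doubling of a family of generators. -/
def dbl (h : ℕ → Matrix α α ℝ) : ℕ → Matrix (α ⊕ α) (α ⊕ α) ℝ
  | 0 => fromBlocks 1 0 0 (-1)
  | 1 => fromBlocks 0 (-1) 1 0
  | i + 2 => fromBlocks 0 (h i) (h i) 0

theorem Gens.dbl {h : ℕ → Matrix α α ℝ} (hs : ∀ i ≤ 8, star (h i) = -h i)
    (hq : ∀ i ≤ 8, h i * h i = -1)
    (ha : ∀ i k, i ≤ 8 → k ≤ 8 → i ≠ k → h i * h k = -(h k * h i)) : Gens (dbl h) where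
  star_eq i hi hi' := by
    match i with
    | 1 =>
      rw [Bott.dbl, star_eq_conjTranspose, fromBlocks_conjTranspose]
      simp [fromBlocks_neg]
    | i + 2 =>
      have := hs i (by omega)
      rw [star_eq_conjTranspose] at this
      rw [Bott.dbl, star_eq_conjTranspose, fromBlocks_conjTranspose, this]
      simp [fromBlocks_neg]
  sq i hi hi' := by
    match i with
    | 1 => simp [Bott.dbl, fromBlocks_multiply, ← fromBlocks_one, fromBlocks_neg]
    | i + 2 =>
      simp [Bott.dbl, fromBlocks_multiply, ← fromBlocks_one, fromBlocks_neg, hq i (by omega)]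
  anti i k hi hk hik := by
    match i, k with
    | 0, 1 => simp [Bott.dbl, fromBlocks_multiply, fromBlocks_neg]
    | 1, 0 => simp [Bott.dbl, fromBlocks_multiply, fromBlocks_neg]
    | 0, k + 2 => simp [Bott.dbl, fromBlocks_multiply, fromBlocks_neg]
    | k + 2, 0 => simp [Bott.dbl, fromBlocks_multiply, fromBlocks_neg]
    | 1, k + 2 => simp [Bott.dbl, fromBlocks_multiply, fromBlocks_neg]
    | k + 2, 1 => simp [Bott.dbl, fromBlocks_multiply, fromBlocks_neg]
    | i + 2, k + 2 =>
      simp [Bott.dbl, fromBlocks_multiply, fromBlocks_neg,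
        ha i k (by omega) (by omega) (by omega)]

theorem mem_US_gs {g : ℕ → Matrix ι ι ℝ} {k : ℕ} {x : Mat ι κ} : x ∈ US (gs g k) κ ↔
    (star x = -x ∧ ∀ i ≤ k, x * scalar κ (g i) = -(scalar κ (g i) * x)) ∧ IsUnit x := by
  have : x ∈ US (gs g k) κ ↔ (star x = -x ∧ ∀ y ∈ scalar κ '' gs g k, x * y = -(y * x)) ∧ IsUnit x :=
    Iff.rfl
  rw [this, gs]
  simp only [forall_mem_image, mem_ofPred_eq]

theorem eq_zero_of_eq_neg {x : Mat ι κ} (h : x = -x) : x = 0 := by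
  ext k l i j
  have := congrFun (congrFun (congrFun (congrFun h k) l) i) j
  simp only [Matrix.neg_apply] at this
  simp only [Matrix.zero_apply]
  linarith

theorem anti_dbl_zero (h : ℕ → Matrix α α ℝ) (a b c d : Mat α κ) :
    blk a b c d * scalar κ (dbl h 0) = -(scalar κ (dbl h 0) * blk a b c d) ↔ a = 0 ∧ d = 0 := by
  rw [dbl, scalar_blk, blk_mul, blk_mul, blk_neg, blk_inj]
  simp only [map_zero, map_one, map_neg, mul_zero, zero_mul, mul_one, one_mul, mul_neg, neg_mul,
    add_zero, zero_add, neg_neg]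
  constructor
  · rintro ⟨h1, -, -, h2⟩
    exact ⟨eq_zero_of_eq_neg h1, eq_zero_of_eq_neg h2.symm⟩
  · rintro ⟨rfl, rfl⟩; simp

theorem skew_blk_anti (b c : Mat α κ) : star (blk 0 b c 0) = -blk 0 b c 0 ↔ b = -star c := by
  rw [blk_star, blk_neg, blk_inj]
  constructor
  · rintro ⟨-, h, -⟩; rw [h, neg_neg]
  · rintro rfl; simp

/-- The space of skew matrices with a single constraint. -/
def identZero (h : ℕ → Matrix α α ℝ) : Ident α (gs (dbl h) 0) (dbl h 1) where
  ψ κ _ _ A := blk 0 (-star A) A 0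
  χ κ _ _ x := low x
  cont_ψ κ _ _ := continuous_blk continuous_const continuous_star.neg continuous_id continuous_const
  cont_χ κ _ _ := continuous_low
  ψ_mem {κ _ _ A} hA := by
    refine mem_US_gs.2 ⟨⟨(skew_blk_anti _ _).2 rfl, fun i hi => ?_⟩,
      isUnit_blk_anti.2 ⟨hA.star.neg, hA⟩⟩
    obtain rfl : i = 0 := by omega
    exact (anti_dbl_zero h _ _ _ _).2 ⟨rfl, rfl⟩
  χ_mem {κ _ _ x} hx := by
    obtain ⟨⟨-, h2⟩, h3⟩ := mem_US_gs.1 hx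
    obtain ⟨a, b, c, d, rfl⟩ := exists_blk x
    obtain ⟨rfl, rfl⟩ := (anti_dbl_zero h _ _ _ _).1 (h2 0 le_rfl)
    rw [low_blk]
    exact (isUnit_blk_anti.1 h3).2
  χ_ψ A := low_blk _ _ _ _
  ψ_χ {κ _ _ x} hx := by
    obtain ⟨⟨h1, h2⟩, h3⟩ := mem_US_gs.1 hx
    obtain ⟨a, b, c, d, rfl⟩ := exists_blk x
    obtain ⟨rfl, rfl⟩ := (anti_dbl_zero h _ _ _ _).1 (h2 0 le_rfl)
    rw [low_blk, ← (skew_blk_anti _ _).1 h1]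
  ψ_one κ _ _ := by rw [dbl, scalar_blk]; simp only [map_zero, map_neg, map_one, star_one]
  ψ_bs A B := by
    rw [← blk_bs, star_bs]
    congr 1
    · simp [bs]
    · simp [bs, fromBlocks_neg]
    · simp [bs]

end Ident

end Bott

open scoped Topology

namespace Bott

open unitInterval Set Matrix
open scoped Kronecker

section Kron

variable {κ κ' : Type} [Fintype κ] [DecidableEq κ] [Fintype κ'] [DecidableEq κ']

/-- Generators of a matrix algebra with a large commutant. -/
noncomputable def uk (i : ℕ) : Matrix (Fin 8 × Fin 2) (Fin 8 × Fin 2) ℝ :=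
  if h : i < 7 then ur ⟨i, h⟩ ⊗ₖ 1 else 0

/-- A complex structure commuting with the matrices `uk i`. -/
def ek : Matrix (Fin 8 × Fin 2) (Fin 8 × Fin 2) ℝ := 1 ⊗ₖ !![0, -1; 1, 0]

theorem neg_kron (a : Matrix (Fin 8) (Fin 8) ℝ) (b : Matrix (Fin 2) (Fin 2) ℝ) :
    (-a) ⊗ₖ b = -(a ⊗ₖ b) := by
  ext i j; simp [Matrix.neg_apply]

theorem kron_neg (a : Matrix (Fin 8) (Fin 8) ℝ) (b : Matrix (Fin 2) (Fin 2) ℝ) :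
    a ⊗ₖ (-b) = -(a ⊗ₖ b) := by
  ext i j; simp [Matrix.neg_apply]

theorem star_kron (a : Matrix (Fin 8) (Fin 8) ℝ) (b : Matrix (Fin 2) (Fin 2) ℝ) :
    star (a ⊗ₖ b) = star a ⊗ₖ star b := by
  ext i j; simp [star_apply]

theorem uk_star {i : ℕ} (hi : i < 7) : star (uk i) = -uk i := by
  rw [uk, dif_pos hi, star_kron, ur_star, star_one, neg_kron]

theorem uk_sq {i : ℕ} (hi : i < 7) : uk i * uk i = -1 := by
  rw [uk, dif_pos hi, ← mul_kronecker_mul, ur_sq, one_mul, neg_kron, one_kronecker_one]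

theorem uk_anti {i k : ℕ} (hi : i < 7) (hk : k < 7) (h : i ≠ k) : uk i * uk k = -(uk k * uk i) := by
  rw [uk, uk, dif_pos hi, dif_pos hk, ← mul_kronecker_mul, ← mul_kronecker_mul,
    ur_anti ⟨i, hi⟩ ⟨k, hk⟩ (by simpa using h), neg_kron]

theorem uk_prod : ∃ c : ℝ, c * c = 1 ∧
    uk 0 * uk 1 * uk 2 * uk 3 * uk 4 * uk 5 * uk 6 = c • 1 := by
  obtain ⟨c, hc, h⟩ := ur_prod
  refine ⟨c, hc, ?_⟩
  have : uk 0 * uk 1 * uk 2 * uk 3 * uk 4 * uk 5 * uk 6 =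
      (ur 0 * ur 1 * ur 2 * ur 3 * ur 4 * ur 5 * ur 6) ⊗ₖ (1 * 1 * 1 * 1 * 1 * 1 * 1) := by
    simp only [mul_kronecker_mul]
    rfl
  rw [this, h, smul_kronecker]
  simp

theorem ek_star : star ek = -ek := by
  rw [ek, star_kron, star_one, ← kron_neg]
  congr 1
  ext i j; fin_cases i <;> fin_cases j <;> simp [star_apply]

theorem ek_sq : ek * ek = -1 := by
  rw [ek, ← mul_kronecker_mul, one_mul, ← one_kronecker_one, ← kron_neg]
  congr 1
  ext i j; fin_cases i <;> fin_cases j <;> simp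

theorem ek_uk {i : ℕ} (hi : i < 7) : ek * uk i = uk i * ek := by
  rw [ek, uk, dif_pos hi, ← mul_kronecker_mul, ← mul_kronecker_mul]
  simp

theorem uk_commutant {q : Matrix (Fin 8 × Fin 2) (Fin 8 × Fin 2) ℝ}
    (h : ∀ i < 7, q * uk i = uk i * q) : q = 1 ⊗ₖ of fun s t => q (0, s) (0, t) := by
  have key : ∀ s t, (of fun a b => q (a, s) (b, t)) = q (0, s) (0, t) • 1 := by
    intro s t
    refine ur_commutant fun i => ?_
    ext a b
    have := congrFun (congrFun (h i i.2) (a, s)) (b, t)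
    rw [uk, dif_pos i.2] at this
    simpa [Matrix.mul_apply, Fintype.sum_prod_type, Matrix.one_apply] using this
  ext ⟨a, s⟩ ⟨b, t⟩
  have := congrFun (congrFun (key s t) a) b
  simp only [of_apply, Matrix.smul_apply, smul_eq_mul] at this
  rw [this]
  simp [mul_comm]

/-- Block matrices in the commutant of the matrices `uk i`. -/
def com (B : Mat (Fin 2) κ) : Mat (Fin 8 × Fin 2) κ := of fun k l => 1 ⊗ₖ B k l

/-- A left inverse of `com`. -/
def ucom (x : Mat (Fin 8 × Fin 2) κ) : Mat (Fin 2) κ :=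
  of fun k l => of fun s t => x k l (0, s) (0, t)

theorem ucom_com (B : Mat (Fin 2) κ) : ucom (com B) = B := by
  ext k l s t; simp [ucom, com]

theorem ucom_com_mul (B : Mat (Fin 2) κ) (y : Mat (Fin 8 × Fin 2) κ) :
    ucom (com B * y) = B * ucom y := by
  ext k l s t
  simp [ucom, com, Matrix.mul_apply, Matrix.sum_apply, Fintype.sum_prod_type, Matrix.one_apply]

theorem ucom_mul_com (B : Mat (Fin 2) κ) (y : Mat (Fin 8 × Fin 2) κ) :
    ucom (y * com B) = ucom y * B := by
  ext k l s t
  simp [ucom, com, Matrix.mul_apply, Matrix.sum_apply, Fintype.sum_prod_type, Matrix.one_apply]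

theorem com_mul (B C : Mat (Fin 2) κ) : com (B * C) = com B * com C := by
  ext1 k l
  simp only [com, of_apply, Matrix.mul_apply, ← mul_kronecker_mul, one_mul]
  ext ⟨a, s⟩ ⟨b, t⟩
  simp [Matrix.sum_apply, Finset.mul_sum]

theorem com_one : com 1 = (1 : Mat (Fin 8 × Fin 2) κ) := by
  ext1 k l
  by_cases h : k = l
  · subst h; simp [com]
  · simp [com, h]

theorem com_bs (B : Mat (Fin 2) κ) (C : Mat (Fin 2) κ') : com (bs B C) = bs (com B) (com C) := by
  ext1 k l
  rcases k with k | k <;> rcases l with l | l <;> simp [bs, com]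

theorem isUnit_com {B : Mat (Fin 2) κ} : IsUnit (com B) ↔ IsUnit B := by
  constructor
  · rintro ⟨u, hu⟩
    have h1 := u.mul_inv
    have h2 := u.inv_mul
    rw [hu] at h1 h2
    refine ⟨⟨B, ucom (u⁻¹).1, ?_, ?_⟩, rfl⟩
    · rw [← ucom_com_mul, h1, ← com_one, ucom_com]
    · rw [← ucom_mul_com, h2, ← com_one, ucom_com]
  · rintro ⟨u, rfl⟩
    refine ⟨⟨com u.1, com (u⁻¹).1, ?_, ?_⟩, rfl⟩ <;> rw [← com_mul] <;> simp [com_one]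

theorem com_ucom {x : Mat (Fin 8 × Fin 2) κ}
    (h : ∀ i < 7, x * scalar κ (uk i) = scalar κ (uk i) * x) : com (ucom x) = x := by
  ext1 k l
  refine (uk_commutant fun i hi => ?_).symm
  have := congrFun (congrFun (h i hi) k) l
  simpa [scalar_apply, mul_diagonal, diagonal_mul] using this

theorem com_comm (B : Mat (Fin 2) κ) {i : ℕ} (hi : i < 7) :
    com B * scalar κ (uk i) = scalar κ (uk i) * com B := by
  ext1 k l
  simp only [scalar_apply, mul_diagonal, diagonal_mul, com, of_apply]
  rw [uk, dif_pos hi, ← mul_kronecker_mul, ← mul_kronecker_mul]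
  simp

theorem eq_zero_of_anti_uk {x : Mat (Fin 8 × Fin 2) κ}
    (h : ∀ i < 7, x * scalar κ (uk i) = -(scalar κ (uk i) * x)) : x = 0 := by
  obtain ⟨c, hc, hu⟩ := uk_prod
  have s : ∀ i < 7, SemiconjBy x (scalar κ (uk i)) (-scalar κ (uk i)) := fun i hi => by
    rw [SemiconjBy, h i hi, neg_mul]
  have t := ((((((s 0 (by omega)).mul_right (s 1 (by omega))).mul_right
    (s 2 (by omega))).mul_right (s 3 (by omega))).mul_right (s 4 (by omega))).mul_right
    (s 5 (by omega))).mul_right (s 6 (by omega))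
  simp only [mul_neg, neg_mul, neg_neg, ← map_mul] at t
  rw [hu] at t
  have e : scalar κ (c • (1 : Matrix (Fin 8 × Fin 2) (Fin 8 × Fin 2) ℝ)) =
      c • (1 : Mat (Fin 8 × Fin 2) κ) := by
    ext1 k l
    by_cases h : k = l
    · subst h; simp [Matrix.smul_apply]
    · simp [h, Matrix.smul_apply]
  rw [e, SemiconjBy, mul_smul_comm, neg_mul, smul_mul_assoc, one_mul, mul_one] at t
  have := eq_zero_of_eq_neg t
  have c0 : c ≠ 0 := by rintro rfl; simp at hc
  exact (smul_eq_zero.1 this).resolve_left c0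

/-- The inner family of generators. -/
noncomputable def hk (i : ℕ) :
    Matrix ((Fin 8 × Fin 2) ⊕ (Fin 8 × Fin 2)) ((Fin 8 × Fin 2) ⊕ (Fin 8 × Fin 2)) ℝ :=
  if i < 7 then fromBlocks (uk i) 0 0 (-uk i) else if i = 7 then fromBlocks 0 (-1) 1 0 else
    fromBlocks 0 ek ek 0

theorem hk_lt {i : ℕ} (hi : i < 7) : hk i = fromBlocks (uk i) 0 0 (-uk i) := if_pos hi
theorem hk_seven : hk 7 = fromBlocks 0 (-1) 1 0 := by simp [hk]
theorem hk_eight : hk 8 = fromBlocks 0 ek ek 0 := by simp [hk]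

theorem gens : Gens (dbl hk) := by
  refine Gens.dbl (fun i hi => ?_) (fun i hi => ?_) fun i k hi hk' hik => ?_
  · rcases (by omega : i < 7 ∨ i = 7 ∨ i = 8) with h | rfl | rfl
    · have := uk_star h
      rw [star_eq_conjTranspose] at this
      rw [hk_lt h, star_eq_conjTranspose, fromBlocks_conjTranspose, conjTranspose_neg, this]
      simp [fromBlocks_neg]
    · rw [hk_seven, star_eq_conjTranspose, fromBlocks_conjTranspose]
      simp [fromBlocks_neg]
    · have := ek_star
      rw [star_eq_conjTranspose] at this
      rw [hk_eight, star_eq_conjTranspose, fromBlocks_conjTranspose, this]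
      simp [fromBlocks_neg]
  · rcases (by omega : i < 7 ∨ i = 7 ∨ i = 8) with h | rfl | rfl
    · rw [hk_lt h, fromBlocks_multiply, ← fromBlocks_one, fromBlocks_neg]
      simp [uk_sq h]
    · rw [hk_seven, fromBlocks_multiply, ← fromBlocks_one, fromBlocks_neg]
      simp
    · rw [hk_eight, fromBlocks_multiply, ← fromBlocks_one, fromBlocks_neg]
      simp [ek_sq]
  · rcases (by omega : i < 7 ∨ i = 7 ∨ i = 8) with h | rfl | rfl <;>
    rcases (by omega : k < 7 ∨ k = 7 ∨ k = 8) with h' | rfl | rfl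
    · rw [hk_lt h, hk_lt h', fromBlocks_multiply, fromBlocks_multiply, fromBlocks_neg]
      simp [uk_anti h h' hik]
    · rw [hk_lt h, hk_seven, fromBlocks_multiply, fromBlocks_multiply, fromBlocks_neg]
      simp
    · rw [hk_lt h, hk_eight, fromBlocks_multiply, fromBlocks_multiply, fromBlocks_neg]
      simp [ek_uk h]
    · rw [hk_lt h', hk_seven, fromBlocks_multiply, fromBlocks_multiply, fromBlocks_neg]
      simp
    · exact absurd rfl hik
    · rw [hk_seven, hk_eight, fromBlocks_multiply, fromBlocks_multiply, fromBlocks_neg]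
      simp
    · rw [hk_lt h', hk_eight, fromBlocks_multiply, fromBlocks_multiply, fromBlocks_neg]
      simp [ek_uk h']
    · rw [hk_seven, hk_eight, fromBlocks_multiply, fromBlocks_multiply, fromBlocks_neg]
      simp
    · exact absurd rfl hik

theorem anti_dbl_one {α : Type} [Fintype α] [DecidableEq α] (h : ℕ → Matrix α α ℝ) (b c : Mat α κ) :
    blk 0 b c 0 * scalar κ (dbl h 1) = -(scalar κ (dbl h 1) * blk 0 b c 0) ↔ b = c := by
  rw [dbl, scalar_blk, blk_mul, blk_mul, blk_neg, blk_inj]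
  simp only [map_zero, map_one, map_neg, mul_zero, zero_mul, mul_one, one_mul, mul_neg, neg_mul,
    add_zero, zero_add, neg_neg]
  simp [eq_comm]

theorem anti_dbl_succ {α : Type} [Fintype α] [DecidableEq α] (h : ℕ → Matrix α α ℝ) (b : Mat α κ)
    (i : ℕ) : blk 0 b b 0 * scalar κ (dbl h (i + 2)) = -(scalar κ (dbl h (i + 2)) * blk 0 b b 0) ↔
      b * scalar κ (h i) = -(scalar κ (h i) * b) := by
  rw [dbl, scalar_blk, blk_mul, blk_mul, blk_neg, blk_inj]
  simp

theorem anti_hk (p b q r : Mat (Fin 8 × Fin 2) κ) {i : ℕ} (hi : i < 7) :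
    blk p b q r * scalar κ (hk i) = -(scalar κ (hk i) * blk p b q r) ↔
      p * scalar κ (uk i) = -(scalar κ (uk i) * p) ∧ b * scalar κ (uk i) = scalar κ (uk i) * b ∧
      q * scalar κ (uk i) = scalar κ (uk i) * q ∧
      r * scalar κ (uk i) = -(scalar κ (uk i) * r) := by
  rw [hk_lt hi, scalar_blk, blk_mul, blk_mul, blk_neg, blk_inj]
  simp only [map_zero, map_neg, mul_zero, zero_mul, mul_neg, neg_mul,
    add_zero, zero_add, neg_neg, neg_inj]
  rw [neg_eq_iff_eq_neg]

theorem skew_blk_self {α : Type} [Fintype α] [DecidableEq α] (b : Mat α κ) :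
    star (blk 0 b b 0) = -blk 0 b b 0 ↔ star b = -b := by
  rw [blk_star, blk_neg, blk_inj]
  simp

theorem exists_of_mem_US {x : Mat (((Fin 8 × Fin 2) ⊕ (Fin 8 × Fin 2)) ⊕ ((Fin 8 × Fin 2) ⊕
    (Fin 8 × Fin 2))) κ} (hx : x ∈ US (gs (dbl hk) 8) κ) : ∃ B : Mat (Fin 2) κ, IsUnit B ∧
      x = blk 0 (blk 0 (-star (com B)) (com B) 0) (blk 0 (-star (com B)) (com B) 0) 0 := by
  obtain ⟨⟨h1, h2⟩, h3⟩ := mem_US_gs.1 hx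
  obtain ⟨a, b, c, d, rfl⟩ := exists_blk x
  obtain ⟨rfl, rfl⟩ := (anti_dbl_zero hk _ _ _ _).1 (h2 0 (by omega))
  obtain rfl := (anti_dbl_one hk _ _).1 (h2 1 (by omega))
  have h4 := fun i (hi : i < 7) => (anti_dbl_succ hk b i).1 (h2 (i + 2) (by omega))
  have h5 := (isUnit_blk_anti.1 h3).1
  rw [skew_blk_self] at h1
  obtain ⟨p, b, q, r, rfl⟩ := exists_blk b
  have h6 := fun i (hi : i < 7) => (anti_hk p b q r hi).1 (h4 i hi)
  obtain rfl := eq_zero_of_anti_uk fun i hi => (h6 i hi).1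
  obtain rfl := eq_zero_of_anti_uk fun i hi => (h6 i hi).2.2.2
  obtain rfl := (skew_blk_anti _ _).1 h1
  have h7 := com_ucom fun i hi => (h6 i hi).2.2.1
  refine ⟨ucom q, isUnit_com.1 ?_, ?_⟩
  · rw [h7]; exact (isUnit_blk_anti.1 h5).2
  · rw [h7]

theorem mem_US_of_isUnit {B : Mat (Fin 2) κ} (hB : IsUnit B) :
    blk 0 (blk 0 (-star (com B)) (com B) 0) (blk 0 (-star (com B)) (com B) 0) 0 ∈
      US (gs (dbl hk) 8) κ := by
  refine mem_US_gs.2 ⟨⟨?_, fun i hi => ?_⟩, ?_⟩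
  · rw [skew_blk_self, skew_blk_anti]
  · match i with
    | 0 => exact (anti_dbl_zero hk _ _ _ _).2 ⟨rfl, rfl⟩
    | 1 => exact (anti_dbl_one hk _ _).2 rfl
    | i + 2 =>
      have hi : i < 7 := by omega
      refine (anti_dbl_succ hk _ i).2 ((anti_hk _ _ _ _ hi).2 ⟨by simp, ?_, com_comm B hi, by simp⟩)
      have := congrArg star (com_comm B hi)
      have su : star (scalar κ (uk i)) = -scalar κ (uk i) := by
        rw [← map_neg, ← uk_star hi]
        ext1 k l
        by_cases h : k = l
        · subst h; simp [star_apply]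
        · simp [star_apply, h, Ne.symm h]
      rw [star_mul, star_mul, su, neg_mul, mul_neg, neg_inj] at this
      rw [neg_mul, mul_neg, this]
  · have := isUnit_com.2 hB
    have := isUnit_blk_anti.2 ⟨this.star.neg, this⟩
    exact isUnit_blk_anti.2 ⟨this, this⟩

theorem continuous_com : Continuous (com : Mat (Fin 2) κ → Mat (Fin 8 × Fin 2) κ) := by
  refine continuous_matrix fun k l => continuous_matrix fun i j => ?_
  have h : Continuous fun x : Mat (Fin 2) κ => x k l := continuous_id.matrix_elem k l
  exact continuous_const.mul (h.matrix_elem i.2 j.2)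

theorem continuous_ucom : Continuous (ucom : Mat (Fin 8 × Fin 2) κ → Mat (Fin 2) κ) := by
  refine continuous_matrix fun k l => continuous_matrix fun i j => ?_
  have h : Continuous fun x : Mat (Fin 8 × Fin 2) κ => x k l := continuous_id.matrix_elem k l
  exact h.matrix_elem (0, i) (0, j)

/-- The space of skew matrices with nine constraints. -/
noncomputable def identEight : Ident (Fin 2) (gs (dbl hk) 8) (dbl hk 9) where
  ψ κ _ _ B := blk 0 (blk 0 (-star (com B)) (com B) 0) (blk 0 (-star (com B)) (com B) 0) 0
  χ κ _ _ x := ucom (low (low x))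
  cont_ψ κ _ _ := by
    have h : Continuous fun B : Mat (Fin 2) κ => blk 0 (-star (com B)) (com B) 0 :=
      continuous_blk continuous_const (continuous_star.comp continuous_com).neg continuous_com
        continuous_const
    exact continuous_blk continuous_const h h continuous_const
  cont_χ κ _ _ := continuous_ucom.comp (continuous_low.comp continuous_low)
  ψ_mem hB := mem_US_of_isUnit hB
  χ_mem hx := by
    obtain ⟨B, hB, rfl⟩ := exists_of_mem_US hx
    rwa [low_blk, low_blk, ucom_com]
  χ_ψ B := by rw [low_blk, low_blk, ucom_com]
  ψ_χ hx := by
    obtain ⟨B, hB, rfl⟩ := exists_of_mem_US hx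
    rw [low_blk, low_blk, ucom_com]
  ψ_one κ _ _ := by
    rw [dbl, hk_seven, scalar_blk, scalar_blk, com_one]
    simp only [map_zero, map_neg, map_one, star_one]
  ψ_bs A B := by
    have z : ∀ {α κ κ' : Type} [Fintype α] [DecidableEq α] [Fintype κ] [DecidableEq κ] [Fintype κ']
      [DecidableEq κ'], (0 : Mat α (κ ⊕ κ')) = bs 0 0 := by intros; simp [bs]
    have n : ∀ {α κ κ' : Type} [Fintype α] [DecidableEq α] [Fintype κ] [DecidableEq κ] [Fintype κ']
      [DecidableEq κ'] (a : Mat α κ) (b : Mat α κ'), -bs a b = bs (-a) (-b) := by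
        intros; simp [bs, fromBlocks_neg]
    rw [com_bs, star_bs, n, z (α := Fin 8 × Fin 2), blk_bs,
      z (α := (Fin 8 × Fin 2) ⊕ (Fin 8 × Fin 2)), blk_bs]

end Kron

end Bott

open scoped Topology

namespace Bott

open unitInterval Set Matrix

/-- The invertible matrices. -/
def GLs (n : Type) [Fintype n] [DecidableEq n] : Set (Matrix n n ℝ) := {x | IsUnit x}

theorem mem_GLs {n : Type} [Fintype n] [DecidableEq n] {x : Matrix n n ℝ} :
    x ∈ GLs n ↔ x.det ≠ 0 := by
  rw [GLs, mem_ofPred_eq, isUnit_iff_isUnit_det, isUnit_iff_ne_zero]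

section Column

variable {X : Type*} [TopologicalSpace X] {n : Type} [Fintype n] [DecidableEq n] {A : Set X}

/-- The first column of a matrix can be moved within a half space. -/
theorem exists_htpy_col {f : X → Matrix n n ℝ} (hf : Continuous f) (hu : ∀ x, f x ∈ GLs n) (o : n)
    {u : X → n → ℝ} (hc : Continuous u) (hp : ∀ x, 0 < u x ⬝ᵥ fun i => f x i o)
    (hA : ∀ x ∈ A, ∀ i, u x i = f x i o) :
    ∃ f' : X → Matrix n n ℝ, HtpyRel (GLs n) A f f' ∧ ∀ x i, f' x i o = u x i := by
  set v : X → n → ℝ := fun x i => f x i o with hv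
  have hvc : Continuous v := continuous_pi fun i => hf.matrix_elem i o
  have hvv : ∀ x, 0 < v x ⬝ᵥ v x := fun x => by
    refine lt_of_le_of_ne (Finset.sum_nonneg fun i _ => mul_self_nonneg _) fun h => ?_
    rw [eq_comm, dotProduct_self_eq_zero] at h
    have := hp x
    rw [show (fun i => f x i o) = v x from rfl, h] at this
    simp at this
  set M : ℝ → X → Matrix n n ℝ := fun t x =>
    1 + (t / (v x ⬝ᵥ v x)) • vecMulVec (u x - v x) (v x) with hM
  have hMc : Continuous fun p : ℝ × X => M p.1 p.2 := by
    have h1 : Continuous fun p : ℝ × X => p.1 / (v p.2 ⬝ᵥ v p.2) :=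
      continuous_fst.div ((hvc.comp continuous_snd).dotProduct (hvc.comp continuous_snd))
        fun p => (hvv p.2).ne'
    have h2 : Continuous fun p : ℝ × X => vecMulVec (u p.2 - v p.2) (v p.2) :=
      Continuous.matrix_vecMulVec (by fun_prop) (by fun_prop)
    exact continuous_const.add (h1.smul h2)
  have hdet : ∀ t ∈ Icc (0 : ℝ) 1, ∀ x, (M t x).det ≠ 0 := by
    intro t ht x
    have : (M t x).det = (1 - t) + t / (v x ⬝ᵥ v x) * (u x ⬝ᵥ v x) := by
      have h1 : M t x = 1 + replicateCol Unit ((t / (v x ⬝ᵥ v x)) • (u x - v x)) *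
          replicateRow Unit (v x) := by
        rw [← vecMulVec_eq, smul_vecMulVec]
      rw [h1, det_one_add_replicateCol_mul_replicateRow, dotProduct_smul, dotProduct_sub,
        dotProduct_comm (v x) (u x), smul_eq_mul]
      field_simp [(hvv x).ne']
      ring
    rw [this]
    have h2 : 0 < u x ⬝ᵥ v x := hp x
    rcases eq_or_lt_of_le ht.2 with h | h
    · subst h; have := hvv x; positivity
    · have h3 : 0 ≤ t / (v x ⬝ᵥ v x) * (u x ⬝ᵥ v x) :=
        mul_nonneg (div_nonneg ht.1 (hvv x).le) h2.le
      linarith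
  refine ⟨fun x => M 1 x * f x, ?_, fun x i => ?_⟩
  · refine HtpyRel.of_real 1 zero_le_one (fun t x => M t x * f x)
      (hMc.mul (hf.comp continuous_snd)) (fun t ht x => ?_) (fun x => ?_) (fun x => rfl)
      fun t _ x hx => ?_
    · rw [mem_GLs, det_mul]
      exact mul_ne_zero (hdet t ht x) (mem_GLs.1 (hu x))
    · simp [hM]
    · have : u x - v x = 0 := by
        ext i; simp [hv, hA x hx i]
      simp [hM, this]
  · have h1 : (M 1 x * f x) i o = (M 1 x *ᵥ v x) i := rfl
    beta_reduce
    rw [h1, hM]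
    beta_reduce
    rw [add_mulVec, one_mulVec, smul_mulVec, vecMulVec_mulVec]
    simp only [Pi.add_apply, Pi.smul_apply, Pi.sub_apply, smul_eq_mul, MulOpposite.smul_eq_mul_unop,
      MulOpposite.unop_op]
    field_simp [(hvv x).ne']
    ring

end Column

section Stab

variable {j : ℕ} {a : Type} [Fintype a] [DecidableEq a] {A : Set (Fin j → I)}

/-- A small perturbation of a map from a low dimensional cube avoids a line. -/
theorem exists_avoid (hj : j < Fintype.card a) {v : (Fin j → I) → Unit ⊕ a → ℝ} (hv : Continuous v)
    {ε : ℝ} (hε : 0 < ε) : ∃ g : (Fin j → I) → Unit ⊕ a → ℝ, Continuous g ∧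
      (∀ x i, |g x i - v x i| < ε) ∧ ∀ x, ∃ i : a, g x (Sum.inr i) ≠ 0 := by
  have hvu : UniformContinuous v := CompactSpace.uniformContinuous_of_continuous hv
  have hpu : UniformContinuous fun (y : Fin j → ℝ) i => projIcc (0 : ℝ) 1 zero_le_one (y i) :=
    uniformContinuous_pi.2 fun i =>
      ((LipschitzWith.projIcc zero_le_one).uniformContinuous.comp
        (Pi.uniformContinuous_proj (fun _ : Fin j => ℝ) i) :)
  obtain ⟨g, hg, hd⟩ := (hvu.comp hpu).exists_contDiff_dist_le (half_pos hε)
  set e : Unit ⊕ a → ℝ := Sum.elim 1 0 with he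
  have hF : ContDiff ℝ 1 fun p : (Fin j → ℝ) × ℝ => g p.1 - p.2 • e :=
    ((hg.of_le (by simp)).comp contDiff_fst).sub (contDiff_snd.smul contDiff_const)
  have hD := hF.dense_compl_range_of_finrank_lt_finrank (by simp; omega)
  obtain ⟨w, hw, hwd⟩ := hD.exists_dist_lt 0 (half_pos hε)
  refine ⟨fun x => g (fun i => (x i : ℝ)) - w, by have := hg.continuous; fun_prop, fun x i => ?_,
    fun x => ?_⟩
  · have h1 := hd fun i => (x i : ℝ)
    have h2 := (dist_pi_lt_iff (half_pos hε)).1 h1 i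
    have h3 := (dist_pi_lt_iff (half_pos hε)).1 hwd i
    simp only [Function.comp_apply, projIcc_val, Real.dist_eq] at h2 h3
    simp only [Pi.sub_apply, Pi.zero_apply] at h3 ⊢
    rw [abs_lt] at *
    constructor <;> linarith
  · by_contra! h
    refine hw ⟨(fun i => (x i : ℝ), g (fun i => (x i : ℝ)) (Sum.inl ()) - w (Sum.inl ())), ?_⟩
    ext i
    rcases i with i | i
    · simp [he]
    · have := h i
      simp only [Pi.sub_apply] at this
      simp [he]; linarith

theorem exists_htpy_block (hj : j < Fintype.card a)
    {f : (Fin j → I) → Matrix (Unit ⊕ a) (Unit ⊕ a) ℝ} (hf : Continuous f)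
    (hu : ∀ x, f x ∈ GLs (Unit ⊕ a)) (hA : ∀ x ∈ A, ∃ c, f x = fromBlocks 1 0 0 c) :
    ∃ c : (Fin j → I) → Matrix a a ℝ, Continuous c ∧ (∀ x, c x ∈ GLs a) ∧
      HtpyRel (GLs (Unit ⊕ a)) A f fun x => fromBlocks 1 0 0 (c x) := by
  set e : Unit ⊕ a → ℝ := Sum.elim 1 0 with he
  have key : ∃ f' : (Fin j → I) → Matrix (Unit ⊕ a) (Unit ⊕ a) ℝ, HtpyRel (GLs (Unit ⊕ a)) A f f' ∧
      ∀ x i, f' x i (Sum.inl ()) = e i := by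
    have hAe : ∀ x ∈ A, ∀ i, f x i (Sum.inl ()) = e i := by
      intro x hx i
      obtain ⟨c, hc⟩ := hA x hx
      rw [hc]
      rcases i with i | i <;> simp [he]
    set v : (Fin j → I) → Unit ⊕ a → ℝ := fun x i => f x i (Sum.inl ()) with hv
    have hvc : Continuous v := continuous_pi fun i => hf.matrix_elem i _
    have hvv : ∀ x, 0 < v x ⬝ᵥ v x := fun x => by
      refine lt_of_le_of_ne (Finset.sum_nonneg fun i _ => mul_self_nonneg _) fun h => ?_
      rw [eq_comm, dotProduct_self_eq_zero] at h
      exact mem_GLs.1 (hu x) (det_eq_zero_of_column_eq_zero (Sum.inl ()) fun i => congrFun h i)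
    obtain ⟨ε, hε, hε2, hεv⟩ : ∃ ε : ℝ, 0 < ε ∧ ε < 1 / 2 ∧ ∀ x, ε * ∑ i, |v x i| < v x ⬝ᵥ v x := by
      have hc : Continuous fun x => (v x ⬝ᵥ v x) / (1 + ∑ i, |v x i|) := by
        refine (hvc.dotProduct hvc).div (by fun_prop) fun x => ?_
        have : 0 ≤ ∑ i, |v x i| := Finset.sum_nonneg fun i _ => abs_nonneg _
        positivity
      obtain ⟨x₀, -, hx₀⟩ := isCompact_univ.exists_isMinOn univ_nonempty hc.continuousOn
      set δ := (v x₀ ⬝ᵥ v x₀) / (1 + ∑ i, |v x₀ i|) with hδ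
      have pos : ∀ x, 0 < 1 + ∑ i, |v x i| := fun x => by
        have : 0 ≤ ∑ i, |v x i| := Finset.sum_nonneg fun i _ => abs_nonneg _
        positivity
      have hδ0 : 0 < δ := div_pos (hvv _) (pos _)
      refine ⟨min δ (1 / 4), by positivity, (min_le_right _ _).trans_lt (by norm_num), fun x => ?_⟩
      have h1 : δ ≤ (v x ⬝ᵥ v x) / (1 + ∑ i, |v x i|) := hx₀ (mem_univ x)
      rw [le_div_iff₀ (pos x)] at h1
      have h2 : min δ (1 / 4) * ∑ i, |v x i| ≤ δ * ∑ i, |v x i| :=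
        mul_le_mul_of_nonneg_right (min_le_left _ _) (Finset.sum_nonneg fun i _ => abs_nonneg _)
      linarith
    obtain ⟨g, hgc, hgd, hga⟩ := exists_avoid hj hvc hε
    -- the cutoff function
    set l : (Fin j → I) → ℝ := fun x => max 0 (min 1 (2 - 2 * v x (Sum.inl ()))) with hl
    have hlc : Continuous l := by fun_prop
    have hl0 : ∀ x, 0 ≤ l x := fun x => le_max_left _ _
    have hl1 : ∀ x, l x ≤ 1 := fun x => max_le zero_le_one (min_le_left _ _)
    set v' : (Fin j → I) → Unit ⊕ a → ℝ := fun x => v x + l x • (g x - v x) with hv'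
    have hvc' : Continuous v' := by fun_prop
    have hpos : ∀ x, 0 < v' x ⬝ᵥ v x := by
      intro x
      have h1 : v' x ⬝ᵥ v x = v x ⬝ᵥ v x + l x * ((g x - v x) ⬝ᵥ v x) := by
        rw [hv']; simp only [add_dotProduct, smul_dotProduct, smul_eq_mul]
      have h2 : |(g x - v x) ⬝ᵥ v x| ≤ ε * ∑ i, |v x i| := by
        rw [dotProduct, Finset.mul_sum]
        refine (Finset.abs_sum_le_sum_abs _ _).trans (Finset.sum_le_sum fun i _ => ?_)
        rw [abs_mul]
        exact mul_le_mul_of_nonneg_right (hgd x i).le (abs_nonneg _)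
      have h3 : |l x * ((g x - v x) ⬝ᵥ v x)| ≤ ε * ∑ i, |v x i| := by
        rw [abs_mul, abs_of_nonneg (hl0 x)]
        exact (mul_le_of_le_one_left (abs_nonneg _) (hl1 x)).trans h2
      have := (abs_le.1 h3).1
      have := hεv x
      rw [h1]; linarith
    have hA' : ∀ x ∈ A, v' x = v x := by
      intro x hx
      have : v x (Sum.inl ()) = 1 := (hAe x hx _).trans (by simp [he])
      have : l x = 0 := by simp [hl, this]
      simp [hv', this]
    obtain ⟨f₁, R₁, hf₁⟩ := exists_htpy_col hf hu (Sum.inl ()) hvc' hpos fun x hx i => by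
      rw [hA' x hx]
    -- the vector `v'` is never a negative multiple of `e`
    set r : (Fin j → I) → ℝ := fun x => √(v' x ⬝ᵥ v' x) with hr
    have hrc : Continuous r := (hvc'.dotProduct hvc').sqrt
    have hsq : ∀ x, v' x ⬝ᵥ v' x = v' x (Sum.inl ()) ^ 2 + ∑ i, v' x (Sum.inr i) ^ 2 := fun x => by
      simp [dotProduct, sq]
    have hne : ∀ x, 0 < v' x (Sum.inl ()) + r x := by
      intro x
      by_cases h : 1 / 2 < v x (Sum.inl ())
      · have h1 : 0 < v' x (Sum.inl ()) := by
          have h2 : |l x * (g x (Sum.inl ()) - v x (Sum.inl ()))| ≤ ε := by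
            rw [abs_mul, abs_of_nonneg (hl0 x)]
            exact (mul_le_of_le_one_left (abs_nonneg _) (hl1 x)).trans (hgd x _).le
          have := (abs_le.1 h2).1
          simp only [hv', Pi.add_apply, Pi.smul_apply, Pi.sub_apply, smul_eq_mul]
          linarith
        have : 0 ≤ r x := Real.sqrt_nonneg _
        linarith
      · have h1 : l x = 1 := by
          simp only [hl]
          rw [min_eq_left (by linarith), max_eq_right zero_le_one]
        have h2 : v' x = g x := by simp [hv', h1]
        obtain ⟨i, hi⟩ := hga x
        have h3 : v' x (Sum.inl ()) ^ 2 < v' x ⬝ᵥ v' x := by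
          rw [hsq]
          have : 0 < ∑ i, v' x (Sum.inr i) ^ 2 :=
            Finset.sum_pos' (fun i _ => sq_nonneg _) ⟨i, Finset.mem_univ _, by
              rw [h2]; positivity⟩
          linarith
        have := Real.sqrt_lt_sqrt (sq_nonneg _) h3
        rw [Real.sqrt_sq_eq_abs] at this
        have := (abs_lt.1 this).1
        linarith
    have hr0 : ∀ x, 0 ≤ r x := fun x => Real.sqrt_nonneg _
    have hrr : ∀ x, r x * r x = v' x ⬝ᵥ v' x := fun x => Real.mul_self_sqrt
      (Finset.sum_nonneg fun i _ => mul_self_nonneg _)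
    have hrp : ∀ x, 0 < r x := fun x => by
      refine lt_of_le_of_ne (hr0 x) fun h => ?_
      have h1 := hrr x
      rw [← h, zero_mul, eq_comm, dotProduct_self_eq_zero] at h1
      have := hpos x
      rw [h1] at this
      simp at this
    set p : (Fin j → I) → Unit ⊕ a → ℝ := fun x => (1 + r x)⁻¹ • (v' x + r x • e) with hp
    have hpc : Continuous p := by
      have h1 : Continuous fun x => (1 + r x)⁻¹ :=
        (continuous_const.add hrc).inv₀ fun x => (by linarith [hr0 x] : 0 < 1 + r x).ne'
      exact h1.smul (hvc'.add (hrc.smul continuous_const))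
    have hev : ∀ x, e ⬝ᵥ v' x = v' x (Sum.inl ()) := fun x => by simp [he, dotProduct]
    have hAp : ∀ x ∈ A, p x = e ∧ v' x = e := by
      intro x hx
      have h1 : v' x = e := by rw [hA' x hx]; ext i; exact hAe x hx i
      have h2 : r x = 1 := by simp [hr, h1, he, dotProduct]
      refine ⟨?_, h1⟩
      rw [hp]; beta_reduce
      rw [h2, h1]
      ext i; simp; ring
    obtain ⟨f₂, R₂, hf₂⟩ := exists_htpy_col (A := A) R₁.continuous_right R₁.mem_right (Sum.inl ()) hpc
      (fun x => by
        have : (fun i => f₁ x i (Sum.inl ())) = v' x := funext (hf₁ x)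
        rw [this, hp]
        simp only [smul_dotProduct, add_dotProduct, hev, smul_eq_mul, ← hrr]
        have h1 := hne x
        have h2 := hrp x
        have h3 : r x * r x + r x * v' x (Sum.inl ()) = r x * (v' x (Sum.inl ()) + r x) := by ring
        rw [h3]
        positivity)
      (fun x hx i => by rw [hf₁, (hAp x hx).1, (hAp x hx).2])
    obtain ⟨f₃, R₃, hf₃⟩ := exists_htpy_col (A := A) R₂.continuous_right R₂.mem_right (Sum.inl ())
      (continuous_const (y := e)) (fun x => by
        have : (fun i => f₂ x i (Sum.inl ())) = p x := funext (hf₂ x)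
        rw [this, hp]
        have : e ⬝ᵥ e = 1 := by simp [he, dotProduct]
        simp only [dotProduct_smul, dotProduct_add, hev, smul_eq_mul, this, mul_one]
        have h1 := hne x
        have h2 := hrp x
        positivity)
      (fun x hx i => by rw [hf₂, (hAp x hx).1])
    exact ⟨f₃, (R₁.trans R₂).trans R₃, hf₃⟩
  obtain ⟨f', R, hf'⟩ := key
  have hb : ∀ x, f' x = fromBlocks 1 (f' x).toBlocks₁₂ 0 (f' x).toBlocks₂₂ := fun x => by
    conv_lhs => rw [← fromBlocks_toBlocks (f' x)]
    congr 1
    · ext i k; simp [toBlocks₁₁, hf', he]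
    · ext i k; simp [toBlocks₂₁, hf', he]
  have hdet : ∀ x, (f' x).toBlocks₂₂.det ≠ 0 := fun x => by
    have := mem_GLs.1 (R.mem_right x)
    rwa [hb, det_fromBlocks_zero₂₁, det_one, one_mul] at this
  have h12 : Continuous fun x => (f' x).toBlocks₁₂ := by
    refine continuous_matrix fun i k => ?_
    exact R.continuous_right.matrix_elem _ _
  have h22 : Continuous fun x => (f' x).toBlocks₂₂ := by
    refine continuous_matrix fun i k => ?_
    exact R.continuous_right.matrix_elem _ _
  refine ⟨fun x => (f' x).toBlocks₂₂, h22, fun x => mem_GLs.2 (hdet x), R.trans ?_⟩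
  refine HtpyRel.of_real 1 zero_le_one (fun t x => fromBlocks 1 ((1 - t) • (f' x).toBlocks₁₂) 0
    (f' x).toBlocks₂₂) ?_ (fun t _ x => ?_) (fun x => ?_) (fun x => ?_) fun t _ x hx => ?_
  · exact continuous_const.matrix_fromBlocks
      ((continuous_const.sub continuous_fst).smul (h12.comp continuous_snd)) continuous_const
      (h22.comp continuous_snd)
  · rw [mem_GLs, det_fromBlocks_zero₂₁, det_one, one_mul]
    exact hdet x
  · rw [sub_zero, one_smul]; exact (hb x).symm
  · simp
  · obtain ⟨c, hc⟩ := hA x hx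
    have : (f' x).toBlocks₁₂ = 0 := by rw [R.eqOn hx, hc, toBlocks_fromBlocks₁₂]
    conv_rhs => rw [hb x]
    rw [this, smul_zero]

end Stab

end Bott

open scoped Topology

namespace Bott

open unitInterval Set Matrix

section Reindex

variable {n m : Type} [Fintype n] [DecidableEq n] [Fintype m] [DecidableEq m]

theorem reindex_mem_GLs (e : n ≃ m) {x : Matrix n n ℝ} : reindex e e x ∈ GLs m ↔ x ∈ GLs n := by
  rw [mem_GLs, mem_GLs, det_reindex_self]

theorem continuous_reindex (e : n ≃ m) :
    Continuous (reindex e e : Matrix n n ℝ → Matrix m m ℝ) :=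
  continuous_id.matrix_submatrix _ _

theorem HtpyRel.reindex {X : Type*} [TopologicalSpace X] {A : Set X} {f g : X → Matrix n n ℝ}
    (R : HtpyRel (GLs n) A f g) (e : n ≃ m) :
    HtpyRel (GLs m) A (fun x => Matrix.reindex e e (f x)) fun x => Matrix.reindex e e (g x) :=
  R.map (fun _ x => Matrix.reindex e e x) ((continuous_reindex e).comp continuous_snd)
    fun _ y hy => (reindex_mem_GLs e).2 hy

end Reindex

section Stab

variable {j : ℕ} {a : Type} [Fintype a] [DecidableEq a] {A : Set (Fin j → I)}

theorem exists_htpy_blocks (hj : j < Fintype.card a) (b : Type) [Finite b] :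
    ∀ [Fintype b] [DecidableEq b] {f : (Fin j → I) → Matrix (b ⊕ a) (b ⊕ a) ℝ}, Continuous f →
      (∀ x, f x ∈ GLs (b ⊕ a)) → (∀ x ∈ A, ∃ c, f x = fromBlocks 1 0 0 c) →
      ∃ c : (Fin j → I) → Matrix a a ℝ, Continuous c ∧ (∀ x, c x ∈ GLs a) ∧
        HtpyRel (GLs (b ⊕ a)) A f fun x => fromBlocks 1 0 0 (c x) := by
  have equiv : ∀ {b b' : Type} (e : b ≃ b'), (∀ [Fintype b] [DecidableEq b]
      {f : (Fin j → I) → Matrix (b ⊕ a) (b ⊕ a) ℝ}, Continuous f →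
      (∀ x, f x ∈ GLs (b ⊕ a)) → (∀ x ∈ A, ∃ c, f x = fromBlocks 1 0 0 c) →
      ∃ c : (Fin j → I) → Matrix a a ℝ, Continuous c ∧ (∀ x, c x ∈ GLs a) ∧
        HtpyRel (GLs (b ⊕ a)) A f fun x => fromBlocks 1 0 0 (c x)) → (∀ [Fintype b'] [DecidableEq b']
      {f : (Fin j → I) → Matrix (b' ⊕ a) (b' ⊕ a) ℝ}, Continuous f →
      (∀ x, f x ∈ GLs (b' ⊕ a)) → (∀ x ∈ A, ∃ c, f x = fromBlocks 1 0 0 c) →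
      ∃ c : (Fin j → I) → Matrix a a ℝ, Continuous c ∧ (∀ x, c x ∈ GLs a) ∧
        HtpyRel (GLs (b' ⊕ a)) A f fun x => fromBlocks 1 0 0 (c x)) := by
    intro b b' e ih _ _ f hf hu hA
    classical
    let _ : Fintype b := Fintype.ofEquiv b' e.symm
    set s := e.sumCongr (Equiv.refl a)
    have hs : ∀ c : Matrix a a ℝ, reindex s s (fromBlocks 1 0 0 c) = fromBlocks 1 0 0 c := by
      intro c
      ext i k
      rcases i with i | i <;> rcases k with k | k <;> simp [s, Matrix.one_apply]
    have hs' : ∀ c : Matrix a a ℝ, reindex s.symm s.symm (fromBlocks 1 0 0 c) =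
        fromBlocks 1 0 0 c := by
      intro c
      rw [← hs c]; simp
    obtain ⟨c, hc, hcu, R⟩ := ih (f := fun x => reindex s.symm s.symm (f x))
      ((continuous_reindex _).comp hf) (fun x => (reindex_mem_GLs _).2 (hu x)) fun x hx => by
        obtain ⟨c, hc⟩ := hA x hx
        exact ⟨c, by rw [hc, hs']⟩
    refine ⟨c, hc, hcu, (R.reindex s).congr (fun x => by simp) fun x => (hs _).symm⟩
  induction b using Finite.induction_empty_option with
  | of_equiv e ih => exact equiv e ih
  | h_empty =>
    intro _ _ f hf hu hA
    have hf' : ∀ x, f x = fromBlocks 1 0 0 (f x).toBlocks₂₂ := fun x => by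
      ext i k
      rcases i with i | i
      · exact i.elim
      · rcases k with k | k
        · exact k.elim
        · simp [toBlocks₂₂]
    refine ⟨fun x => (f x).toBlocks₂₂, ?_, fun x => ?_, ?_⟩
    · exact continuous_matrix fun i k => hf.matrix_elem _ _
    · have := mem_GLs.1 (hu x)
      rwa [hf', det_fromBlocks_zero₂₁, det_one, one_mul, ← mem_GLs] at this
    · exact (HtpyRel.refl hf hu).congr (fun x => rfl) fun x => (hf' x).symm
  | h_option ih =>
    rename_i b _
    have e : Unit ⊕ b ≃ Option b := (Equiv.sumComm _ _).trans (Equiv.optionEquivSumPUnit b).symm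
    refine @equiv (Unit ⊕ b) (Option b) e ?_
    clear equiv
    intro _ _ f hf hu hA
    classical
    let _ : Fintype b := Fintype.ofInjective (Sum.inr : b → Unit ⊕ b) Sum.inr_injective
    set s := Equiv.sumAssoc Unit b a
    have hs : ∀ c : Matrix a a ℝ, reindex s s (fromBlocks 1 0 0 c) =
        fromBlocks 1 0 0 (fromBlocks 1 0 0 c) := by
      intro c
      ext i k
      rcases i with i | i | i <;> rcases k with k | k | k <;> simp [s, Matrix.one_apply]
    obtain ⟨c, hc, hcu, R⟩ := exists_htpy_block (A := A) (a := b ⊕ a) (by simp; omega)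
      ((continuous_reindex s).comp hf) (fun x => (reindex_mem_GLs _).2 (hu x)) fun x hx => by
        obtain ⟨c, hc⟩ := hA x hx
        exact ⟨_, by rw [Function.comp_apply, hc, hs]⟩
    obtain ⟨d, hd, hdu, R'⟩ := ih hc hcu fun x hx => by
      obtain ⟨c', hc'⟩ := hA x hx
      have := R.eqOn hx
      rw [Function.comp_apply, hc', hs, fromBlocks_inj] at this
      exact ⟨c', this.2.2.2⟩
    refine ⟨d, hd, hdu, ?_⟩
    have R'' : HtpyRel (GLs (Unit ⊕ (b ⊕ a))) A (fun x => fromBlocks 1 0 0 (c x))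
        fun x => fromBlocks 1 0 0 (fromBlocks 1 0 0 (d x)) :=
      R'.map (fun _ y => fromBlocks 1 0 0 y)
        (continuous_const.matrix_fromBlocks continuous_const continuous_const continuous_snd)
        fun _ y hy => by
          rw [mem_GLs, det_fromBlocks_zero₂₁, det_one, one_mul]; exact mem_GLs.1 hy
    refine ((R.trans R'').reindex s.symm).congr (fun x => by simp) fun x => ?_
    rw [← hs]; simp

variable {b : Type} [Fintype b] [DecidableEq b]

theorem exists_destabilize (hj : j < Fintype.card a) {f : (Fin j → I) → Matrix (b ⊕ a) (b ⊕ a) ℝ}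
    (hf : IsLoop (GLs (b ⊕ a)) 1 f) : ∃ c : (Fin j → I) → Matrix a a ℝ, IsLoop (GLs a) 1 c ∧
      HtpyRel (GLs (b ⊕ a)) (Cube.boundary (Fin j)) f fun x => fromBlocks 1 0 0 (c x) := by
  obtain ⟨c, hc, hcu, R⟩ := exists_htpy_blocks hj b hf.cont hf.mem fun x hx =>
    ⟨1, by rw [hf.bdry x hx, fromBlocks_one]⟩
  refine ⟨c, ⟨hc, hcu, fun x hx => ?_⟩, R⟩
  have := R.eqOn hx
  rw [hf.bdry x hx, ← fromBlocks_one, fromBlocks_inj] at this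
  exact this.2.2.2

theorem HtpyRel.destabilize (hj : j + 1 < Fintype.card a) {f g : (Fin j → I) → Matrix a a ℝ}
    (R : HtpyRel (GLs (b ⊕ a)) A (fun x => fromBlocks 1 0 0 (f x))
      fun x => fromBlocks 1 0 0 (g x)) : HtpyRel (GLs a) A f g := by
  obtain ⟨H, hc, hY, h0, h1, hA⟩ := R
  obtain ⟨c, hc', hcu, R⟩ := exists_htpy_blocks (A := {y | y 0 = 0 ∨ y 0 = 1 ∨ Fin.tail y ∈ A})
    hj b (f := fun y : Fin (j + 1) → I => H (y 0, Fin.tail y))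
    (hc.comp ((continuous_apply 0).prodMk (continuous_pi fun i => continuous_apply i.succ))) (fun _ => hY _) (by
      rintro y (h | h | h)
      · exact ⟨_, by rw [h]; exact h0 _⟩
      · exact ⟨_, by rw [h]; exact h1 _⟩
      · exact ⟨_, hA _ _ h⟩)
  have key : ∀ y : Fin (j + 1) → I, ∀ d, (y 0 = 0 ∨ y 0 = 1 ∨ Fin.tail y ∈ A) →
      H (y 0, Fin.tail y) = fromBlocks 1 0 0 d → c y = d := fun y d hy hd => by
    have := R.eqOn hy
    rw [hd, fromBlocks_inj] at this
    exact this.2.2.2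
  refine ⟨fun p => c (Fin.cons p.1 p.2), hc'.comp ?_, fun p => hcu _,
    fun x => ?_, fun x => ?_, fun t x hx => ?_⟩
  · exact continuous_cons.comp continuous_swap
  · exact key _ _ (Or.inl rfl) (by simpa using h0 x)
  · exact key _ _ (Or.inr (Or.inl rfl)) (by simpa using h1 x)
  · exact key _ _ (Or.inr (Or.inr (by simpa using hx))) (by simpa using hA t x hx)

end Stab

end Bott

open scoped Topology

namespace Bott

open unitInterval Set Matrix

variable {β κ κ' ι : Type} [Fintype κ] [DecidableEq κ] [Fintype κ'] [DecidableEq κ']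
  [Fintype ι] [DecidableEq ι] [Fintype β] [DecidableEq β] {j : ℕ}

/-- The set of units of a monoid. -/
def Un (R : Type*) [Monoid R] : Set R := {x | IsUnit x}

section Flat

/-- Forgetting the block structure of a matrix of matrices. -/
def flat (A : Mat β κ) : Matrix (κ × β) (κ × β) ℝ := Matrix.compRingEquiv κ β ℝ A

/-- Restoring the block structure of a matrix. -/
def unflat (A : Matrix (κ × β) (κ × β) ℝ) : Mat β κ := (Matrix.compRingEquiv κ β ℝ).symm A

theorem flat_mem {A : Mat β κ} (hA : A ∈ Un (Mat β κ)) : flat A ∈ GLs (κ × β) :=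
  hA.map (Matrix.compRingEquiv κ β ℝ)

theorem unflat_mem {A : Matrix (κ × β) (κ × β) ℝ} (hA : A ∈ GLs (κ × β)) :
    unflat A ∈ Un (Mat β κ) :=
  IsUnit.map (Matrix.compRingEquiv κ β ℝ).symm hA

theorem continuous_flat : Continuous (flat : Mat β κ → _) :=
  continuous_matrix fun i k => (continuous_id.matrix_elem i.1 k.1).matrix_elem i.2 k.2

theorem continuous_unflat : Continuous (unflat : _ → Mat β κ) :=
  continuous_matrix fun i k => continuous_matrix fun i' k' => continuous_id.matrix_elem (i, i') (k, k')

@[simp] theorem flat_unflat (A : Matrix (κ × β) (κ × β) ℝ) : flat (unflat A) = A := rfl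

@[simp] theorem unflat_flat (A : Mat β κ) : unflat (flat A) = A := rfl

theorem flat_one : flat (1 : Mat β κ) = 1 := map_one (Matrix.compRingEquiv κ β ℝ)

theorem unflat_one : unflat (1 : Matrix (κ × β) (κ × β) ℝ) = 1 :=
  map_one (Matrix.compRingEquiv κ β ℝ).symm

/-- The distribution of the product over the sum. -/
def distr (κ κ' β : Type) : (κ ⊕ κ') × β ≃ (κ' × β) ⊕ (κ × β) :=
  (Equiv.sumProdDistrib κ κ' β).trans (Equiv.sumComm _ _)

theorem reindex_flat_bs (A : Mat β κ) :
    reindex (distr κ κ' β) (distr κ κ' β) (flat (bs A 1)) = fromBlocks 1 0 0 (flat A) := by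
  ext i k
  rcases i with ⟨i, b⟩ | ⟨i, b⟩ <;> rcases k with ⟨k, c⟩ | ⟨k, c⟩ <;>
    simp [flat, bs, distr, compRingEquiv, Matrix.one_apply, Prod.ext_iff]
  split_ifs <;> simp_all [Matrix.one_apply]

end Flat

theorem exists_mat_destabilize (hj : j < Fintype.card κ * Fintype.card β)
    {f : (Fin j → I) → Mat β (κ ⊕ κ')} (hf : IsLoop (Un (Mat β (κ ⊕ κ'))) 1 f) :
    ∃ c : (Fin j → I) → Mat β κ, IsLoop (Un (Mat β κ)) 1 c ∧
      HtpyRel (Un (Mat β (κ ⊕ κ'))) (Cube.boundary (Fin j)) f fun x => bs (c x) 1 := by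
  set s := distr κ κ' β
  obtain ⟨c, hc, R⟩ := exists_destabilize (by rwa [Fintype.card_prod])
    (f := fun x => reindex s s (flat (f x)))
    ⟨(continuous_reindex s).comp (continuous_flat.comp hf.cont),
      fun x => (reindex_mem_GLs s).2 (flat_mem (hf.mem x)),
      fun x hx => by rw [hf.bdry x hx, flat_one]; simp⟩
  refine ⟨fun x => unflat (c x), ⟨continuous_unflat.comp hc.cont, fun x => unflat_mem (hc.mem x),
    fun x hx => by rw [hc.bdry x hx, unflat_one]⟩, ?_⟩
  have R' := (R.reindex s.symm).map (Y' := Un (Mat β (κ ⊕ κ'))) (fun _ y => unflat y)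
    (continuous_unflat.comp continuous_snd) fun _ y hy => unflat_mem hy
  refine R'.congr (fun x => by simp) fun x => ?_
  rw [← flat_unflat (c x), ← reindex_flat_bs]
  simp [s]

theorem HtpyRel.mat_destabilize (hj : j + 1 < Fintype.card κ * Fintype.card β)
    {A : Set (Fin j → I)} {f g : (Fin j → I) → Mat β κ}
    (R : HtpyRel (Un (Mat β (κ ⊕ κ'))) A (fun x => bs (f x) 1) fun x => bs (g x) 1) :
    HtpyRel (Un (Mat β κ)) A f g := by
  have R' := (R.map (fun _ y => flat y) (continuous_flat.comp continuous_snd)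
    fun _ y hy => flat_mem hy).reindex (distr κ κ' β)
  have R'' := (R'.congr (fun x => (reindex_flat_bs (f x)).symm)
    fun x => (reindex_flat_bs (g x)).symm).destabilize (by rwa [Fintype.card_prod])
  exact R''.map (fun _ y => unflat y) (continuous_unflat.comp continuous_snd)
    fun _ y hy => unflat_mem hy

namespace Ident

variable {S : Set (Matrix ι ι ℝ)} {J : Matrix ι ι ℝ}

theorem χ_base (P : Ident β S J) (κ : Type) [Fintype κ] [DecidableEq κ] : P.χ κ (scalar κ J) = 1 := by
  rw [← P.ψ_one, P.χ_ψ]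

theorem loop_ψ (P : Ident β S J) {f : (Fin j → I) → Mat β κ} (hf : IsLoop (Un (Mat β κ)) 1 f) :
    IsLoop (US S κ) (scalar κ J) fun x => P.ψ κ (f x) :=
  ⟨(P.cont_ψ κ).comp hf.cont, fun x => P.ψ_mem (hf.mem x),
    fun x hx => by rw [hf.bdry x hx, P.ψ_one]⟩

theorem loop_χ (P : Ident β S J) {f : (Fin j → I) → Mat ι κ} (hf : IsLoop (US S κ) (scalar κ J) f) :
    IsLoop (Un (Mat β κ)) 1 fun x => P.χ κ (f x) :=
  ⟨(P.cont_χ κ).comp hf.cont, fun x => P.χ_mem (hf.mem x),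
    fun x hx => by rw [hf.bdry x hx, P.χ_base]⟩

theorem htpy_ψ (P : Ident β S J) {A : Set (Fin j → I)} {f g : (Fin j → I) → Mat β κ}
    (R : HtpyRel (Un (Mat β κ)) A f g) :
    HtpyRel (US S κ) A (fun x => P.ψ κ (f x)) fun x => P.ψ κ (g x) :=
  R.map (fun _ y => P.ψ κ y) ((P.cont_ψ κ).comp continuous_snd) fun _ _ hy => P.ψ_mem hy

theorem htpy_χ (P : Ident β S J) {A : Set (Fin j → I)} {f g : (Fin j → I) → Mat ι κ}
    (R : HtpyRel (US S κ) A f g) :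
    HtpyRel (Un (Mat β κ)) A (fun x => P.χ κ (f x)) fun x => P.χ κ (g x) :=
  R.map (fun _ y => P.χ κ y) ((P.cont_χ κ).comp continuous_snd) fun _ _ hy => P.χ_mem hy

theorem χ_bs (P : Ident β S J) {x : Mat ι κ} (hx : x ∈ US S κ) :
    P.χ (κ ⊕ κ') (bs x (scalar κ' J)) = bs (P.χ κ x) 1 := by
  rw [← P.χ_ψ (bs (P.χ κ x) 1), P.ψ_bs, P.ψ_χ hx, P.ψ_one]

theorem exists_destabilize (P : Ident β S J) (hj : j < Fintype.card κ * Fintype.card β)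
    {f : (Fin j → I) → Mat ι (κ ⊕ κ')} (hf : IsLoop (US S (κ ⊕ κ')) (scalar (κ ⊕ κ') J) f) :
    ∃ c : (Fin j → I) → Mat ι κ, IsLoop (US S κ) (scalar κ J) c ∧
      HtpyRel (US S (κ ⊕ κ')) (Cube.boundary (Fin j)) f fun x => bs (c x) (scalar κ' J) := by
  obtain ⟨c, hc, R⟩ := exists_mat_destabilize hj (P.loop_χ hf)
  exact ⟨_, P.loop_ψ hc, (P.htpy_ψ R).congr (fun x => (P.ψ_χ (hf.mem x)).symm)
    fun x => by rw [P.ψ_bs, P.ψ_one]⟩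

theorem destabilize (P : Ident β S J) (hj : j + 1 < Fintype.card κ * Fintype.card β) {A : Set (Fin j → I)}
    {f g : (Fin j → I) → Mat ι κ} (hf : ∀ x, f x ∈ US S κ) (hg : ∀ x, g x ∈ US S κ)
    (R : HtpyRel (US S (κ ⊕ κ')) A (fun x => bs (f x) (scalar κ' J))
      fun x => bs (g x) (scalar κ' J)) : HtpyRel (US S κ) A f g := by
  have R' := ((P.htpy_χ R).congr (fun x => (P.χ_bs (hf x)).symm)
    fun x => (P.χ_bs (hg x)).symm).mat_destabilize hj
  exact (P.htpy_ψ R').congr (fun x => (P.ψ_χ (hf x)).symm) fun x => (P.ψ_χ (hg x)).symm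

end Ident

end Bott

open scoped Topology

namespace Bott

open unitInterval Set Matrix

variable {n : Type} [Fintype n] [DecidableEq n]

section Cholesky

/-- The first elimination step of the Cholesky decomposition. -/
noncomputable def elim {b : Type} [DecidableEq b] (P : Matrix (Unit ⊕ b) (Unit ⊕ b) ℝ) :
    Matrix (Unit ⊕ b) (Unit ⊕ b) ℝ :=
  fromBlocks ((√(P (.inl ()) (.inl ())))⁻¹ • 1) (-(P (.inl ()) (.inl ()))⁻¹ • P.toBlocks₁₂) 0 1

theorem elim_spec {b : Type} [Fintype b] [DecidableEq b] {P : Matrix (Unit ⊕ b) (Unit ⊕ b) ℝ}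
    (hP : P.PosDef) : ∃ D : Matrix b b ℝ, D.PosDef ∧ (elim P)ᵀ * P * elim P = fromBlocks 1 0 0 D := by
  set p := P (.inl ()) (.inl ()) with hp
  have hp0 : 0 < p := hP.diag_pos
  have hT : IsUnit (elim P) := by
    rw [isUnit_iff_isUnit_det, elim, det_fromBlocks_zero₂₁]
    simp [← hp, (Real.sqrt_pos.2 hp0).ne']
  have hQ : ((elim P)ᵀ * P * elim P).PosDef := by
    have := hP.conjTranspose_mul_mul_same (B := elim P) (mulVec_injective_of_isUnit hT)
    rwa [conjTranspose_eq_transpose_of_trivial] at this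
  have hsymm : P.toBlocks₂₁ = P.toBlocks₁₂ᵀ := by
    ext i k
    have := hP.1.apply (.inr i) (.inl k)
    simpa [toBlocks₂₁, toBlocks₁₂] using this.symm
  have h11 : P.toBlocks₁₁ = p • 1 := by
    ext i k
    simp [toBlocks₁₁, hp]
  refine ⟨((elim P)ᵀ * P * elim P).toBlocks₂₂, hQ.submatrix Sum.inr_injective, ?_⟩
  have hsq : (√p)⁻¹ * (p * (√p)⁻¹) = 1 := by
    have := Real.mul_self_sqrt hp0.le
    have h0 := (Real.sqrt_pos.2 hp0).ne'
    field_simp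
    nlinarith
  rw [← fromBlocks_toBlocks P, elim, fromBlocks_transpose, fromBlocks_multiply, fromBlocks_multiply]
  simp only [fromBlocks_toBlocks, ← hp, toBlocks_fromBlocks₂₂, h11, hsymm]
  congr 1
  · simp [smul_smul, hsq]
  · simp [smul_smul, hp0.ne']
  · simp [smul_smul, hp0.ne']

theorem continuousOn_elim {b : Type} [Fintype b] [DecidableEq b] :
    ContinuousOn (elim (b := b)) {P | P.PosDef} := by
  have hp : ContinuousOn (fun P : Matrix (Unit ⊕ b) (Unit ⊕ b) ℝ => P (.inl ()) (.inl ()))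
      {P | P.PosDef} := (continuous_id.matrix_elem _ _).continuousOn
  have hp0 : ∀ P ∈ {P : Matrix (Unit ⊕ b) (Unit ⊕ b) ℝ | P.PosDef}, P (.inl ()) (.inl ()) ≠ 0 :=
    fun P hP => (PosDef.diag_pos hP).ne'
  have hs0 : ∀ P ∈ {P : Matrix (Unit ⊕ b) (Unit ⊕ b) ℝ | P.PosDef}, √(P (.inl ()) (.inl ())) ≠ 0 :=
    fun P hP => (Real.sqrt_pos.2 (PosDef.diag_pos hP)).ne'
  refine continuousOn_pi.2 fun i => continuousOn_pi.2 fun k => ?_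
  rcases i with i | i <;> rcases k with k | k
  · exact (((Real.continuous_sqrt.comp_continuousOn hp).inv₀ hs0).smul continuousOn_const)
  · exact ((hp.inv₀ hp0).neg).mul (continuous_id.matrix_elem _ _).continuousOn
  · exact continuousOn_const
  · exact continuousOn_const

theorem exists_cholesky_sum {b : Type} [Fintype b] [DecidableEq b] (s : Matrix b b ℝ → Matrix b b ℝ)
    (hs : ContinuousOn s {P | P.PosDef}) (hsP : ∀ P, P.PosDef → (s P)ᵀ * P * s P = 1)
    (hs1 : s 1 = 1) : ∃ s : Matrix (Unit ⊕ b) (Unit ⊕ b) ℝ → Matrix (Unit ⊕ b) (Unit ⊕ b) ℝ,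
      ContinuousOn s {P | P.PosDef} ∧ (∀ P, P.PosDef → (s P)ᵀ * P * s P = 1) ∧ s 1 = 1 := by
  have hD : ∀ P : Matrix (Unit ⊕ b) (Unit ⊕ b) ℝ, P.PosDef →
      ((elim P)ᵀ * P * elim P).toBlocks₂₂.PosDef := fun P hP => by
    obtain ⟨D, hD, h⟩ := elim_spec hP
    rwa [h, toBlocks_fromBlocks₂₂]
  refine ⟨fun P => elim P * fromBlocks 1 0 0 (s ((elim P)ᵀ * P * elim P).toBlocks₂₂), ?_,
    fun P hP => ?_, ?_⟩
  · have h1 : ContinuousOn (fun P => (elim (b := b) P)ᵀ * P * elim P) {P | P.PosDef} :=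
      (continuous_id.matrix_transpose.comp_continuousOn continuousOn_elim).mul continuousOn_id |>.mul
        continuousOn_elim
    refine continuousOn_elim.mul (continuousOn_pi.2 fun i => continuousOn_pi.2 fun k => ?_)
    have h2 : ContinuousOn (fun P => s ((elim P)ᵀ * P * elim P).toBlocks₂₂) {P | P.PosDef} :=
      hs.comp ((continuous_matrix fun i k => continuous_id.matrix_elem _ _ :
        Continuous (toBlocks₂₂ : Matrix (Unit ⊕ b) (Unit ⊕ b) ℝ → _)).comp_continuousOn h1) hD
    rcases i with i | i <;> rcases k with k | k
    · exact continuousOn_const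
    · exact continuousOn_const
    · exact continuousOn_const
    · exact continuousOn_pi.1 (continuousOn_pi.1 h2 i) k
  · obtain ⟨D, hD, h⟩ := elim_spec hP
    beta_reduce
    rw [h, toBlocks_fromBlocks₂₂, transpose_mul, Matrix.mul_assoc, Matrix.mul_assoc,
      ← Matrix.mul_assoc P, ← Matrix.mul_assoc (elim P)ᵀ, ← Matrix.mul_assoc (elim P)ᵀ, h,
      fromBlocks_transpose, fromBlocks_multiply, fromBlocks_multiply]
    have := hsP D hD
    rw [Matrix.mul_assoc] at this
    simp [this]
  · have : elim (1 : Matrix (Unit ⊕ b) (Unit ⊕ b) ℝ) = 1 := by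
      ext i k
      rcases i with i | i <;> rcases k with k | k <;> simp [elim, toBlocks₁₂, Matrix.one_apply]
    simp only [this, transpose_one, one_mul]
    rw [← fromBlocks_one, toBlocks_fromBlocks₂₂, hs1]

/-- The existence of a continuous Cholesky decomposition. -/
theorem exists_cholesky (n : Type) [Finite n] : ∀ [Fintype n] [DecidableEq n],
    ∃ s : Matrix n n ℝ → Matrix n n ℝ, ContinuousOn s {P | P.PosDef} ∧
      (∀ P, P.PosDef → (s P)ᵀ * P * s P = 1) ∧ s 1 = 1 := by
  have equiv : ∀ {b b' : Type} (e : b ≃ b'), (∀ [Fintype b] [DecidableEq b],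
      ∃ s : Matrix b b ℝ → Matrix b b ℝ, ContinuousOn s {P | P.PosDef} ∧
      (∀ P, P.PosDef → (s P)ᵀ * P * s P = 1) ∧ s 1 = 1) → ∀ [Fintype b'] [DecidableEq b'],
      ∃ s : Matrix b' b' ℝ → Matrix b' b' ℝ, ContinuousOn s {P | P.PosDef} ∧
      (∀ P, P.PosDef → (s P)ᵀ * P * s P = 1) ∧ s 1 = 1 := by
    intro b b' e ih _ _
    classical
    let _ : Fintype b := Fintype.ofEquiv b' e.symm
    obtain ⟨s, hs, hsP, hs1⟩ := ih
    have hpos : ∀ P : Matrix b' b' ℝ, P.PosDef → (reindex e.symm e.symm P).PosDef := fun P hP =>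
      hP.submatrix e.injective
    refine ⟨fun P => reindex e e (s (reindex e.symm e.symm P)), ?_, fun P hP => ?_, ?_⟩
    · exact (continuous_reindex e).comp_continuousOn
        (hs.comp (continuous_reindex e.symm).continuousOn hpos)
    · have := congrArg (reindexAlgEquiv ℝ ℝ e) (hsP _ (hpos P hP))
      simpa [map_mul] using this
    · simp [hs1]
  induction n using Finite.induction_empty_option with
  | of_equiv e ih => exact equiv e ih
  | h_empty =>
    intro _ _
    exact ⟨id, continuousOn_id, fun P _ => Subsingleton.elim _ _, rfl⟩
  | h_option ih =>
    rename_i b _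
    have e : Unit ⊕ b ≃ Option b := (Equiv.sumComm _ _).trans (Equiv.optionEquivSumPUnit b).symm
    refine @equiv (Unit ⊕ b) (Option b) e ?_
    clear equiv
    intro i₁ i₂
    classical
    obtain rfl : i₁ = instFintypeSum Unit b := Subsingleton.elim _ _
    obtain rfl : i₂ = instDecidableEqSum := Subsingleton.elim _ _
    obtain ⟨s, hs, hsP, hs1⟩ := ih
    exact exists_cholesky_sum s hs hsP hs1

end Cholesky

section Orth

/-- The set of orthogonal matrices. -/
def Os (n : Type) [Fintype n] [DecidableEq n] : Set (Matrix n n ℝ) :=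
  {x | x ∈ Matrix.orthogonalGroup n ℝ}

theorem mem_Os {x : Matrix n n ℝ} : x ∈ Os n ↔ xᵀ * x = 1 :=
  mem_orthogonalGroup_iff' _ _

theorem Os_subset : Os n ⊆ GLs n := fun x hx =>
  IsUnit.of_mul_eq_one_right xᵀ (mem_Os.1 hx)

/-- The invertible matrices retract by deformation to the orthogonal ones. -/
theorem exists_retraction (n : Type) [Fintype n] [DecidableEq n] :
    ∃ H : I × Matrix n n ℝ → Matrix n n ℝ, ContinuousOn H {p | p.2 ∈ GLs n} ∧
      (∀ t, ∀ x ∈ GLs n, H (t, x) ∈ GLs n) ∧ (∀ x ∈ GLs n, H (0, x) = x) ∧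
      (∀ x ∈ GLs n, H (1, x) ∈ Os n) ∧ ∀ t, ∀ x ∈ Os n, H (t, x) = x := by
  obtain ⟨s, hs, hsP, hs1⟩ := exists_cholesky n
  have hpos : ∀ t : I, ∀ x ∈ GLs n, ((1 - (t : ℝ)) • (1 : Matrix n n ℝ) + (t : ℝ) • (xᵀ * x)).PosDef := by
    intro t x hx
    have h1 : (xᵀ * x).PosDef := by
      have := PosDef.conjTranspose_mul_self x (mulVec_injective_of_isUnit hx)
      rwa [conjTranspose_eq_transpose_of_trivial] at this
    rcases eq_or_lt_of_le t.2.2 with h | h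
    · simpa [h] using h1
    · exact (PosDef.one.smul (sub_pos.2 h)).add_posSemidef (h1.posSemidef.smul t.2.1)
  refine ⟨fun p => p.2 * s ((1 - (p.1 : ℝ)) • (1 : Matrix n n ℝ) + (p.1 : ℝ) • (p.2ᵀ * p.2)),
    ?_, fun t x hx => ?_, fun x hx => ?_, fun x hx => ?_, fun t x hx => ?_⟩
  · refine continuous_snd.continuousOn.mul (hs.comp (Continuous.continuousOn ?_)
      fun p hp => hpos p.1 p.2 hp)
    fun_prop
  · have := hsP _ (hpos t x hx)
    exact IsUnit.mul hx (IsUnit.of_mul_eq_one_right _ this)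
  · simp [hs1]
  · have := hsP _ (hpos 1 x hx)
    rw [mem_Os, transpose_mul]
    simpa [Matrix.mul_assoc] using this
  · beta_reduce
    rw [mem_Os.1 hx, ← add_smul, sub_add_cancel, one_smul, hs1, mul_one]

variable {j : ℕ}

theorem exists_orth {f : (Fin j → I) → Matrix n n ℝ}
    (hf : IsLoop (GLs n) 1 f) : ∃ g : (Fin j → I) → Matrix n n ℝ, IsLoop (Os n) 1 g ∧
      HtpyRel (GLs n) (Cube.boundary (Fin j)) f g := by
  obtain ⟨H, hc, hm, h0, h1, hO⟩ := exists_retraction n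
  have h1O : (1 : Matrix n n ℝ) ∈ Os n := mem_Os.2 (by simp)
  have hA : ∀ t, ∀ x ∈ Cube.boundary (Fin j), H (t, f x) = f x := fun t x hx => by
    rw [hf.bdry x hx, hO t _ h1O]
  have hH : Continuous fun p : I × (Fin j → I) => H (p.1, f p.2) :=
    hc.comp_continuous (continuous_fst.prodMk (hf.cont.comp continuous_snd)) fun p => hf.mem _
  exact ⟨fun x => H (1, f x), ⟨hH.comp (continuous_const.prodMk continuous_id),
    fun x => h1 _ (hf.mem x), fun x hx => by rw [hA 1 x hx, hf.bdry x hx]⟩,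
    fun p => H (p.1, f p.2), hH, fun p => hm _ _ (hf.mem _), fun x => h0 _ (hf.mem x),
    fun x => rfl, hA⟩

theorem HtpyRel.orth {A : Set (Fin j → I)} {f g : (Fin j → I) → Matrix n n ℝ}
    (R : HtpyRel (GLs n) A f g) (hf : ∀ x, f x ∈ Os n) (hg : ∀ x, g x ∈ Os n) :
    HtpyRel (Os n) A f g := by
  obtain ⟨H, hc, hm, h0, h1, hO⟩ := exists_retraction n
  obtain ⟨K, kc, km, k0, k1, kA⟩ := R
  refine ⟨fun p => H (1, K p), hc.comp_continuous (continuous_const.prodMk kc) fun p => km p,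
    fun p => h1 _ (km p), fun x => ?_, fun x => ?_, fun t x hx => ?_⟩
  · beta_reduce; rw [k0, hO _ _ (hf x)]
  · beta_reduce; rw [k1, hO _ _ (hg x)]
  · beta_reduce; rw [kA t x hx, hO _ _ (hf x)]

end Orth

end Bott

open scoped Topology

namespace Bott

open unitInterval Set Matrix

section LoopIso

variable {E E' : Type} [TopologicalSpace E] [TopologicalSpace E'] {Y : Set E} {Y' : Set E'} {e : E}
  {e' : E'} {m m' : ℕ}

/-- The generalized loop associated with a loop in a subset. -/
def IsLoop.toGenLoop {f : (Fin m → I) → E} (hf : IsLoop Y e f) (he : e ∈ Y) :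
    GenLoop (Fin m) Y ⟨e, he⟩ :=
  ⟨⟨fun x => ⟨f x, hf.mem x⟩, hf.cont.subtype_mk _⟩, fun x hx => Subtype.ext (hf.bdry x hx)⟩

theorem isLoop_genLoop {he : e ∈ Y} (p : GenLoop (Fin m) Y ⟨e, he⟩) :
    IsLoop Y e fun x => (p x : E) :=
  ⟨continuous_subtype_val.comp p.1.continuous, fun x => (p x).2,
    fun x hx => congrArg Subtype.val (p.2 x hx)⟩

theorem IsLoop.homotopic_iff {f g : (Fin m → I) → E} (hf : IsLoop Y e f) (hg : IsLoop Y e g)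
    (he : e ∈ Y) : GenLoop.Homotopic (hf.toGenLoop he) (hg.toGenLoop he) ↔
      HtpyRel Y (Cube.boundary (Fin m)) f g := by
  constructor
  · rintro ⟨H⟩
    exact ⟨fun p => H p, continuous_subtype_val.comp H.continuous, fun p => (H p).2,
      fun x => congrArg Subtype.val (H.apply_zero x), fun x => congrArg Subtype.val (H.apply_one x),
      fun t x hx => congrArg Subtype.val (H.eq_fst t hx)⟩
  · rintro ⟨H, hc, hm, h0, h1, hA⟩
    exact ⟨⟨⟨⟨fun p => ⟨H p, hm p⟩, hc.subtype_mk _⟩, fun x => Subtype.ext (h0 x),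
      fun x => Subtype.ext (h1 x)⟩, fun t x hx => Subtype.ext (hA t x hx)⟩⟩

/-- An operation on loops which is bijective up to homotopy and compatible with concatenation. -/
structure LoopIso (Y : Set E) (e : E) (Y' : Set E') (e' : E') (i : Fin m) (i' : Fin m')
    (Φ : ((Fin m → I) → E) → (Fin m' → I) → E') : Prop where
  loop : ∀ {f}, IsLoop Y e f → IsLoop Y' e' (Φ f)
  htpy : ∀ {f g}, IsLoop Y e f → IsLoop Y e g → HtpyRel Y (Cube.boundary (Fin m)) f g →
    HtpyRel Y' (Cube.boundary (Fin m')) (Φ f) (Φ g)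
  inj : ∀ {f g}, IsLoop Y e f → IsLoop Y e g →
    HtpyRel Y' (Cube.boundary (Fin m')) (Φ f) (Φ g) → HtpyRel Y (Cube.boundary (Fin m)) f g
  surj : ∀ {a}, IsLoop Y' e' a →
    ∃ f, IsLoop Y e f ∧ HtpyRel Y' (Cube.boundary (Fin m')) a (Φ f)
  tr_eq : ∀ f g, Φ (tr i f g) = tr i' (Φ f) (Φ g)

theorem LoopIso.nonempty_mulEquiv {i : Fin (m + 1)} {i' : Fin (m' + 1)}
    {Φ : ((Fin (m + 1) → I) → E) → (Fin (m' + 1) → I) → E'} (L : LoopIso Y e Y' e' i i' Φ)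
    (he : e ∈ Y) (he' : e' ∈ Y') : Nonempty (π_ (m + 1) Y ⟨e, he⟩ ≃* π_ (m' + 1) Y' ⟨e', he'⟩) := by
  let F : π_ (m + 1) Y ⟨e, he⟩ → π_ (m' + 1) Y' ⟨e', he'⟩ :=
    Quotient.map (fun p => (L.loop (isLoop_genLoop p)).toGenLoop he') fun p q h =>
      (IsLoop.homotopic_iff _ _ he').2 (L.htpy (isLoop_genLoop p) (isLoop_genLoop q)
        ((IsLoop.homotopic_iff (isLoop_genLoop p) (isLoop_genLoop q) he).1 h))
  refine ⟨MulEquiv.ofBijective (MonoidHom.mk' F fun p q => ?_) ⟨fun p q => ?_, fun p => ?_⟩⟩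
  · refine Quotient.inductionOn₂ p q fun p q => ?_
    refine (congrArg F (HomotopyGroup.mul_spec (i := i) (p := p) (q := q))).trans
      (Eq.trans ?_ (HomotopyGroup.mul_spec (i := i')).symm)
    refine congrArg (Quotient.mk _) ?_
    refine Subtype.ext (ContinuousMap.ext fun x => Subtype.ext ?_)
    refine (congrFun (congrArg Φ ?_) x).trans
      ((congrFun (L.tr_eq (fun x => (q x : E)) fun x => (p x : E)) x).trans ?_)
    · funext t
      exact apply_ite (Subtype.val : Y → E) ((t i : ℝ) ≤ 1 / 2) _ _
    · rw [Bott.tr]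
      refine Eq.trans ?_ (apply_ite (Subtype.val : Y' → E') ((x i' : ℝ) ≤ 1 / 2) _ _).symm
      rfl
  · refine Quotient.inductionOn₂ p q fun p q h => ?_
    have h' := (IsLoop.homotopic_iff _ _ he').1 (Quotient.exact h)
    exact Quotient.sound ((IsLoop.homotopic_iff (isLoop_genLoop p) (isLoop_genLoop q) he).2
      (L.inj (isLoop_genLoop p) (isLoop_genLoop q) h'))
  · refine Quotient.inductionOn p fun p => ?_
    obtain ⟨f, hf, R⟩ := L.surj (isLoop_genLoop p)
    exact ⟨⟦hf.toGenLoop he⟧, Quotient.sound ((IsLoop.homotopic_iff (L.loop hf)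
      (isLoop_genLoop p) he').2 R.symm)⟩

end LoopIso

section Instances

variable {n a : Type} [Fintype n] [DecidableEq n] [Fintype a] [DecidableEq a] {m m' : ℕ}
variable {β κ ι : Type} [Fintype κ] [DecidableEq κ] [Fintype ι] [DecidableEq ι] [Fintype β]
  [DecidableEq β]

/-- The homotopy groups of the orthogonal group and of the general linear group agree. -/
theorem loopIso_orth (i : Fin m) : LoopIso (Os n) 1 (GLs n) 1 i i id where
  loop hf := ⟨hf.cont, fun x => Os_subset (hf.mem x), hf.bdry⟩
  htpy _ _ R := R.mono subset_rfl Os_subset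
  inj hf hg R := R.orth hf.mem hg.mem
  surj ha := exists_orth ha
  tr_eq _ _ := rfl

/-- The homotopy groups of a large general linear group are those of a smaller one. -/
theorem loopIso_stab {b : Type} [Fintype b] [DecidableEq b] (hm : m + 1 < Fintype.card a)
    (e : b ⊕ a ≃ n) (i : Fin m) :
    LoopIso (GLs a) 1 (GLs n) 1 i i fun f x => reindex e e (fromBlocks 1 0 0 (f x)) where
  loop hf := ⟨(continuous_reindex e).comp (continuous_const.matrix_fromBlocks continuous_const
      continuous_const hf.cont), fun x => by
        rw [reindex_mem_GLs, mem_GLs, det_fromBlocks_zero₂₁, det_one, one_mul]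
        exact mem_GLs.1 (hf.mem x),
      fun x hx => by rw [hf.bdry x hx, fromBlocks_one]; simp⟩
  htpy _ _ R := (R.map (Y' := GLs (b ⊕ a)) (fun _ y => fromBlocks 1 0 0 y)
      (continuous_const.matrix_fromBlocks continuous_const continuous_const continuous_snd)
      fun _ y hy => by
        rw [mem_GLs, det_fromBlocks_zero₂₁, det_one, one_mul]; exact mem_GLs.1 hy).reindex e
  inj _ _ R := ((R.reindex e.symm).congr (fun x => by simp) fun x => by simp).destabilize hm
  surj {f} hf := by
    obtain ⟨c, hc, R⟩ := exists_destabilize (Nat.lt_of_succ_lt hm)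
      (f := fun x => reindex e.symm e.symm (f x)) ⟨(continuous_reindex _).comp hf.cont,
        fun x => (reindex_mem_GLs _).2 (hf.mem x), fun x hx => by rw [hf.bdry x hx]; simp⟩
    exact ⟨c, hc, (R.reindex e).congr (fun x => by simp) fun x => rfl⟩
  tr_eq f g := tr_comp (fun y => reindex e e (fromBlocks 1 0 0 y)) i f g

theorem Ident.loopIso {S : Set (Matrix ι ι ℝ)} {J : Matrix ι ι ℝ} (P : Ident β S J) (κ : Type)
    [Fintype κ] [DecidableEq κ] (i : Fin m) : LoopIso (GLs (κ × β)) 1 (US S κ) (scalar κ J) i i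
      fun f x => P.ψ κ (unflat (f x)) where
  loop hf := P.loop_ψ ⟨continuous_unflat.comp hf.cont, fun x => unflat_mem (hf.mem x),
    fun x hx => by rw [hf.bdry x hx, unflat_one]⟩
  htpy _ _ R := P.htpy_ψ (R.map (fun _ y => unflat y) (continuous_unflat.comp continuous_snd)
    fun _ y hy => unflat_mem hy)
  inj _ _ R := ((P.htpy_χ R).map (Y' := GLs (κ × β)) (fun _ y => flat y)
    (continuous_flat.comp continuous_snd) fun _ y hy => flat_mem hy).congr
      (fun x => by rw [P.χ_ψ, flat_unflat]) fun x => by rw [P.χ_ψ, flat_unflat]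
  surj {f} hf := by
    have h := P.loop_χ hf
    refine ⟨fun x => flat (P.χ κ (f x)), ⟨continuous_flat.comp h.cont, fun x => flat_mem (h.mem x),
      fun x hx => by rw [h.bdry x hx, flat_one]⟩, (HtpyRel.refl hf.cont hf.mem).congr
        (fun x => rfl) fun x => ?_⟩
    rw [unflat_flat, P.ψ_χ (hf.mem x)]
  tr_eq f g := tr_comp (fun y => P.ψ κ (unflat y)) i f g

theorem StabIso.loopIso {S S' : Set (Matrix ι ι ℝ)} {j j' : Matrix ι ι ℝ} {i : Fin m} {i' : Fin m'}
    {β' : Type} [Fintype β'] [DecidableEq β'] (P : StabIso S S' j j' i i') (Q : Ident β S j)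
    (Q' : Ident β' S' j') (κ : Type) [Fintype κ] [DecidableEq κ]
    (hm : m + 1 < Fintype.card κ * Fintype.card β) (hm' : m' + 1 < Fintype.card κ * Fintype.card β') :
    LoopIso (US S κ) (scalar κ j) (US S' κ) (scalar κ j') i i' (P.Γ κ) where
  loop hf := P.loop hf
  htpy _ _ R := P.htpy R
  inj hf hg R := by
    obtain ⟨κ', _, _, R'⟩ := P.inj hf hg R
    exact Q.destabilize hm hf.mem hg.mem R'
  surj ha := by
    obtain ⟨κ', _, _, b, hb, R⟩ := P.surj ha
    obtain ⟨c, hc, R'⟩ := Q.exists_destabilize (Nat.lt_of_succ_lt hm) hb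
    refine ⟨c, hc, Q'.destabilize (κ' := κ') hm' ha.mem (P.loop hc).mem (R.trans ?_)⟩
    have := P.htpy R'
    rwa [P.bs_eq] at this
  tr_eq f g := P.tr_eq κ f g

end Instances

/-- Independence of the homotopy groups of large orthogonal groups of the size. -/
theorem nonempty_mulEquiv_orth {a n : Type} [Fintype a] [DecidableEq a] [Fintype n] [DecidableEq n]
    {k : ℕ} (hk : k + 2 < Fintype.card a) (h : Fintype.card a ≤ Fintype.card n) :
    Nonempty (π_ (k + 1) (Os n) ⟨1, mem_Os.2 (by simp)⟩ ≃* π_ (k + 1) (GLs a) ⟨1, isUnit_one⟩) := by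
  have e : Fin (Fintype.card n - Fintype.card a) ⊕ a ≃ n := Fintype.equivOfCardEq (by simp; omega)
  obtain ⟨f⟩ := (loopIso_orth (n := n) (0 : Fin (k + 1))).nonempty_mulEquiv
    (mem_Os.2 (by simp)) isUnit_one
  obtain ⟨g⟩ := (loopIso_stab hk e (0 : Fin (k + 1))).nonempty_mulEquiv isUnit_one isUnit_one
  exact ⟨f.trans g.symm⟩

theorem orthogonal_periodicity (k n m : ℕ) (hn : 32 * (k + 11) ≤ n) (hm : 32 * (k + 11) ≤ m) :
    Nonempty (π_ (k + 1) (Os (Fin n)) ⟨1, mem_Os.2 (by simp)⟩ ≃*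
      π_ (k + 1 + 8) (Os (Fin m)) ⟨1, mem_Os.2 (by simp)⟩) := by
  obtain ⟨f⟩ := nonempty_mulEquiv_orth (a := Fin (k + 11) × Fin 2) (n := Fin n) (k := k)
    (by simp; omega) (by simp; omega)
  obtain ⟨g⟩ := (identEight.loopIso (Fin (k + 11)) (0 : Fin (k + 1))).nonempty_mulEquiv isUnit_one
    ((gens.stabIso (0 : Fin (k + 1))).base _)
  obtain ⟨h⟩ := ((gens.stabIso (0 : Fin (k + 1))).loopIso identEight (identZero hk) (Fin (k + 11))
    (by simp; omega) (by simp; omega)).nonempty_mulEquiv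
    ((gens.stabIso (0 : Fin (k + 1))).base _) ((gens.stabIso (0 : Fin (k + 1))).base' _)
  obtain ⟨g'⟩ := ((identZero hk).loopIso (Fin (k + 11)) (0 : Fin (k + 1 + 8))).nonempty_mulEquiv
    isUnit_one ((gens.stabIso (0 : Fin (k + 1))).base' _)
  obtain ⟨f'⟩ := nonempty_mulEquiv_orth
    (a := Fin (k + 11) × ((Fin 8 × Fin 2) ⊕ (Fin 8 × Fin 2))) (n := Fin m) (k := k + 8)
    (by simp; omega) (by simp; omega)
  exact ⟨f.trans (g.trans (h.trans (g'.symm.trans f'.symm)))⟩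

end Bott

theorem bott_periodicity_orthogonal (k : ℕ) :
    ∃ N : ℕ, ∀ n m : ℕ, N ≤ n → N ≤ m →
      Nonempty ((π_ (k + 1) (Matrix.orthogonalGroup (Fin n) ℝ) 1) ≃*
        (π_ (k + 1 + 8) (Matrix.orthogonalGroup (Fin m) ℝ) 1)) :=
  ⟨32 * (k + 11), fun n m hn hm => Bott.orthogonal_periodicity k n m hn hm⟩
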